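/- Let K be an algebraically closed field (of any characteristic) and n ≥ 4. The projective dimension of the coordinate ring O_{1,3,n} of the Kalman variety K_{1,3,n}, as a module over the polynomial ring A, equals 3n − 11. -/

import Mathlib

set_option synthInstance.maxHeartbeats 1000000
set_option maxHeartbeats 4000000

open Matrix

/-- The span of the first `d` standard basis vectors of `K^n`. -/
def firstCoordsSubspace (K : Type*) [Field K] (n d : ℕ) : Submodule K (Fin n → K) where
  carrier := {v | ∀ i : Fin n, d ≤ (i : ℕ) → v i = 0}
  add_mem' := fun hv hw i hi => by simp [hv i hi, hw i hi]
  zero_mem' := fun i _ => rfl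
  smul_mem' := fun c v hv i hi => by simp [hv i hi]

/-- The Kalman variety `K_{s,d,n}`: matrices having an `s`-dimensional invariant
subspace contained in the span `L` of the first `d` standard basis vectors. -/
def kalmanSet (K : Type*) [Field K] (n d s : ℕ) : Set (Matrix (Fin n) (Fin n) K) :=
  {M | ∃ U : Submodule K (Fin n → K), U ≤ firstCoordsSubspace K n d ∧
    Module.finrank K U = s ∧ ∀ v ∈ U, M.mulVec v ∈ U}

/-- The upper-left `d × d` block `α` of an `n × n` matrix. -/
def alphaBlock {K : Type*} [Field K] {n : ℕ} (d : ℕ) (h : d ≤ n)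
    (M : Matrix (Fin n) (Fin n) K) : Matrix (Fin d) (Fin d) K :=
  fun i j => M (Fin.castLE h i) (Fin.castLE h j)

/-- The lower-left `(n-d) × d` block `γ` of an `n × n` matrix. -/
def gammaBlock {K : Type*} [Field K] {n : ℕ} (d : ℕ) (h : d ≤ n)
    (M : Matrix (Fin n) (Fin n) K) : Matrix (Fin (n - d)) (Fin d) K :=
  fun i j => M ⟨d + (i : ℕ), by have := i.isLt; omega⟩ (Fin.castLE h j)

/-- The reduced Kalman matrix: the `d(n-d) × d` matrix obtained by stacking
`γ, γα, γα², …, γα^{d-1}`; row `(k, i)` is row `i` of the block `γ * α^k`. -/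
def redKalman {K : Type*} [Field K] {n : ℕ} (d : ℕ) (h : d ≤ n)
    (M : Matrix (Fin n) (Fin n) K) : Matrix (Fin d × Fin (n - d)) (Fin d) K :=
  fun p j => (gammaBlock d h M * (alphaBlock d h M) ^ (p.1 : ℕ)) p.2 j

/-- The vanishing ideal of a set of `n × n` matrices, inside the polynomial
coordinate ring `A = K[x_{ij}]` of the matrix space. -/
def matVanishingIdeal (K : Type*) [Field K] (n : ℕ)
    (S : Set (Matrix (Fin n) (Fin n) K)) : Ideal (MvPolynomial (Fin n × Fin n) K) where
  carrier := {f | ∀ M ∈ S, MvPolynomial.eval (fun p => M p.1 p.2) f = 0}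
  add_mem' := fun ha hb M hM => by simp [ha M hM, hb M hM]
  zero_mem' := fun M hM => by simp
  smul_mem' := fun c f hf M hM => by simp [smul_eq_mul, hf M hM]

/-- The coordinate ring `A` of the space of `n × n` matrices. -/
abbrev MatCoordRing (K : Type*) [Field K] (n : ℕ) := MvPolynomial (Fin n × Fin n) K

/-- The vanishing ideal `I_{s,d,n}` of the Kalman variety. -/
noncomputable def kalmanIdeal (K : Type*) [Field K] (n d s : ℕ) :
    Ideal (MatCoordRing K n) :=
  matVanishingIdeal K n (kalmanSet K n d s)

/-- The irrelevant (maximal graded) ideal `A₊` of the polynomial ring,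
generated by all the variables. -/
noncomputable def irrelevantIdeal (K : Type*) [Field K] (n : ℕ) :
    Ideal (MatCoordRing K n) :=
  Ideal.span (Set.range MvPolynomial.X)

/-- The coordinate ring `O_{s,d,n} = A/I_{s,d,n}` of the Kalman variety. -/
abbrev KalmanCoordRing (K : Type*) [Field K] (n d s : ℕ) :=
  MatCoordRing K n ⧸ kalmanIdeal K n d s

/-- The normalization `Õ_{s,d,n}`: the integral closure of `O_{s,d,n}` in its
total ring of fractions (which is its field of fractions when `O_{s,d,n}` is a
domain, e.g. when `K` is algebraically closed). -/
def KalmanNormalization (K : Type*) [Field K] (n d s : ℕ) : Type _ :=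
  ↥(integralClosure (KalmanCoordRing K n d s) (FractionRing (KalmanCoordRing K n d s)))

noncomputable instance (K : Type*) [Field K] (n d s : ℕ) :
    CommRing (KalmanNormalization K n d s) :=
  Subalgebra.toCommRing (R := KalmanCoordRing K n d s)
    (A := FractionRing (KalmanCoordRing K n d s)) (integralClosure _ _)

noncomputable instance (K : Type*) [Field K] (n d s : ℕ) :
    Algebra (KalmanCoordRing K n d s) (KalmanNormalization K n d s) :=
  Subalgebra.algebra (R := KalmanCoordRing K n d s)
    (A := FractionRing (KalmanCoordRing K n d s)) (integralClosure _ _)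

noncomputable instance (K : Type*) [Field K] (n d s : ℕ) :
    Algebra (MatCoordRing K n) (KalmanNormalization K n d s) :=
  ((algebraMap (KalmanCoordRing K n d s) (KalmanNormalization K n d s)).comp
    (algebraMap (MatCoordRing K n) (KalmanCoordRing K n d s))).toAlgebra

instance (K : Type*) [Field K] (n d s : ℕ) :
    IsScalarTower (MatCoordRing K n) (KalmanCoordRing K n d s)
      (KalmanNormalization K n d s) :=
  IsScalarTower.of_algebraMap_eq' (R := MatCoordRing K n)
    (S := KalmanCoordRing K n d s) (A := KalmanNormalization K n d s) rfl

noncomputable instance (K : Type*) [Field K] (n d s : ℕ) :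
    Algebra K (KalmanNormalization K n d s) :=
  ((algebraMap (KalmanCoordRing K n d s) (KalmanNormalization K n d s)).comp
    (algebraMap K (KalmanCoordRing K n d s))).toAlgebra

instance (K : Type*) [Field K] (n d s : ℕ) :
    IsScalarTower K (MatCoordRing K n) (KalmanNormalization K n d s) :=
  IsScalarTower.of_algebraMap_eq fun x => by
    show algebraMap (KalmanCoordRing K n d s) _ (algebraMap K _ x) =
      algebraMap (KalmanCoordRing K n d s) _
        (algebraMap (MatCoordRing K n) _ (algebraMap K (MatCoordRing K n) x))
    rw [← IsScalarTower.algebraMap_apply K (MatCoordRing K n) (KalmanCoordRing K n d s)]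

/-- The inclusion of `O_{s,d,n}` into its normalization `Õ_{s,d,n}`,
as an `A`-module map. -/
noncomputable def kalmanNormInclusion (K : Type*) [Field K] (n d s : ℕ) :
    KalmanCoordRing K n d s →ₗ[MatCoordRing K n] KalmanNormalization K n d s :=
  (IsScalarTower.toAlgHom (MatCoordRing K n) (KalmanCoordRing K n d s)
    (KalmanNormalization K n d s)).toLinearMap

universe u v

/-- `projDimLE R k M` means that `M` admits a projective resolution of length
at most `k`, i.e. the projective dimension of `M` is `≤ k`. -/
def projDimLE (R : Type u) [Ring R] :
    ℕ → (M : Type max u v) → [AddCommGroup M] → [Module R M] → Prop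
  | 0, M, _, _ => Module.Projective R M
  | (k + 1), M, _, _ =>
      ∃ (P : Type max u v) (_ : AddCommGroup P) (_ : Module R P)
        (f : P →ₗ[R] M), Module.Projective R P ∧ Function.Surjective f ∧
          projDimLE R k (LinearMap.ker f)

/-- `projDimEq R M k` means that the projective dimension of the `R`-module `M`
equals `k` (in particular it is finite). -/
def projDimEq (R : Type u) [Ring R] (M : Type max u v) [AddCommGroup M]
    [Module R M] (k : ℕ) : Prop :=
  projDimLE R k M ∧ ∀ l : ℕ, projDimLE R l M → k ≤ l

section

open CategoryTheory

/-- Projective dimension at most `n`, for unbundled modules. -/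
def PDLE (R : Type u) [CommRing R] (M : Type u) [AddCommGroup M] [Module R M]
    (n : ℕ) : Prop :=
  HasProjectiveDimensionLE (ModuleCat.of R M) n

namespace PDLE

variable {R : Type u} [CommRing R] {M N L : Type u} [AddCommGroup M] [Module R M]
  [AddCommGroup N] [Module R N] [AddCommGroup L] [Module R L] {n : ℕ}

theorem of_equiv (e : M ≃ₗ[R] N) (h : PDLE R M n) : PDLE R N n :=
  @hasProjectiveDimensionLT_of_iso _ _ _ (ModuleCat.of R M) _ e.toModuleIso _ h

theorem mono {m : ℕ} (h : PDLE R M n) (hnm : n ≤ m) : PDLE R M m :=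
  @hasProjectiveDimensionLT_of_ge _ _ _ (ModuleCat.of R M) (n + 1) (m + 1) (by omega) h

theorem zero_iff : PDLE R M 0 ↔ Module.Projective R M := by
  rw [PDLE, ← projective_iff_hasProjectiveDimensionLE_zero, ← IsProjective.iff_projective]

theorem of_projective [h : Module.Projective R M] (n : ℕ) : PDLE R M n :=
  (zero_iff.2 h).mono (Nat.zero_le n)

theorem shortExact {f : M →ₗ[R] N} {g : N →ₗ[R] L} (hf : Function.Injective f)
    (hfg : Function.Exact f g) (hg : Function.Surjective g) :
    (ShortComplex.mk (ModuleCat.ofHom f) (ModuleCat.ofHom g)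
      (by ext x; exact hfg.apply_apply_eq_zero x)).ShortExact where
  exact := by
    rw [ShortComplex.ShortExact.moduleCat_exact_iff_function_exact]
    exact hfg
  mono_f := by rw [ModuleCat.mono_iff_injective]; exact hf
  epi_g := by rw [ModuleCat.epi_iff_surjective]; exact hg

theorem mid {f : M →ₗ[R] N} {g : N →ₗ[R] L} (hf : Function.Injective f)
    (hfg : Function.Exact f g) (hg : Function.Surjective g)
    (h1 : PDLE R M n) (h3 : PDLE R L n) : PDLE R N n :=
  (shortExact hf hfg hg).hasProjectiveDimensionLT_X₂ _ h1 h3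

theorem left {f : M →ₗ[R] N} {g : N →ₗ[R] L} (hf : Function.Injective f)
    (hfg : Function.Exact f g) (hg : Function.Surjective g)
    (h2 : PDLE R N n) (h3 : PDLE R L (n + 1)) : PDLE R M n :=
  (shortExact hf hfg hg).hasProjectiveDimensionLT_X₁ _ h2 h3

theorem right {f : M →ₗ[R] N} {g : N →ₗ[R] L} (hf : Function.Injective f)
    (hfg : Function.Exact f g) (hg : Function.Surjective g)
    (h1 : PDLE R M n) (h2 : PDLE R N (n + 1)) : PDLE R L (n + 1) :=
  (shortExact hf hfg hg).hasProjectiveDimensionLT_X₃ _ h1 h2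

theorem prod (h1 : PDLE R M n) (h2 : PDLE R N n) : PDLE R (M × N) n :=
  mid (f := LinearMap.inl R M N) (g := LinearMap.snd R M N) LinearMap.inl_injective
    (.inl_snd) LinearMap.snd_surjective h1 h2

theorem pi {r : ℕ} (h : PDLE R M n) : PDLE R (Fin r → M) n := by
  induction r with
  | zero => exact of_projective n
  | succ r ih => exact (h.prod ih).of_equiv (Fin.consLinearEquiv R (fun _ => M))

/-- The kernel of a surjection from a projective module. -/
theorem ker_of_surjective [Module.Projective R N] (g : N →ₗ[R] L) (hg : Function.Surjective g)
    (h : PDLE R L (n + 1)) : PDLE R (LinearMap.ker g) n :=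
  left (f := (LinearMap.ker g).subtype) (g := g) (Submodule.injective_subtype _)
    (LinearMap.exact_subtype_ker_map g) hg (of_projective n) h

theorem of_ker (g : N →ₗ[R] L) (hg : Function.Surjective g)
    (h : PDLE R (LinearMap.ker g) n) (hN : PDLE R N (n + 1)) : PDLE R L (n + 1) :=
  right (f := (LinearMap.ker g).subtype) (g := g) (Submodule.injective_subtype _)
    (LinearMap.exact_subtype_ker_map g) hg h hN

theorem projective_finsupp (R : Type u) [CommRing R] (N : Type u) [AddCommGroup N] [Module R N]
    [Module.Projective R N] (ι : Type u) : Module.Projective R (ι →₀ N) := by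
  classical
  exact Module.Projective.of_equiv' (finsuppLEquivDirectSum R N ι).symm

theorem projective_trans (R R' M : Type u) [CommRing R] [CommRing R'] [Algebra R R']
    [Module.Projective R R'] [AddCommGroup M] [Module R M] [Module R' M] [IsScalarTower R R' M]
    [Module.Projective R' M] : Module.Projective R M := by
  obtain ⟨s, hs⟩ := (Module.projective_def' (R := R') (P := M)).1 inferInstance
  have := projective_finsupp R R' M
  refine Module.Projective.of_split (s.restrictScalars R)
    ((Finsupp.linearCombination R' id).restrictScalars R) ?_
  ext x
  exact LinearMap.congr_fun hs x

/-- Restriction of scalars along a projective ring extension. -/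
theorem restrictScalars {R' : Type u} [CommRing R'] [Algebra R R'] [Module.Projective R R']
    {M : Type u} [AddCommGroup M] [Module R M] [Module R' M] [IsScalarTower R R' M]
    (h : PDLE R' M n) : PDLE R M n := by
  induction n generalizing M with
  | zero =>
    rw [zero_iff] at *
    exact projective_trans R R' M
  | succ n ih =>
    let g : (M →₀ R') →ₗ[R'] M := Finsupp.linearCombination R' id
    have hg : Function.Surjective g := Finsupp.linearCombination_id_surjective R' M
    have h1 := ih (ker_of_surjective g hg h)
    have := projective_finsupp R R' M
    exact of_ker (g.restrictScalars R) hg h1 (of_projective _)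

/-- Transport along a ring isomorphism. -/
theorem of_ringEquiv {R' : Type u} [CommRing R'] (e : R ≃+* R') {M : Type u} [AddCommGroup M]
    [Module R M] [Module R' M] (he : ∀ (r : R) (x : M), r • x = e r • x)
    (h : PDLE R' M n) : PDLE R M n := by
  algebraize [e.toRingHom]
  have : IsScalarTower R R' M := ⟨fun a b c => by
    rw [he, smul_smul]; rfl⟩
  have : Module.Projective R R' := by
    refine Module.Projective.of_equiv' (R := R) (M := R) ?_
    exact { e with map_smul' := fun a b => by simp [RingHom.algebraMap_toAlgebra, Algebra.smul_def] }
  exact restrictScalars h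

section Polynomial
open Polynomial PolynomialModule

variable (P M : Type u) [CommRing P] [AddCommGroup M] [Module P M] [Module P[X] M]
  [IsScalarTower P P[X] M]

/-- Multiplication by the variable. -/
noncomputable def mulX : M →ₗ[P] M := (LinearMap.lsmul P[X] M X).restrictScalars P

/-- The characteristic presentation `M[X] → M[X]` of a `P[X]`-module `M`. -/
noncomputable def charMap : PolynomialModule P M →ₗ[P[X]] PolynomialModule P M :=
  LinearMap.lsmul P[X] _ X -
    { toFun := PolynomialModule.map P (mulX P M)
      map_add' := by simp
      map_smul' := fun p q => by
        rw [PolynomialModule.map_smul]; simp }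

/-- The action map `M[X] → M` of a `P[X]`-module `M`. -/
noncomputable def actMap : PolynomialModule P M →ₗ[P[X]] M :=
  (LinearMap.liftBaseChange P[X] (LinearMap.id : M →ₗ[P] M)) ∘ₗ
    (polynomialTensorProductLEquivPolynomialModule P M).symm.toLinearMap

variable {P M}

theorem actMap_single (k : ℕ) (x : M) : actMap P M (single P k x) = (X ^ k : P[X]) • x := by
  have : single P k x = (polynomialTensorProductLEquivPolynomialModule P M)
      ((X ^ k : P[X]) ⊗ₜ x) := by
    simp [polynomialTensorProductLEquivPolynomialModule, ← monomial_one_right_eq_X_pow,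
      PolynomialModule.lsingle, monomial_smul_single]
  rw [actMap, LinearMap.comp_apply, this]
  simp

theorem charMap_single (k : ℕ) (x : M) :
    charMap P M (single P k x) = single P (k + 1) x - single P k ((X : P[X]) • x) := by
  simp [charMap, mulX, ← monomial_one_one_eq_X, monomial_smul_single, add_comm]

theorem charMap_coeff (q : PolynomialModule P M) (k : ℕ) :
    (charMap P M q).coeff (k + 1) = q.coeff k - (X : P[X]) • q.coeff (k + 1) := by
  induction q using PolynomialModule.induction_linear with
  | zero => simp
  | add p q hp hq =>
    simp only [map_add, PolynomialModule.coeff_add, Finsupp.add_apply, hp, hq, smul_add]; abel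
  | single i x =>
    rw [charMap_single]
    rw [show (single P (i + 1) x - single P i ((X : P[X]) • x)).coeff =
      (single P (i + 1) x).coeff - (single P i ((X : P[X]) • x)).coeff from
      map_sub PolynomialModule.coeffAddEquiv _ _]
    by_cases h : i = k <;> by_cases h' : i = k + 1 <;>
      simp [h, h']

theorem charMap_injective : Function.Injective (charMap P M) := by
  rw [injective_iff_map_eq_zero]
  intro q hq
  have h (k : ℕ) : q.coeff k = (X : P[X]) • q.coeff (k + 1) := by
    have := charMap_coeff q k
    rw [hq] at this
    exact sub_eq_zero.1 (by simpa using this.symm)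
  have h2 (k j : ℕ) : q.coeff k = (X ^ j : P[X]) • q.coeff (k + j) := by
    induction j with
    | zero => simp
    | succ j ih => rw [ih, h, smul_smul, pow_succ, add_assoc]
  ext k
  obtain ⟨N, hN⟩ := q.coeff.support.bddAbove
  rw [h2 k (N + 1), Finsupp.notMem_support_iff.1, smul_zero]
  · simp
  · intro h3
    have := hN h3
    omega

theorem actMap_charMap (q : PolynomialModule P M) : actMap P M (charMap P M q) = 0 := by
  induction q using PolynomialModule.induction_linear with
  | zero => simp
  | add p q hp hq => simp [hp, hq]
  | single i x =>
    simp [charMap_single, actMap_single, smul_smul, pow_succ]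

theorem charMap_actMap_exact : Function.Exact (charMap P M) (actMap P M) := by
  have key (q : PolynomialModule P M) : ∃ r, q = charMap P M r + single P 0 (actMap P M q) := by
    induction q using PolynomialModule.induction_linear with
    | zero => exact ⟨0, by simp⟩
    | add p q hp hq =>
      obtain ⟨r, hr⟩ := hp
      obtain ⟨s, hs⟩ := hq
      refine ⟨r + s, ?_⟩
      nth_rw 1 [hr, hs]
      simp only [map_add, PolynomialModule.single_add]
      abel
    | single k x =>
      induction k generalizing x with
      | zero => exact ⟨0, by simp [actMap_single]⟩
      | succ k ih =>
        obtain ⟨r, hr⟩ := ih ((X : P[X]) • x)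
        refine ⟨r + single P k x, ?_⟩
        rw [actMap_single, smul_smul, ← pow_succ] at hr
        rw [map_add, charMap_single, hr, actMap_single]
        abel
  intro q
  constructor
  · intro h
    obtain ⟨r, hr⟩ := key q
    exact ⟨r, by rw [hr, h]; simp⟩
  · rintro ⟨r, rfl⟩
    exact actMap_charMap r

theorem actMap_surjective : Function.Surjective (actMap P M) := fun x =>
  ⟨single P 0 x, by simp [actMap_single]⟩

theorem polynomial_aux [Module.Projective P M] : PDLE P[X] M 1 := by
  have : Module.Projective P[X] (PolynomialModule P M) :=
    Module.Projective.of_equiv' (polynomialTensorProductLEquivPolynomialModule P M)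
  exact right charMap_injective charMap_actMap_exact actMap_surjective
    (of_projective 0) (of_projective 1)

/-- Passing to a polynomial ring raises the projective dimension by at most one. -/
theorem polynomial {n : ℕ} (h : PDLE P M n) : PDLE P[X] M (n + 1) := by
  induction n generalizing M with
  | zero =>
    rw [zero_iff] at h
    exact polynomial_aux
  | succ n ih =>
    let g : (M →₀ P[X]) →ₗ[P[X]] M := Finsupp.linearCombination P[X] id
    have hg : Function.Surjective g := Finsupp.linearCombination_id_surjective P[X] M
    have := projective_finsupp P P[X] M
    have h1 : PDLE P (LinearMap.ker g) n := ker_of_surjective (g.restrictScalars P) hg h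
    exact of_ker g hg (ih h1) (of_projective _)

end Polynomial

/-- `P'` has relative dimension at most `r` over `P`, in the sense of projective dimensions. -/
def RelDim (P P' : Type u) [CommRing P] [CommRing P'] (f : P →+* P') (r : ℕ) : Prop :=
  ∀ (M : Type u) [AddCommGroup M] [Module P' M] (n : ℕ),
    (letI := Module.compHom M f; PDLE P M n) → PDLE P' M (n + r)

theorem RelDim.comp {P P' P'' : Type u} [CommRing P] [CommRing P'] [CommRing P'']
    {f : P →+* P'} {g : P' →+* P''} {r s : ℕ} (hf : RelDim P P' f r) (hg : RelDim P' P'' g s) :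
    RelDim P P'' (g.comp f) (r + s) := by
  intro M _ _ n h
  rw [← add_assoc]
  apply hg
  let _ := Module.compHom M g
  exact hf M n h

theorem RelDim.equiv {P P' : Type u} [CommRing P] [CommRing P'] (e : P ≃+* P') :
    RelDim P P' e.toRingHom 0 := by
  intro M _ _ n h
  let _ := Module.compHom M e.toRingHom
  refine of_ringEquiv e.symm (fun r x => ?_) h
  change _ = e (e.symm r) • x
  simp

theorem RelDim.polynomial (P : Type u) [CommRing P] :
    RelDim P (Polynomial P) Polynomial.C 1 := by
  intro M _ _ n h
  let _ := Module.compHom M (Polynomial.C : P →+* _)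
  have : IsScalarTower P (Polynomial P) M := ⟨fun a b c => by
    rw [Polynomial.smul_eq_C_mul, mul_smul]; rfl⟩
  exact PDLE.polynomial h

theorem RelDim.congr {P P' : Type u} [CommRing P] [CommRing P'] {f g : P →+* P'} {r : ℕ}
    (h : RelDim P P' f r) (hfg : f = g) : RelDim P P' g r := hfg ▸ h

theorem RelDim.mvPolynomial_fin (P : Type u) [CommRing P] (r : ℕ) :
    RelDim P (MvPolynomial (Fin r) P) MvPolynomial.C r := by
  induction r with
  | zero =>
    refine (RelDim.equiv (MvPolynomial.isEmptyRingEquiv P (Fin 0)).symm).congr ?_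
    ext x; simp
  | succ r ih =>
    refine ((ih.comp (RelDim.polynomial _)).comp (RelDim.equiv
      (MvPolynomial.finSuccEquiv P r).symm.toRingEquiv)).congr ?_
    ext1 x
    exact (MvPolynomial.finSuccEquiv P r).symm.commutes x

theorem RelDim.mvPolynomial (P : Type u) [CommRing P] (ρ : Type) [Fintype ρ] :
    RelDim P (MvPolynomial ρ P) MvPolynomial.C (Fintype.card ρ) := by
  refine ((RelDim.mvPolynomial_fin P (Fintype.card ρ)).comp (RelDim.equiv
      (MvPolynomial.renameEquiv P (Fintype.equivFin ρ)).symm.toRingEquiv)).congr ?_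
  ext x
  simp

/-- Modules projective over a polynomial subring on part of the variables. -/
theorem RelDim.rename (K : Type u) [CommRing K] {τ ρ σ : Type} [Fintype ρ] (e : ρ ⊕ τ ≃ σ) :
    RelDim (MvPolynomial τ K) (MvPolynomial σ K)
      (MvPolynomial.rename (e ∘ Sum.inr)).toRingHom (Fintype.card ρ) := by
  refine ((RelDim.mvPolynomial (MvPolynomial τ K) ρ).comp (RelDim.equiv
      ((MvPolynomial.sumAlgEquiv K ρ τ).symm.trans
        (MvPolynomial.renameEquiv K e)).toRingEquiv)).congr ?_
  ext x <;> simp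

end PDLE

end

section

open CategoryTheory Abelian

namespace PDLE

theorem ext_nonzero_step {R : Type u} [CommRing R] (x : R) {L L' N : Type u} [AddCommGroup L]
    [Module R L] [AddCommGroup L'] [Module R L'] [AddCommGroup N] [Module R N]
    (hL : Function.Injective (LinearMap.lsmul R L x)) (g : L →ₗ[R] L')
    (hg : Function.Surjective g) (hgx : Function.Exact (LinearMap.lsmul R L x) g)
    (hN : ∀ y : N, x • y = 0) (n : ℕ)
    (h : ∃ e : Ext (ModuleCat.of R L) (ModuleCat.of R N) n, e ≠ 0) :
    ∃ e : Ext (ModuleCat.of R L') (ModuleCat.of R N) (n + 1), e ≠ 0 := by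
  obtain ⟨e, he⟩ := h
  have hS := shortExact hL hgx hg
  refine ⟨hS.extClass.comp e (add_comm 1 n), fun h0 => he ?_⟩
  obtain ⟨x₂, hx₂⟩ := Ext.contravariant_sequence_exact₁ hS _ e (add_comm 1 n) h0
  rw [← hx₂]
  have h1 : ModuleCat.ofHom (LinearMap.lsmul R L x) = x • 𝟙 (ModuleCat.of R L) := by
    ext y; rfl
  have h2 : x • 𝟙 (ModuleCat.of R N) = 0 := by
    ext y; exact hN y
  change (Ext.mk₀ (ModuleCat.ofHom (LinearMap.lsmul R L x))).comp x₂ (zero_add n) = 0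
  rw [h1, Ext.mk₀_smul, Ext.smul_comp, Ext.mk₀_id_comp, Ext.smul_eq_comp_mk₀, h2]
  simp

section
open MvPolynomial
variable (K : Type u) [CommRing K] {σ : Type}

theorem ext_coordinate_nonzero [DecidableEq σ] (s : Finset σ) {N : Type u} [AddCommGroup N]
    [Module (MvPolynomial σ K) N] [Nontrivial N]
    (hN : ∀ i ∈ s, ∀ y : N, (X i : MvPolynomial σ K) • y = 0) :
    ∃ e : Ext (ModuleCat.of (MvPolynomial σ K) (MvPolynomial σ K ⧸ Ideal.span
      (X '' (s : Set σ) : Set (MvPolynomial σ K)))) (ModuleCat.of _ N) s.card, e ≠ 0 := by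
  induction s using Finset.induction_on with
  | empty =>
    obtain ⟨y, hy⟩ := exists_ne (0 : N)
    let f : (MvPolynomial σ K ⧸ Ideal.span
      (X '' ((∅ : Finset σ) : Set σ) : Set (MvPolynomial σ K))) →ₗ[MvPolynomial σ K] N :=
      Submodule.liftQ _ (LinearMap.toSpanSingleton _ N y) (by simp)
    have hf : f (Submodule.Quotient.mk 1) = y :=
      (Submodule.liftQ_apply _ _ _).trans (one_smul _ y)
    refine ⟨Ext.mk₀ (ModuleCat.ofHom f), fun h0 => hy ?_⟩
    have := (Ext.mk₀_bijective _ _).1 (h0.trans (Ext.mk₀_zero _ _).symm)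
    rw [← hf]
    exact congrArg (fun g => g.hom (Submodule.Quotient.mk 1)) this
  | insert i s his ih =>
    rw [Finset.card_insert_of_notMem his]
    have hle : Ideal.span (X '' (s : Set σ) : Set (MvPolynomial σ K)) ≤
      Ideal.span (X '' ((insert i s : Finset σ) : Set σ) : Set (MvPolynomial σ K)) :=
      Ideal.span_mono (Set.image_mono (by simp))
    refine ext_nonzero_step (X i) ?_ (Submodule.factor hle) (Submodule.factor_surjective hle)
      ?_ (hN i (by simp)) _ (ih fun j hj => hN j (by simp [hj]))
    · rw [injective_iff_map_eq_zero]
      intro a ha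
      obtain ⟨a, rfl⟩ := Submodule.Quotient.mk_surjective _ a
      rw [LinearMap.lsmul_apply, ← Submodule.Quotient.mk_smul, Submodule.Quotient.mk_eq_zero,
        mem_ideal_span_X_image] at ha
      rw [Submodule.Quotient.mk_eq_zero, mem_ideal_span_X_image]
      intro m hm
      obtain ⟨j, hj, hj'⟩ := ha (m + Finsupp.single i 1) (by
        rw [mem_support_iff] at hm ⊢
        rwa [smul_eq_mul, add_comm, coeff_X_mul])
      refine ⟨j, hj, ?_⟩
      have : i ≠ j := by rintro rfl; exact his hj
      simpa [Finsupp.single_apply, this] using hj'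
    · intro a
      obtain ⟨a, rfl⟩ := Submodule.Quotient.mk_surjective _ a
      constructor
      · intro h
        have h' : a ∈ Ideal.span (X '' ((insert i s : Finset σ) : Set σ) : Set (MvPolynomial σ K)) :=
          (Submodule.Quotient.mk_eq_zero _).1 h
        rw [Finset.coe_insert, Set.image_insert_eq, Ideal.mem_span_insert] at h'
        obtain ⟨b, c, hc, rfl⟩ := h'
        refine ⟨Submodule.Quotient.mk b, ?_⟩
        rw [LinearMap.lsmul_apply, ← Submodule.Quotient.mk_smul, Submodule.Quotient.eq]
        convert neg_mem hc using 1
        rw [smul_eq_mul]; ring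
      · rintro ⟨b, hb⟩
        rw [← hb]
        obtain ⟨b, rfl⟩ := Submodule.Quotient.mk_surjective _ b
        refine (Submodule.Quotient.mk_eq_zero _).2 ?_
        exact Ideal.mul_mem_right _ _ (Ideal.subset_span ⟨i, by simp, rfl⟩)

/-- The projective dimension of the coordinate ring of a coordinate subspace. -/
theorem coordinate_subspace [Nontrivial K] {ρ τ : Type} [Fintype ρ] (e : ρ ⊕ τ ≃ σ)
    {N : Type u} [AddCommGroup N] [Module (MvPolynomial σ K) N]
    (φ : MvPolynomial σ K →ₗ[MvPolynomial σ K] N) (hφ : Function.Surjective φ)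
    (hker : LinearMap.ker φ = Ideal.span (X '' Set.range (e ∘ Sum.inl) : Set (MvPolynomial σ K))) :
    PDLE (MvPolynomial σ K) N (Fintype.card ρ) ∧
      ∀ k, PDLE (MvPolynomial σ K) N k → Fintype.card ρ ≤ k := by
  classical
  have hmem (f : MvPolynomial σ K) : φ f = 0 ↔
      ∀ m ∈ f.support, ∃ i ∈ Set.range (e ∘ Sum.inl), m i ≠ 0 := by
    rw [← LinearMap.mem_ker, hker, mem_ideal_span_X_image]
  have hX (i : ρ) (y : N) : (X (e (Sum.inl i)) : MvPolynomial σ K) • y = 0 := by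
    obtain ⟨f, rfl⟩ := hφ y
    rw [← map_smul, ← LinearMap.mem_ker, hker]
    exact Ideal.mul_mem_right _ _ (Ideal.subset_span ⟨_, ⟨i, rfl⟩, rfl⟩)
  constructor
  · have := RelDim.rename K e N 0 ?_
    · simpa using this
    · let _ := Module.compHom N
        (rename (e ∘ Sum.inr) : MvPolynomial τ K →ₐ[K] MvPolynomial σ K).toRingHom
      rw [zero_iff]
      let g : MvPolynomial τ K →ₗ[MvPolynomial τ K] N :=
        { toFun := fun f => φ (rename (e ∘ Sum.inr) f)
          map_add' := by simp
          map_smul' := fun f f' => by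
            rw [smul_eq_mul, map_mul, ← smul_eq_mul, map_smul]; rfl }
      refine Module.Projective.of_equiv' (LinearEquiv.ofBijective g ⟨?_, ?_⟩)
      · rw [injective_iff_map_eq_zero]
        intro f hf
        by_contra hne
        obtain ⟨m, hm⟩ := MvPolynomial.ne_zero_iff.1 hne
        obtain ⟨_, ⟨i, rfl⟩, h⟩ := (hmem _).1 hf (m.mapDomain (e ∘ Sum.inr)) (by
          rw [mem_support_iff, coeff_rename_mapDomain]
          · exact hm
          · exact e.injective.comp Sum.inr_injective)
        refine h (Finsupp.mapDomain_of_notMem_range _ _ ?_)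
        rintro ⟨j, hj⟩
        simpa using e.injective hj
      · intro y
        obtain ⟨f, rfl⟩ := hφ y
        induction f using MvPolynomial.induction_on with
        | C a => exact ⟨C a, by simp [g]⟩
        | add p q hp hq =>
          obtain ⟨a, ha⟩ := hp
          obtain ⟨b, hb⟩ := hq
          exact ⟨a + b, by rw [map_add, ha, hb, map_add]⟩
        | mul_X p i hp =>
          obtain ⟨a, ha⟩ := hp
          obtain ⟨i, rfl⟩ := e.surjective i
          rw [mul_comm, ← smul_eq_mul, map_smul]
          rcases i with i | i
          · exact ⟨0, by rw [hX, map_zero]⟩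
          · refine ⟨(X i : MvPolynomial τ K) • a, ?_⟩
            rw [map_smul, ha]
            change (rename (e ∘ Sum.inr) (X i : MvPolynomial τ K) : MvPolynomial σ K) • φ p =
              (X (e (Sum.inr i)) : MvPolynomial σ K) • φ p
            rw [rename_X]
            rfl
  · intro k hk
    by_contra! hlt
    have hinj : Function.Injective (e ∘ (Sum.inl : ρ → ρ ⊕ τ)) := e.injective.comp Sum.inl_injective
    let s : Finset σ := Finset.univ.map ⟨_, hinj⟩
    have hs : (s : Set σ) = Set.range (e ∘ Sum.inl) := by
      simp only [s, Finset.coe_map, Finset.coe_univ, Set.image_univ]; rfl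
    have : Nontrivial N := by
      refine ⟨φ 1, 0, fun h => ?_⟩
      obtain ⟨_, _, h⟩ := (hmem 1).1 h 0 (by simp)
      simp at h
    obtain ⟨x, hx⟩ := ext_coordinate_nonzero K s (N := N) (fun i hi y => by
      obtain ⟨j, rfl⟩ : i ∈ Set.range (e ∘ Sum.inl) := hs ▸ hi
      exact hX j y)
    have hk' := hk.of_equiv ((Submodule.quotEquivOfEq (LinearMap.ker φ) (Ideal.span
      (X '' (s : Set σ) : Set (MvPolynomial σ K)))
      (by rw [hker, hs])).symm.trans (φ.quotKerEquivOfSurjective hφ)).symm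
    have hk'' : HasProjectiveDimensionLT (ModuleCat.of (MvPolynomial σ K)
      (MvPolynomial σ K ⧸ Ideal.span
        (X '' (s : Set σ) : Set (MvPolynomial σ K)))) (k + 1) := hk'
    exact hx (Ext.eq_zero_of_hasProjectiveDimensionLT x (k + 1) (by simp [s]; omega))

end
end PDLE

theorem projDimLE_iff {R : Type u} [CommRing R] {M : Type u} [AddCommGroup M] [Module R M]
    (n : ℕ) : projDimLE.{u, u} R n M ↔ PDLE R M n := by
  induction n generalizing M with
  | zero => rw [PDLE.zero_iff, projDimLE]
  | succ n ih =>
    rw [projDimLE]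
    constructor
    · rintro ⟨P, _, _, f, hP, hf, h⟩
      exact PDLE.of_ker f hf (ih.1 h) (PDLE.of_projective _)
    · intro h
      refine ⟨M →₀ R, inferInstance, inferInstance, Finsupp.linearCombination R id,
        inferInstance, Finsupp.linearCombination_id_surjective R M, ?_⟩
      exact ih.2 (PDLE.ker_of_surjective _ (Finsupp.linearCombination_id_surjective R M) h)

end

section

open MvPolynomial

theorem free_of_monomial_basis {R : Type u} [CommRing R] {τ B B0 : Type*} {M : Type u} [AddCommGroup M]
    [Module R M] [Module (MvPolynomial τ R) M] [IsScalarTower R (MvPolynomial τ R) M]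
    (b : Module.Basis B R M) (φ : (τ →₀ ℕ) × B0 ≃ B)
    (h : ∀ i k β, (X i : MvPolynomial τ R) • b (φ (k, β)) = b (φ (k + Finsupp.single i 1, β))) :
    Module.Free (MvPolynomial τ R) M := by
  have hmon (k : τ →₀ ℕ) : ∀ (l : τ →₀ ℕ) (β : B0),
      (monomial k 1 : MvPolynomial τ R) • b (φ (l, β)) = b (φ (l + k, β)) := by
    induction k using Finsupp.induction_linear with
    | zero => intro l β; simp
    | add k l hk hl =>
      intro l' β
      rw [← one_mul (1 : R), ← monomial_mul, mul_smul, hl, hk, add_assoc, add_comm l k]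
    | single i a =>
      induction a with
      | zero => intro l β; simp
      | succ a ih =>
        intro l β
        rw [Finsupp.single_add, ← one_mul (1 : R), ← monomial_mul, mul_smul]
        change _ • (X i : MvPolynomial τ R) • _ = _
        rw [h, ih, add_assoc, add_comm (Finsupp.single i 1)]
  let F : (B0 →₀ MvPolynomial τ R) →ₗ[MvPolynomial τ R] M :=
    Finsupp.linearCombination _ (fun β => b (φ (0, β)))
  let b1 : Module.Basis (Σ _ : B0, τ →₀ ℕ) R (B0 →₀ MvPolynomial τ R) :=
    Finsupp.basis (fun _ => basisMonomials τ R)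
  let e : (B0 →₀ MvPolynomial τ R) ≃ₗ[R] M := b1.equiv b
    ((Equiv.sigmaEquivProd _ _).trans ((Equiv.prodComm _ _).trans φ))
  have hF : F.restrictScalars R = e.toLinearMap := by
    refine b1.ext fun x => ?_
    have h1 : b1 x = Finsupp.single x.1 (monomial x.2 1) := by
      simp [b1, Finsupp.coe_basis]
    have h2 : e (b1 x) = b (φ (x.2, x.1)) := by
      simp [e]
    change F (b1 x) = e (b1 x)
    rw [h2, h1]
    simp only [F, Finsupp.linearCombination_single]
    simpa using hmon x.2 0 x.1
  refine Module.Free.of_equiv (LinearEquiv.ofBijective F ?_)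
  have : (F : (B0 →₀ MvPolynomial τ R) → M) = e := by
    funext x; exact LinearMap.congr_fun hF x
  rw [this]
  exact e.bijective

/-- A module with a monomial basis permuted freely by part of the variables. -/
theorem PDLE.of_monomial_basis (K : Type u) [CommRing K] {τ ρ σ : Type} [Fintype ρ]
    (e : ρ ⊕ τ ≃ σ) {B B0 : Type*} {M : Type u} [AddCommGroup M]
    [Module K M] [Module (MvPolynomial σ K) M] [IsScalarTower K (MvPolynomial σ K) M]
    (b : Module.Basis B K M) (φ : (τ →₀ ℕ) × B0 ≃ B)
    (h : ∀ i k β, (X (e (Sum.inr i)) : MvPolynomial σ K) • b (φ (k, β)) =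
      b (φ (k + Finsupp.single i 1, β))) :
    PDLE (MvPolynomial σ K) M (Fintype.card ρ) := by
  have := RelDim.rename K e M 0 ?_
  · simpa using this
  · let _ := Module.compHom M
      (rename (e ∘ Sum.inr) : MvPolynomial τ K →ₐ[K] MvPolynomial σ K).toRingHom
    rw [zero_iff]
    have : IsScalarTower K (MvPolynomial τ K) M := ⟨fun r f x => by
      change rename (e ∘ Sum.inr) (r • f) • x = r • (rename (e ∘ Sum.inr) f • x)
      rw [map_smul, smul_assoc]⟩
    have := free_of_monomial_basis b φ (fun i k β => by
      rw [← h]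
      change rename (e ∘ Sum.inr) (X i : MvPolynomial τ K) • b (φ (k, β)) =
        (X (e (Sum.inr i)) : MvPolynomial σ K) • b (φ (k, β))
      rw [rename_X]; rfl)
    infer_instance

end

section

open MvPolynomial

/-- A module whose monomial basis is shifted freely by part of the variables. -/
theorem PDLE.of_shift (K : Type u) [CommRing K] {τ ρ σ ω : Type} [Fintype ρ]
    (e : ρ ⊕ τ ≃ σ) {S : Set (ω →₀ ℕ)} {M : Type u} [AddCommGroup M]
    [Module K M] [Module (MvPolynomial σ K) M] [IsScalarTower K (MvPolynomial σ K) M]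
    (b : Module.Basis S K M) (θ : τ → ω →₀ ℕ) (κ : (ω →₀ ℕ) → (τ →₀ ℕ))
    (h1 : ∀ s ∈ S, ∀ i, s + θ i ∈ S)
    (h2 : ∀ s ∈ S, ∃ r ∈ S, r + Finsupp.linearCombination ℕ θ (κ s) = s)
    (h3 : ∀ s ∈ S, ∀ i, κ (s + θ i) = κ s + Finsupp.single i 1)
    (h : ∀ i (s t : S), (t : ω →₀ ℕ) = s + θ i →
      (X (e (Sum.inr i)) : MvPolynomial σ K) • b s = b t) :
    PDLE (MvPolynomial σ K) M (Fintype.card ρ) := by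
  have key (k : τ →₀ ℕ) : ∀ s ∈ S, s + Finsupp.linearCombination ℕ θ k ∈ S ∧
      κ (s + Finsupp.linearCombination ℕ θ k) = κ s + k := by
    induction k using Finsupp.induction_linear with
    | zero => intro s hs; simp [hs]
    | add k l hk hl =>
      intro s hs
      rw [map_add, ← add_assoc, ← add_assoc]
      exact ⟨(hl _ (hk s hs).1).1, by rw [(hl _ (hk s hs).1).2, (hk s hs).2]⟩
    | single i a =>
      induction a with
      | zero => intro s hs; simp [hs]
      | succ a ih =>
        intro s hs
        have := ih s hs
        rw [Finsupp.single_add, map_add, ← add_assoc, ← add_assoc, Finsupp.linearCombination_single ℕ 1,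
          one_smul]
        exact ⟨h1 _ this.1 i, by rw [h3 _ this.1, this.2]⟩
  choose r hr1 hr2 using h2
  have hr3 (s) (hs : s ∈ S) : κ (r s hs) = 0 := by
    have := (key (κ s) _ (hr1 s hs)).2
    rw [hr2] at this
    simpa using this
  let B0 := {s : S // κ s = 0}
  let φ : (τ →₀ ℕ) × B0 ≃ S :=
    { toFun := fun x => ⟨x.2.1.1 + Finsupp.linearCombination ℕ θ x.1, (key x.1 _ x.2.1.2).1⟩
      invFun := fun s => (κ s, ⟨⟨r s.1 s.2, hr1 _ _⟩, hr3 _ _⟩)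
      left_inv := by
        rintro ⟨k, ⟨⟨s, hs⟩, h0⟩⟩
        have h4 := key k s hs
        simp only at h0
        have h5 : κ (s + Finsupp.linearCombination ℕ θ k) = k := by rw [h4.2, h0, zero_add]
        have h6 := (hr2 _ h4.1).trans (congrArg _ (congrArg _ h5)).symm
        ext1
        · exact h5
        · exact Subtype.ext (Subtype.ext (add_right_cancel h6))
      right_inv := by
        rintro ⟨s, hs⟩
        exact Subtype.ext (hr2 s hs) }
  refine PDLE.of_monomial_basis K e b φ fun i k β => h i _ _ ?_
  simp [φ, add_assoc]

section monomialMap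

variable {K : Type u} [CommRing K] {σ ω : Type} (E : σ → ω →₀ ℕ)

theorem aeval_monomial_monomial (m : σ →₀ ℕ) (r : K) :
    aeval (fun i => (monomial (E i) (1 : K))) (monomial m r) =
      monomial (Finsupp.linearCombination ℕ E m) r := by
  rw [aeval_monomial, Finsupp.linearCombination_apply, algebraMap_eq, Finsupp.prod]
  simp only [monomial_pow, one_pow]
  rw [Finsupp.sum, monomial_sum_index]

/-- The kernel of a monomial map is generated by any family of binomials connecting the fibres. -/
theorem ker_aeval_monomial (I : Ideal (MvPolynomial σ K))
    (h : ∀ m m', Finsupp.linearCombination ℕ E m = Finsupp.linearCombination ℕ E m' →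
      (monomial m 1 - monomial m' 1 : MvPolynomial σ K) ∈ I)
    (f : MvPolynomial σ K) (hf : aeval (fun i => (monomial (E i) (1 : K))) f = 0) : f ∈ I := by
  classical
  let L := Finsupp.linearCombination ℕ E
  let g : (ω →₀ ℕ) → (σ →₀ ℕ) := Function.invFun L
  let ρ : MvPolynomial ω K →ₗ[K] MvPolynomial σ K :=
    (basisMonomials ω K).constr K fun w => monomial (g w) 1
  have hρ (w) (r : K) : ρ (monomial w r) = monomial (g w) r := by
    have := (basisMonomials ω K).constr_basis K (fun w => (monomial (g w) 1 : MvPolynomial σ K)) w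
    rw [coe_basisMonomials] at this
    have h2 : (monomial w r : MvPolynomial ω K) = r • monomial w 1 := by
      rw [smul_monomial, smul_eq_mul, mul_one]
    rw [h2, map_smul, this, smul_monomial, smul_eq_mul, mul_one]
  have key (p : MvPolynomial σ K) : p - ρ (aeval (fun i => (monomial (E i) (1 : K))) p) ∈ I := by
    induction p using MvPolynomial.induction_on' with
    | monomial m a =>
      rw [aeval_monomial_monomial, hρ]
      have := I.mul_mem_left (C a) (h m (g (L m)) (Function.invFun_eq (f := L) ⟨m, rfl⟩).symm)
      simpa [mul_sub, C_mul_monomial] using this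
    | add p q hp hq =>
      rw [map_add, map_add, add_sub_add_comm]
      exact I.add_mem hp hq
  have := key f
  rwa [hf, map_zero, sub_zero] at this

end monomialMap

end

section

open MvPolynomial

section Segre

variable (K : Type u) [Field K] (σ₀ ι κ : Type)

/-- The source of the Segre map. -/
abbrev SegA := MvPolynomial (σ₀ ⊕ κ × ι) K

/-- The target of the Segre map. -/
abbrev SegW := MvPolynomial (σ₀ ⊕ (ι ⊕ κ)) K

/-- The exponents of the images of the variables under the Segre map. -/
noncomputable def segExp : σ₀ ⊕ κ × ι → (σ₀ ⊕ (ι ⊕ κ)) →₀ ℕ :=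
  Sum.elim (fun s => Finsupp.single (Sum.inl s) 1) fun q =>
    Finsupp.single (Sum.inr (Sum.inr q.1)) 1 + Finsupp.single (Sum.inr (Sum.inl q.2)) 1

/-- The Segre map, sending `x_(k, i)` to `c_k p_i`. -/
noncomputable def seg : SegA K σ₀ ι κ →ₐ[K] SegW K σ₀ ι κ :=
  aeval fun i => monomial (segExp σ₀ ι κ i) 1

noncomputable instance segAlgebra : Algebra (SegA K σ₀ ι κ) (SegW K σ₀ ι κ) :=
  (seg K σ₀ ι κ).toAlgebra

variable {K σ₀ ι κ}

instance : IsScalarTower K (SegA K σ₀ ι κ) (SegW K σ₀ ι κ) :=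
  IsScalarTower.of_algebraMap_eq fun r => ((seg K σ₀ ι κ).commutes r).symm

@[simp] theorem seg_X_inl (s : σ₀) : seg K σ₀ ι κ (X (Sum.inl s)) = X (Sum.inl s) := by
  rw [seg, aeval_X]; rfl

@[simp] theorem seg_X_inr (k : κ) (i : ι) : seg K σ₀ ι κ (X (Sum.inr (k, i))) =
    X (Sum.inr (Sum.inr k)) * X (Sum.inr (Sum.inl i)) := by
  rw [seg, aeval_X, X, X, monomial_mul, mul_one]; rfl

variable (K σ₀ ι κ) in
/-- The ideal of `2 × 2` minors of the generic matrix. -/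
noncomputable def segIdeal : Ideal (SegA K σ₀ ι κ) :=
  Ideal.span {f | ∃ k l i j, f = X (Sum.inr (k, i)) * X (Sum.inr (l, j)) -
    X (Sum.inr (k, j)) * X (Sum.inr (l, i))}

theorem segExp_apply_inl (q) (s : σ₀) :
    segExp σ₀ ι κ q (Sum.inl s) ≠ 0 ↔ q = Sum.inl s := by
  classical
  rcases q with q | q <;> simp [segExp, Finsupp.single_apply]

theorem segExp_apply_inr (q) (k : κ) : segExp σ₀ ι κ q (Sum.inr (Sum.inr k)) ≠ 0 ↔
    ∃ i, q = Sum.inr (k, i) := by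
  classical
  rcases q with q | q <;> simp [segExp, Finsupp.single_apply, Prod.ext_iff]

theorem segExp_apply_inl' (q) (i : ι) : segExp σ₀ ι κ q (Sum.inr (Sum.inl i)) ≠ 0 ↔
    ∃ k, q = Sum.inr (k, i) := by
  classical
  rcases q with q | q <;> simp [segExp, Finsupp.single_apply, Prod.ext_iff]

theorem exists_of_linearCombination_ne_zero {σ ω : Type} (E : σ → ω →₀ ℕ) (m : σ →₀ ℕ) (w : ω)
    (h : Finsupp.linearCombination ℕ E m w ≠ 0) : ∃ q, m q ≠ 0 ∧ E q w ≠ 0 := by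
  classical
  rw [Finsupp.linearCombination_apply, Finsupp.sum, Finsupp.finsetSum_apply] at h
  obtain ⟨q, hq, hq'⟩ := Finset.exists_ne_zero_of_sum_ne_zero h
  refine ⟨q, by simpa using hq, fun h0 => hq' (by simp [h0])⟩

theorem linearCombination_ne_zero {σ ω : Type} (E : σ → ω →₀ ℕ) (m : σ →₀ ℕ) (w : ω)
    (q) (h1 : m q ≠ 0) (h2 : E q w ≠ 0) : Finsupp.linearCombination ℕ E m w ≠ 0 := by
  classical
  rw [Finsupp.linearCombination_apply, Finsupp.sum, Finsupp.finsetSum_apply]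
  intro h
  have := Finset.sum_eq_zero_iff.mp h q (by simpa using h1)
  simp [h1, h2] at this

theorem exists_eq_add_single {σ : Type} (m : σ →₀ ℕ) (q) (h : m q ≠ 0) :
    ∃ m', m = m' + Finsupp.single q 1 := by
  classical
  refine ⟨m - Finsupp.single q 1, ?_⟩
  rw [tsub_add_cancel_of_le]
  simpa [Finsupp.single_le_iff] using Nat.one_le_iff_ne_zero.mpr h

theorem monomial_sub_mem_segIdeal (d : ℕ) : ∀ m m' : (σ₀ ⊕ κ × ι) →₀ ℕ, m.degree = d →
    Finsupp.linearCombination ℕ (segExp σ₀ ι κ) m =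
      Finsupp.linearCombination ℕ (segExp σ₀ ι κ) m' →
    (monomial m 1 - monomial m' 1 : SegA K σ₀ ι κ) ∈ segIdeal K σ₀ ι κ := by
  classical
  induction d with
  | zero =>
    intro m m' hm h
    obtain rfl : m = 0 := (Finsupp.degree_eq_zero_iff m).mp hm
    rw [map_zero] at h
    obtain rfl : m' = 0 := by
      ext q
      by_contra hq
      have hne : segExp σ₀ ι κ q ≠ 0 := by
        rcases q with q | q <;> simp [segExp]
      obtain ⟨w, hw⟩ := Finsupp.ne_iff.mp hne
      have := linearCombination_ne_zero (segExp σ₀ ι κ) m' w q hq (by simpa using hw)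
      rw [← h] at this
      simp at this
    simp
  | succ d ih =>
    have common (m m' : (σ₀ ⊕ κ × ι) →₀ ℕ) (q) (hm : m.degree = d + 1) (h1 : m q ≠ 0) (h2 : m' q ≠ 0)
        (h : Finsupp.linearCombination ℕ (segExp σ₀ ι κ) m =
          Finsupp.linearCombination ℕ (segExp σ₀ ι κ) m') :
        (monomial m 1 - monomial m' 1 : SegA K σ₀ ι κ) ∈ segIdeal K σ₀ ι κ := by
      obtain ⟨m, rfl⟩ := exists_eq_add_single m q h1
      obtain ⟨m', rfl⟩ := exists_eq_add_single m' q h2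
      rw [map_add, map_add] at h
      have := ih m m' (by simpa using hm) (add_right_cancel h)
      have := Ideal.mul_mem_right (X q : SegA K σ₀ ι κ) _ this
      simpa [sub_mul, X, monomial_mul] using this
    intro m m' hm h
    obtain ⟨q, hq⟩ : ∃ q, m q ≠ 0 := by
      by_contra! h0
      obtain rfl : m = 0 := by ext; simp [h0]
      simp at hm
    by_cases hq' : m' q = 0
    swap
    · exact common m m' q hm hq hq' h
    rcases q with s | ⟨k, i⟩
    · have := linearCombination_ne_zero (segExp σ₀ ι κ) m (Sum.inl s) _ hq ((segExp_apply_inl _ _).mpr rfl)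
      rw [h] at this
      obtain ⟨q, h1, h2⟩ := exists_of_linearCombination_ne_zero _ _ _ this
      exact absurd hq' ((segExp_apply_inl _ _).mp h2 ▸ h1)
    · have a1 := linearCombination_ne_zero (segExp σ₀ ι κ) m (Sum.inr (Sum.inr k)) _ hq
        ((segExp_apply_inr _ _).mpr ⟨i, rfl⟩)
      have a2 := linearCombination_ne_zero (segExp σ₀ ι κ) m (Sum.inr (Sum.inl i)) _ hq
        ((segExp_apply_inl' _ _).mpr ⟨k, rfl⟩)
      rw [h] at a1 a2
      obtain ⟨q1, h1, h1'⟩ := exists_of_linearCombination_ne_zero _ _ _ a1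
      obtain ⟨q2, h2, h2'⟩ := exists_of_linearCombination_ne_zero _ _ _ a2
      obtain ⟨j, rfl⟩ := (segExp_apply_inr _ _).mp h1'
      obtain ⟨l, rfl⟩ := (segExp_apply_inl' _ _).mp h2'
      have hij : j ≠ i := fun hji => h1 (hji ▸ hq')
      obtain ⟨n1, rfl⟩ := exists_eq_add_single m' _ h1
      have h3 : n1 (Sum.inr (l, i)) ≠ 0 := by
        simpa [Finsupp.single_apply, hij] using h2
      obtain ⟨n2, rfl⟩ := exists_eq_add_single n1 _ h3
      have h4 := common m (n2 + Finsupp.single (Sum.inr (l, j)) 1 +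
        Finsupp.single (Sum.inr (k, i)) 1) (Sum.inr (k, i)) hm hq (by simp) (by
          rw [h]
          simp only [map_add, Finsupp.linearCombination_single, one_smul, segExp, Sum.elim_inr]
          abel)
      have h5 : (X (Sum.inr (k, i)) * X (Sum.inr (l, j)) -
          X (Sum.inr (k, j)) * X (Sum.inr (l, i)) : SegA K σ₀ ι κ) ∈ segIdeal K σ₀ ι κ :=
        Ideal.subset_span ⟨k, l, i, j, rfl⟩
      have h6 := Ideal.add_mem _ h4 (Ideal.mul_mem_left _ (monomial n2 1) h5)
      convert h6 using 1
      simp only [X, mul_sub, monomial_mul, mul_one]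
      rw [show n2 + (Finsupp.single (Sum.inr (k, i)) 1 + Finsupp.single (Sum.inr (l, j)) 1) =
        n2 + Finsupp.single (Sum.inr (l, j)) 1 + Finsupp.single (Sum.inr (k, i)) 1 by abel,
        show n2 + (Finsupp.single (Sum.inr (k, j)) 1 + Finsupp.single (Sum.inr (l, i)) 1) =
        n2 + Finsupp.single (Sum.inr (l, i)) 1 + Finsupp.single (Sum.inr (k, j)) 1 by abel]
      abel

theorem seg_eq_zero_iff (f : SegA K σ₀ ι κ) : seg K σ₀ ι κ f = 0 ↔ f ∈ segIdeal K σ₀ ι κ := by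
  constructor
  · exact ker_aeval_monomial (segExp σ₀ ι κ) _ (fun m m' => monomial_sub_mem_segIdeal _ m m' rfl) f
  · intro hf
    have : segIdeal K σ₀ ι κ ≤ RingHom.ker (seg K σ₀ ι κ) := by
      refine Ideal.span_le.mpr ?_
      rintro _ ⟨k, l, i, j, rfl⟩
      simp only [SetLike.mem_coe, RingHom.mem_ker, map_sub, map_mul, seg_X_inr]
      ring
    exact this hf

end Segre

end

section

open MvPolynomial

section shiftSub

variable {K : Type u} [Field K] {σ ω : Type} [Algebra (MvPolynomial σ K) (MvPolynomial ω K)]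
  [IsScalarTower K (MvPolynomial σ K) (MvPolynomial ω K)]
  (V : Submodule (MvPolynomial σ K) (MvPolynomial ω K)) (S : Set (ω →₀ ℕ))

theorem coe_basisRestrictSupport (s : S) :
    (basisRestrictSupport K S s : MvPolynomial ω K) = monomial (s : ω →₀ ℕ) 1 := by
  have : basisRestrictSupport K S s = ⟨monomial (s : ω →₀ ℕ) 1,
      (monomial_mem_restrictSupport K).2 (Or.inl s.2)⟩ := by
    rw [Module.Basis.apply_eq_iff]
    classical
    ext t
    change coeff (t : ω →₀ ℕ) (monomial (s : ω →₀ ℕ) (1 : K)) = _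
    rw [coeff_monomial, Finsupp.single_apply]
    simp [Subtype.ext_iff]
  rw [this]

theorem exists_basis_of_support (hV : ∀ f, f ∈ V ↔ ∀ m ∈ f.support, m ∈ S) :
    ∃ b : Module.Basis S K V, ∀ s, (b s : MvPolynomial ω K) = monomial s 1 := by
  have h : restrictSupport K S = V.restrictScalars K := by
    ext f
    exact (hV f).symm
  refine ⟨(basisRestrictSupport K S).map (LinearEquiv.ofEq _ _ h), fun s => ?_⟩
  exact coe_basisRestrictSupport S s

theorem exists_basis_quotient_of_support (hV : ∀ f, f ∈ V ↔ ∀ m ∈ f.support, m ∈ S) :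
    ∃ b : Module.Basis (Sᶜ : Set _) K (MvPolynomial ω K ⧸ V), ∀ s,
      b s = Submodule.Quotient.mk (monomial s 1 : MvPolynomial ω K) := by
  have h : restrictSupport K S = V.restrictScalars K := by
    ext f
    exact (hV f).symm
  have hc : IsCompl (V.restrictScalars K) (restrictSupport K Sᶜ) := by
    rw [← h]
    constructor
    · rw [Submodule.disjoint_def]
      intro x hx hx'
      rw [mem_restrictSupport_iff] at hx hx'
      rw [← support_eq_empty, ← Finset.coe_eq_empty]
      exact Set.eq_empty_of_forall_notMem fun y hy => hx' hy (hx hy)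
    · rw [codisjoint_iff, eq_top_iff]
      intro x _
      rw [← support_sum_monomial_coeff x]
      refine Submodule.sum_mem _ fun m _ => ?_
      by_cases hm : m ∈ S
      · exact Submodule.mem_sup_left ((monomial_mem_restrictSupport K).2 (Or.inl hm))
      · exact Submodule.mem_sup_right ((monomial_mem_restrictSupport K).2 (Or.inl hm))
  refine ⟨(basisRestrictSupport K Sᶜ).map (((Submodule.quotientEquivOfIsCompl _ _ hc).symm).trans
    (Submodule.Quotient.restrictScalarsEquiv K V)), fun s => ?_⟩
  rw [← coe_basisRestrictSupport]
  rfl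

variable {S} {τ ρ : Type} [Fintype ρ] (e : ρ ⊕ τ ≃ σ)
    (θ : τ → ω →₀ ℕ) (κ : (ω →₀ ℕ) → (τ →₀ ℕ))

theorem PDLE.submodule_of_shift
    (hθ : ∀ i, algebraMap (MvPolynomial σ K) (MvPolynomial ω K) (X (e (Sum.inr i))) =
      monomial (θ i) 1)
    (hV : ∀ f, f ∈ V ↔ ∀ m ∈ f.support, m ∈ S)
    (h1 : ∀ s ∈ S, ∀ i, s + θ i ∈ S)
    (h2 : ∀ s ∈ S, ∃ r ∈ S, r + Finsupp.linearCombination ℕ θ (κ s) = s)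
    (h3 : ∀ s ∈ S, ∀ i, κ (s + θ i) = κ s + Finsupp.single i 1) :
    PDLE (MvPolynomial σ K) V (Fintype.card ρ) := by
  obtain ⟨b, hb⟩ := exists_basis_of_support V S hV
  refine PDLE.of_shift K e b θ κ h1 h2 h3 fun i s t hst => Subtype.ext ?_
  rw [Submodule.coe_smul, hb, hb, Algebra.smul_def, hθ, monomial_mul, hst, add_comm, mul_one]

theorem PDLE.quotient_of_shift
    (hθ : ∀ i, algebraMap (MvPolynomial σ K) (MvPolynomial ω K) (X (e (Sum.inr i))) =
      monomial (θ i) 1)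
    (hV : ∀ f, f ∈ V ↔ ∀ m ∈ f.support, m ∈ S)
    (h1 : ∀ s ∈ Sᶜ, ∀ i, s + θ i ∈ Sᶜ)
    (h2 : ∀ s ∈ Sᶜ, ∃ r ∈ Sᶜ, r + Finsupp.linearCombination ℕ θ (κ s) = s)
    (h3 : ∀ s ∈ Sᶜ, ∀ i, κ (s + θ i) = κ s + Finsupp.single i 1) :
    PDLE (MvPolynomial σ K) (MvPolynomial ω K ⧸ V) (Fintype.card ρ) := by
  obtain ⟨b, hb⟩ := exists_basis_quotient_of_support V S hV
  refine PDLE.of_shift K e b θ κ h1 h2 h3 fun i s t hst => ?_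
  rw [hb, hb, ← Submodule.Quotient.mk_smul, Algebra.smul_def, hθ, monomial_mul, hst, add_comm,
    mul_one]

end shiftSub

section Segre

variable {K : Type u} [Field K] {σ₀ ι κ : Type}

variable (σ₀ ι κ) in
/-- The weight on the target of the Segre map: `c` has weight `1` and `p` has weight `-1`. -/
def segWt : σ₀ ⊕ (ι ⊕ κ) → ℤ := Sum.elim 0 (Sum.elim (-1) 1)

theorem seg_isWeightedHomogeneous (a : SegA K σ₀ ι κ) :
    IsWeightedHomogeneous (segWt σ₀ ι κ) (seg K σ₀ ι κ a) 0 := by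
  induction a using MvPolynomial.induction_on with
  | C r =>
    rw [← algebraMap_eq, AlgHom.commutes]
    exact isWeightedHomogeneous_C _ _
  | add p q hp hq => rw [map_add]; exact hp.add hq
  | mul_X p q hp =>
    rw [map_mul]
    rw [← add_zero (0 : ℤ)]
    refine hp.mul ?_
    rcases q with s | ⟨k, i⟩
    · rw [seg_X_inl]; exact isWeightedHomogeneous_X K _ _
    · rw [seg_X_inr]
      exact (isWeightedHomogeneous_X K (segWt σ₀ ι κ) _).mul (isWeightedHomogeneous_X K _ _)

variable (K σ₀ ι κ) in
/-- The weight strands of the target of the Segre map, as modules over the source. -/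
noncomputable def segV (j : ℤ) : Submodule (SegA K σ₀ ι κ) (SegW K σ₀ ι κ) where
  carrier := {x | IsWeightedHomogeneous (segWt σ₀ ι κ) x j}
  zero_mem' := isWeightedHomogeneous_zero K _ _
  add_mem' := fun hx hy => hx.add hy
  smul_mem' := fun a x hx => by
    have := (seg_isWeightedHomogeneous a).mul hx
    rwa [zero_add] at this

theorem mem_segV_iff {j : ℤ} {x : SegW K σ₀ ι κ} :
    x ∈ segV K σ₀ ι κ j ↔ ∀ m ∈ x.support, Finsupp.weight (segWt σ₀ ι κ) m = j :=
  ⟨fun h _ hm => h (mem_support_iff.mp hm), fun h _ hm => h _ (mem_support_iff.mpr hm)⟩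

theorem segV_mul {i j : ℤ} {x y : SegW K σ₀ ι κ} (hx : x ∈ segV K σ₀ ι κ i)
    (hy : y ∈ segV K σ₀ ι κ j) : x * y ∈ segV K σ₀ ι κ (i + j) :=
  IsWeightedHomogeneous.mul hx hy

theorem weight_segWt [Fintype ι] [Fintype κ] (m : (σ₀ ⊕ (ι ⊕ κ)) →₀ ℕ) :
    Finsupp.weight (segWt σ₀ ι κ) m =
      ∑ k, (m (Sum.inr (Sum.inr k)) : ℤ) - ∑ i, (m (Sum.inr (Sum.inl i)) : ℤ) := by
  classical
  induction m using Finsupp.induction_linear with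
  | zero => simp
  | add m m' h h' =>
    rw [map_add, h, h']
    simp only [Finsupp.add_apply, Nat.cast_add, Finset.sum_add_distrib]
    ring
  | single q a =>
    rcases q with s | i | k
    · simp [segWt, Finsupp.weight_apply]
    · simp [segWt, Finsupp.weight_apply, Finsupp.single_apply]
    · simp [segWt, Finsupp.weight_apply, Finsupp.single_apply]

theorem segV_induction {j : ℤ} {P : SegW K σ₀ ι κ → Prop} (h0 : P 0)
    (hadd : ∀ x y, P x → P y → P (x + y))
    (hm : ∀ m r, Finsupp.weight (segWt σ₀ ι κ) m = j → P (monomial m r))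
    {x : SegW K σ₀ ι κ} (hx : x ∈ segV K σ₀ ι κ j) : P x := by
  rw [← support_sum_monomial_coeff x]
  exact Finset.sum_induction _ P hadd h0 fun m h => hm m _ (mem_segV_iff.mp hx m h)

theorem exists_seg_eq_of_mem_segV [Fintype ι] [Fintype κ] {x : SegW K σ₀ ι κ}
    (hx : x ∈ segV K σ₀ ι κ 0) : ∃ a, seg K σ₀ ι κ a = x := by
  refine segV_induction (P := fun x => ∃ a, seg K σ₀ ι κ a = x) ⟨0, map_zero _⟩ ?_ ?_ hx
  · rintro x y ⟨a, rfl⟩ ⟨b, rfl⟩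
    exact ⟨a + b, map_add _ _ _⟩
  · intro m r
    induction hd : m.degree using Nat.strong_induction_on generalizing m with
    | _ d ih =>
    intro hm
    have hm' := hm
    rw [weight_segWt] at hm'
    by_cases h0 : ∃ s, m (Sum.inl s) ≠ 0
    · obtain ⟨s, hs⟩ := h0
      obtain ⟨m, rfl⟩ := exists_eq_add_single m _ hs
      obtain ⟨a, ha⟩ := ih m.degree (by rw [← hd]; simp) m rfl (by
        rw [map_add] at hm; simpa [segWt, Finsupp.weight_apply] using hm)
      exact ⟨a * X (Sum.inl s), by rw [map_mul, ha, seg_X_inl, X, monomial_mul, mul_one]⟩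
    push Not at h0
    by_cases h1 : ∃ k, m (Sum.inr (Sum.inr k)) ≠ 0
    · obtain ⟨k, hk⟩ := h1
      have : ∃ i, m (Sum.inr (Sum.inl i)) ≠ 0 := by
        by_contra! h
        simp only [h, Nat.cast_zero, Finset.sum_const_zero, sub_zero] at hm'
        rw [Finset.sum_eq_zero_iff_of_nonneg (fun _ _ => by positivity)] at hm'
        exact hk (by simpa using hm' k (Finset.mem_univ _))
      obtain ⟨i, hi⟩ := this
      obtain ⟨m, rfl⟩ := exists_eq_add_single m _ hk
      obtain ⟨m, rfl⟩ := exists_eq_add_single m (Sum.inr (Sum.inl i)) (by simpa using hi)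
      obtain ⟨a, ha⟩ := ih m.degree (by rw [← hd]; simp) m rfl (by
        rw [map_add, map_add] at hm; simpa [segWt, Finsupp.weight_apply] using hm)
      refine ⟨a * X (Sum.inr (k, i)), ?_⟩
      rw [map_mul, ha, seg_X_inr, X, X, monomial_mul, monomial_mul, mul_one, mul_one]
      abel_nf
    push Not at h1
    have h2 : ∀ i, m (Sum.inr (Sum.inl i)) = 0 := by
      simp only [h1, Nat.cast_zero, Finset.sum_const_zero, zero_sub, neg_eq_zero] at hm'
      rw [Finset.sum_eq_zero_iff_of_nonneg (fun _ _ => by positivity)] at hm'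
      intro i
      simpa using hm' i (Finset.mem_univ _)
    have : m = 0 := by
      ext (s | i | k)
      exacts [h0 s, h2 i, h1 k]
    exact ⟨C r, by rw [this, monomial_zero', ← algebraMap_eq, AlgHom.commutes]; rfl⟩

theorem X_p_mem (i : ι) : (X (Sum.inr (Sum.inl i)) : SegW K σ₀ ι κ) ∈ segV K σ₀ ι κ (-1) :=
  isWeightedHomogeneous_X K _ _

theorem X_s_mem (s : σ₀) : (X (Sum.inl s) : SegW K σ₀ ι κ) ∈ segV K σ₀ ι κ 0 :=
  isWeightedHomogeneous_X K _ _

theorem exists_sum_of_mem_segV [Fintype ι] [Fintype κ] (j : ℕ) {x : SegW K σ₀ ι κ}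
    (hx : x ∈ segV K σ₀ ι κ (j + 1)) : ∃ g : κ → SegW K σ₀ ι κ, (∀ k, g k ∈ segV K σ₀ ι κ j) ∧
      x = ∑ k, X (Sum.inr (Sum.inr k)) * g k := by
  classical
  refine segV_induction (P := fun x => ∃ g : κ → SegW K σ₀ ι κ, (∀ k, g k ∈ segV K σ₀ ι κ j) ∧
      x = ∑ k, X (Sum.inr (Sum.inr k)) * g k) ⟨0, fun _ => zero_mem _, by simp⟩ ?_ ?_ hx
  · rintro x y ⟨g, hg, rfl⟩ ⟨g', hg', rfl⟩
    exact ⟨g + g', fun k => add_mem (hg k) (hg' k), by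
      simp [mul_add, Finset.sum_add_distrib]⟩
  · intro m r hm
    have hm' := hm
    rw [weight_segWt] at hm'
    have : ∃ k, m (Sum.inr (Sum.inr k)) ≠ 0 := by
      by_contra! h
      simp only [h, Nat.cast_zero, Finset.sum_const_zero, zero_sub] at hm'
      have : (0 : ℤ) ≤ ∑ i, (m (Sum.inr (Sum.inl i)) : ℤ) :=
        Finset.sum_nonneg fun _ _ => by positivity
      omega
    obtain ⟨k, hk⟩ := this
    obtain ⟨m, rfl⟩ := exists_eq_add_single m _ hk
    refine ⟨Pi.single k (monomial m r), fun l => ?_, ?_⟩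
    · by_cases h : l = k
      · subst h
        rw [Pi.single_eq_same]
        refine isWeightedHomogeneous_monomial _ _ _ ?_
        rw [map_add] at hm
        simpa [segWt, Finsupp.weight_apply] using hm
      · rw [Pi.single_eq_of_ne h]
        exact zero_mem _
    · rw [Finset.sum_eq_single k, Pi.single_eq_same, X, monomial_mul, one_mul, add_comm]
      · intro l _ hl
        rw [Pi.single_eq_of_ne hl, mul_zero]
      · simp

end Segre

end

section

open MvPolynomial

theorem exists_equiv_of_injective {σ τ : Type} [Fintype σ] [Fintype τ] (t : τ → σ)
    (ht : Function.Injective t) :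
    ∃ e : Fin (Fintype.card σ - Fintype.card τ) ⊕ τ ≃ σ, ∀ i, e (Sum.inr i) = t i := by
  classical
  let e1 : τ ≃ Set.range t := Equiv.ofInjective t ht
  have hc : Fintype.card ((Set.range t)ᶜ : Set σ) = Fintype.card σ - Fintype.card τ := by
    rw [Fintype.card_compl_set, ← Fintype.card_congr e1]
  let e2 := Fintype.equivFinOfCardEq hc
  refine ⟨(Equiv.sumCongr e2.symm e1).trans ((Equiv.sumComm _ _).trans (Equiv.Set.sumCompl _)),
    fun i => ?_⟩
  simp [e1]

section Segre

variable {K : Type u} [Field K] {σ₀ ι κ : Type}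

theorem segV_pdle_of_embedding [Fintype σ₀] [Fintype ι] [Fintype κ] (f : ι ↪ κ) (j : ℤ) :
    PDLE (SegA K σ₀ ι κ) (segV K σ₀ ι κ j)
      (Fintype.card κ * Fintype.card ι - Fintype.card ι) := by
  classical
  obtain ⟨e, he⟩ := exists_equiv_of_injective
    (Sum.elim Sum.inl (fun i => Sum.inr (f i, i)) : σ₀ ⊕ ι → σ₀ ⊕ κ × ι) (by
      rintro (s | i) (s' | i') h <;> simp_all)
  let θ : σ₀ ⊕ ι → (σ₀ ⊕ (ι ⊕ κ)) →₀ ℕ := Sum.elim (fun s => Finsupp.single (Sum.inl s) 1) fun i =>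
    Finsupp.single (Sum.inr (Sum.inr (f i))) 1 + Finsupp.single (Sum.inr (Sum.inl i)) 1
  let ht : ((σ₀ ⊕ (ι ⊕ κ)) →₀ ℕ) → (σ₀ ⊕ ι →₀ ℕ) := fun m => Finsupp.equivFunOnFinite.symm
    (Sum.elim (fun s => m (Sum.inl s)) fun i => min (m (Sum.inr (Sum.inr (f i)))) (m (Sum.inr (Sum.inl i))))
  have hw (i) : Finsupp.weight (segWt σ₀ ι κ) (θ i) = 0 := by
    rcases i with s | i <;> simp [θ, segWt, Finsupp.weight_apply]
    rw [Finsupp.sum_add_index'] <;> simp [add_mul]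
  have hlw (k) : Finsupp.weight (segWt σ₀ ι κ) (Finsupp.linearCombination ℕ θ k) = 0 := by
    rw [Finsupp.linearCombination_apply, Finsupp.sum, map_sum]
    exact Finset.sum_eq_zero fun i _ => by rw [map_nsmul, hw, smul_zero]
  have hle (m) : Finsupp.linearCombination ℕ θ (ht m) ≤ m := by
    rw [Finsupp.linearCombination_apply, Finsupp.sum_fintype _ _ (by simp)]
    rw [Fintype.sum_sum_type]
    rintro (s | i | k)
    · simp [θ, ht, Finsupp.single_apply]
    · simp [θ, ht, Finsupp.single_apply]
    · by_cases hk : ∃ i, f i = k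
      · obtain ⟨i, rfl⟩ := hk
        simp [θ, ht, Finsupp.single_apply]
      · push Not at hk
        simp [θ, ht, hk]
  have := PDLE.submodule_of_shift (K := K) (segV K σ₀ ι κ j)
    (S := {m | Finsupp.weight (segWt σ₀ ι κ) m = j}) e θ ht ?_ (fun f => mem_segV_iff) ?_ ?_ ?_
  · simpa [Nat.add_sub_add_left] using this
  · intro i
    rw [he]
    change seg K σ₀ ι κ _ = _
    rcases i with s | i
    · exact seg_X_inl s
    · refine (seg_X_inr (f i) i).trans ?_
      rw [X, X, monomial_mul, mul_one]
      rfl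
  · intro s hs i
    simp only [Set.mem_ofPred_eq] at hs ⊢
    rw [map_add, hs, hw, add_zero]
  · intro s hs
    have h2 := tsub_add_cancel_of_le (hle s)
    refine ⟨_, ?_, h2⟩
    have h3 := congrArg (Finsupp.weight (segWt σ₀ ι κ)) h2
    rw [map_add, hlw, add_zero] at h3
    exact h3.trans hs
  · intro s hs i
    ext q
    rcases i with i | i <;> rcases q with q | q <;> simp [ht, θ, Finsupp.single_apply]

/-- The chart `c_0 = 1` of the Segre variety with `κ = Fin 2`. -/
noncomputable def chartExp (σ₀ ι : Type) : σ₀ ⊕ (ι ⊕ Fin 2) → (σ₀ ⊕ (ι ⊕ Unit)) →₀ ℕ :=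
  Sum.elim (fun s => Finsupp.single (Sum.inl s) 1) (Sum.elim
    (fun i => Finsupp.single (Sum.inr (Sum.inl i)) 1)
    ![0, Finsupp.single (Sum.inr (Sum.inr ())) 1])

theorem segV_fin_two_pdle [Fintype σ₀] [Fintype ι] (j : ℕ) :
    PDLE (SegA K σ₀ ι (Fin 2)) (segV K σ₀ ι (Fin 2) j) (Fintype.card ι) := by
  classical
  let A := SegA K σ₀ ι (Fin 2)
  let W := SegW K σ₀ ι (Fin 2)
  let W' := MvPolynomial (σ₀ ⊕ (ι ⊕ Unit)) K
  let ψ : W →ₐ[K] W' := aeval fun i => monomial (chartExp σ₀ ι i) 1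
  let D := Finsupp.linearCombination ℕ (chartExp σ₀ ι)
  have hψ (m) (r : K) : ψ (monomial m r) = monomial (D m) r := aeval_monomial_monomial _ _ _
  have hD1 (m s) : D m (Sum.inl s) = m (Sum.inl s) := by
    simp [D, Finsupp.linearCombination_apply, Finsupp.sum_fintype, chartExp,
      Finsupp.single_apply]
  have hD2 (m i) : D m (Sum.inr (Sum.inl i)) = m (Sum.inr (Sum.inl i)) := by
    simp [D, Finsupp.linearCombination_apply, Finsupp.sum_fintype, chartExp,
      Finsupp.single_apply]
  have hD3 (m) : D m (Sum.inr (Sum.inr ())) = m (Sum.inr (Sum.inr 1)) := by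
    simp [D, Finsupp.linearCombination_apply, Finsupp.sum_fintype, chartExp]
  let S : Set ((σ₀ ⊕ (ι ⊕ Unit)) →₀ ℕ) :=
    {m | m (Sum.inr (Sum.inr ())) ≤ ∑ i, m (Sum.inr (Sum.inl i)) + j}
  have hwt (m : (σ₀ ⊕ (ι ⊕ Fin 2)) →₀ ℕ) : Finsupp.weight (segWt σ₀ ι (Fin 2)) m = j ↔
      m (Sum.inr (Sum.inr 0)) + m (Sum.inr (Sum.inr 1)) = ∑ i, m (Sum.inr (Sum.inl i)) + j := by
    rw [weight_segWt, Fin.sum_univ_two]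
    zify
    constructor <;> intro h <;> linarith
  let _ : Algebra A W' := (ψ.comp (seg K σ₀ ι (Fin 2))).toAlgebra
  have : IsScalarTower K A W' :=
    IsScalarTower.of_algebraMap_eq fun r => ((ψ.comp (seg K σ₀ ι (Fin 2))).commutes r).symm
  let F : segV K σ₀ ι (Fin 2) j →ₗ[A] W' :=
    { toFun := fun x => ψ x
      map_add' := fun x y => map_add ψ _ _
      map_smul' := fun a x => by
        change ψ (seg K σ₀ ι (Fin 2) a * _) = ψ (seg K σ₀ ι (Fin 2) a) * _
        rw [map_mul] }
  have hinj : Function.Injective F := by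
    rw [← LinearMap.ker_eq_bot, LinearMap.ker_eq_bot']
    rintro ⟨x, hx⟩ h0
    change ψ x = 0 at h0
    have key : ∀ e, Finsupp.weight (segWt σ₀ ι (Fin 2)) e = j → coeff (D e) (ψ x) = coeff e x := by
      refine segV_induction (P := fun x => ∀ e, Finsupp.weight (segWt σ₀ ι (Fin 2)) e = j →
        coeff (D e) (ψ x) = coeff e x) (by simp) ?_ ?_ hx
      · intro x y hx hy e he
        rw [map_add, coeff_add, coeff_add, hx e he, hy e he]
      · intro m r hm e he
        rw [hψ, coeff_monomial, coeff_monomial]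
        refine if_congr ⟨fun h => ?_, fun h => by rw [h]⟩ rfl rfl
        rw [hwt] at hm he
        have h1 (i) : m (Sum.inr (Sum.inl i)) = e (Sum.inr (Sum.inl i)) := by
          rw [← hD2, ← hD2, h]
        have h2 : m (Sum.inr (Sum.inr 1)) = e (Sum.inr (Sum.inr 1)) := by rw [← hD3, ← hD3, h]
        simp only [h1] at hm
        ext (s | i | k)
        · rw [← hD1, ← hD1, h]
        · exact h1 i
        · fin_cases k
          · simp; omega
          · exact h2
    refine Subtype.ext (MvPolynomial.ext _ _ fun e => ?_)
    by_cases he : Finsupp.weight (segWt σ₀ ι (Fin 2)) e = j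
    · rw [← key e he, h0]; simp
    · simp only [ZeroMemClass.coe_zero, coeff_zero]
      by_contra hne
      exact he (hx hne)
  have hrange (f) : f ∈ LinearMap.range F ↔ ∀ m ∈ f.support, m ∈ S := by
    constructor
    · rintro ⟨⟨x, hx⟩, rfl⟩
      change ∀ m ∈ (ψ x).support, m ∈ S
      refine segV_induction (P := fun x => ∀ m ∈ (ψ x).support, m ∈ S) (by simp) ?_ ?_ hx
      · intro x y hx hy m hm
        rw [map_add] at hm
        rcases Finset.mem_union.mp (support_add hm) with h | h
        exacts [hx m h, hy m h]
      · intro m r hm m' hm'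
        rw [hψ] at hm'
        obtain rfl : m' = D m := by simpa using support_monomial_subset hm'
        simp only [S, Set.mem_ofPred_eq, hD2, hD3]
        rw [hwt] at hm
        omega
    · intro h
      rw [← support_sum_monomial_coeff f]
      refine Submodule.sum_mem _ fun m hm => ?_
      have h1 := h m hm
      simp only [S, Set.mem_ofPred_eq] at h1
      let m' : (σ₀ ⊕ (ι ⊕ Fin 2)) →₀ ℕ := Finsupp.equivFunOnFinite.symm
        (Sum.elim (fun s => m (Sum.inl s)) (Sum.elim (fun i => m (Sum.inr (Sum.inl i)))
          ![∑ i, m (Sum.inr (Sum.inl i)) + j - m (Sum.inr (Sum.inr ())), m (Sum.inr (Sum.inr ()))]))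
      have h2 : D m' = m := by
        ext (s | i | k)
        · rw [hD1]; rfl
        · rw [hD2]; rfl
        · rw [hD3]; rfl
      refine ⟨⟨monomial m' (coeff m f), isWeightedHomogeneous_monomial _ _ _ ?_⟩, ?_⟩
      · rw [hwt]
        simp [m']
        omega
      · change ψ _ = _
        rw [hψ, h2]
  have hlc (θ : σ₀ ⊕ ι → (σ₀ ⊕ (ι ⊕ Unit)) →₀ ℕ) (k q) : Finsupp.linearCombination ℕ θ k q =
      ∑ s, k (Sum.inl s) * θ (Sum.inl s) q + ∑ i, k (Sum.inr i) * θ (Sum.inr i) q := by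
    simp [Finsupp.linearCombination_apply, Finsupp.sum_fintype]
  let ht : ((σ₀ ⊕ (ι ⊕ Unit)) →₀ ℕ) → (σ₀ ⊕ ι →₀ ℕ) := fun m => Finsupp.equivFunOnFinite.symm
    (Sum.elim (fun s => m (Sum.inl s)) fun i => m (Sum.inr (Sum.inl i)))
  have hX0 (i) : algebraMap A W' (X (Sum.inr (0, i))) = X (Sum.inr (Sum.inl i)) := by
    change ψ (seg K σ₀ ι (Fin 2) _) = _
    rw [seg_X_inr, map_mul, aeval_X, aeval_X]
    simp [chartExp, X]
  have hX1 (i) : algebraMap A W' (X (Sum.inr (1, i))) =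
      X (Sum.inr (Sum.inr ())) * X (Sum.inr (Sum.inl i)) := by
    change ψ (seg K σ₀ ι (Fin 2) _) = _
    rw [seg_X_inr, map_mul, aeval_X, aeval_X]
    simp [chartExp, X]
  have hXs (s) : algebraMap A W' (X (Sum.inl s)) = X (Sum.inl s) := by
    change ψ (seg K σ₀ ι (Fin 2) _) = _
    rw [seg_X_inl, aeval_X]
    simp [chartExp, X]
  have hW : PDLE A W' (Fintype.card ι) := by
    obtain ⟨e, he⟩ := exists_equiv_of_injective
      (Sum.elim Sum.inl (fun i => Sum.inr (0, i)) : σ₀ ⊕ ι → σ₀ ⊕ Fin 2 × ι) (by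
        rintro (s | i) (s' | i') h <;> simp_all)
    let θ : σ₀ ⊕ ι → (σ₀ ⊕ (ι ⊕ Unit)) →₀ ℕ :=
      Sum.elim (fun s => Finsupp.single (Sum.inl s) 1) fun i => Finsupp.single (Sum.inr (Sum.inl i)) 1
    have := PDLE.submodule_of_shift (K := K) (⊤ : Submodule A W')
      (S := Set.univ) e θ ht ?_ (by simp) ?_ ?_ ?_
    · have := PDLE.of_equiv Submodule.topEquiv this
      simpa [two_mul, Nat.add_sub_add_left] using this
    · intro i
      rw [he]
      rcases i with s | i
      · exact hXs s
      · exact hX0 i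
    · simp
    · intro m _
      have : Finsupp.linearCombination ℕ θ (ht m) ≤ m := by
        rintro (s | i | k) <;> rw [hlc] <;> simp [θ, ht, Finsupp.single_apply]
      exact ⟨_, trivial, tsub_add_cancel_of_le this⟩
    · intro s hs i
      ext q
      rcases i with i | i <;> rcases q with q | q <;> simp [ht, θ, Finsupp.single_apply]
  have hQ : PDLE A (W' ⧸ LinearMap.range F) (Fintype.card ι) := by
    obtain ⟨e, he⟩ := exists_equiv_of_injective
      (Sum.elim Sum.inl (fun i => Sum.inr (1, i)) : σ₀ ⊕ ι → σ₀ ⊕ Fin 2 × ι) (by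
        rintro (s | i) (s' | i') h <;> simp_all)
    let θ : σ₀ ⊕ ι → (σ₀ ⊕ (ι ⊕ Unit)) →₀ ℕ :=
      Sum.elim (fun s => Finsupp.single (Sum.inl s) 1) fun i =>
        Finsupp.single (Sum.inr (Sum.inr ())) 1 + Finsupp.single (Sum.inr (Sum.inl i)) 1
    have := PDLE.quotient_of_shift (K := K) (LinearMap.range F) (S := S) e θ ht ?_ hrange ?_ ?_ ?_
    · simpa [two_mul, Nat.add_sub_add_left] using this
    · intro i
      rw [he]
      rcases i with s | i
      · exact hXs s
      · exact (hX1 i).trans (by rw [X, X, monomial_mul, mul_one]; rfl)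
    · intro m hm i
      simp only [S, Set.mem_compl_iff, Set.mem_ofPred_eq, not_le] at hm ⊢
      rcases i with s | i
      · simpa [θ] using hm
      · simp [θ, Finset.sum_add_distrib, Finsupp.single_apply]
        omega
    · intro m hm
      simp only [S, Set.mem_compl_iff, Set.mem_ofPred_eq, not_le] at hm
      have hle : Finsupp.linearCombination ℕ θ (ht m) ≤ m := by
        rintro (s | i | k) <;> rw [hlc] <;> simp [θ, ht, Finsupp.single_apply]
        have hk : k = () := rfl
        rw [hk]
        omega
      refine ⟨_, ?_, tsub_add_cancel_of_le hle⟩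
      simp only [S, Set.mem_compl_iff, Set.mem_ofPred_eq, not_le, Finsupp.tsub_apply]
      simp [hlc, θ, ht, Finsupp.single_apply]
      omega
    · intro s hs i
      ext q
      rcases i with i | i <;> rcases q with q | q <;> simp [ht, θ, Finsupp.single_apply]
  exact PDLE.left (f := F) (g := (LinearMap.range F).mkQ) hinj
    (by rw [LinearMap.exact_iff, Submodule.ker_mkQ]) (Submodule.mkQ_surjective _) hW (hQ.mono (Nat.le_succ _))

end Segre

end

section

open MvPolynomial

section divStep

open Polynomial in
theorem mem_of_linear_dvd_map {C B : Type u} [CommRing C] [CommRing B] [IsDomain B] (φ : C →+* B)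
    (a y : B) (ha : a ≠ 0) (J : Ideal C[X])
    (hJ : ∀ f ∈ J, (Polynomial.C a * Polynomial.X + Polynomial.C y) ∣ f.map φ)
    (h3 : ∀ c, φ c = 0 → Polynomial.C c ∈ J)
    (h2 : ∀ c, a ∣ φ c → ∃ c', Polynomial.C c * Polynomial.X + Polynomial.C c' ∈ J) (f : C[X])
    (hf : (Polynomial.C a * Polynomial.X + Polynomial.C y) ∣ f.map φ) : f ∈ J := by
  induction hd : f.natDegree using Nat.strong_induction_on generalizing f with
  | _ d ih =>
  have hl : (Polynomial.C a * Polynomial.X + Polynomial.C y).natDegree = 1 :=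
    Polynomial.natDegree_linear ha
  obtain ⟨h, hh⟩ := hf
  rcases Nat.eq_zero_or_pos d with rfl | hpos
  · rw [Polynomial.eq_C_of_natDegree_eq_zero hd] at hh ⊢
    apply h3
    by_cases h0 : h = 0
    · rw [h0, mul_zero, Polynomial.map_C] at hh
      simpa using hh
    · have := congrArg Polynomial.natDegree hh
      rw [Polynomial.natDegree_mul (by intro h; simp [h] at hl) h0, hl, Polynomial.map_C,
        Polynomial.natDegree_C] at this
      omega
  · have hdvd : a ∣ φ (f.coeff d) := by
      rw [← Polynomial.coeff_map]
      by_cases hlt : (f.map φ).natDegree < d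
      · rw [Polynomial.coeff_eq_zero_of_natDegree_lt hlt]; exact dvd_zero _
      · have h4 : (f.map φ).natDegree = d :=
          le_antisymm (hd ▸ Polynomial.natDegree_map_le) (not_lt.mp hlt)
        rw [← h4, Polynomial.coeff_natDegree, hh, Polynomial.leadingCoeff_mul,
          Polynomial.leadingCoeff_linear ha]
        exact dvd_mul_right _ _
    obtain ⟨c', hc'⟩ := h2 _ hdvd
    have hg : Polynomial.X ^ (d - 1) *
        (Polynomial.C (f.coeff d) * Polynomial.X + Polynomial.C c') ∈ J := J.mul_mem_left _ hc'
    have hsub := ih _ ?_ (f - Polynomial.X ^ (d - 1) *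
        (Polynomial.C (f.coeff d) * Polynomial.X + Polynomial.C c')) ?_ rfl
    · simpa using J.add_mem hsub hg
    · obtain ⟨e, rfl⟩ : ∃ e, d = e + 1 := ⟨d - 1, by omega⟩
      rw [Nat.lt_succ_iff, Polynomial.natDegree_le_iff_coeff_eq_zero]
      intro N hN
      rw [Nat.add_sub_cancel, Polynomial.coeff_sub, mul_add, Polynomial.coeff_add, mul_comm,
        mul_assoc, ← pow_succ', mul_comm _ (Polynomial.C c'), Polynomial.coeff_C_mul_X_pow,
        Polynomial.coeff_C_mul_X_pow]
      rcases (Nat.succ_le_of_lt hN).eq_or_lt with rfl | hlt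
      · simp
      · rw [Polynomial.coeff_eq_zero_of_natDegree_lt (by omega), if_neg (by omega),
          if_neg (by omega)]
        simp
    · rw [Polynomial.map_sub]
      exact dvd_sub ⟨h, hh⟩ (hJ _ hg)

/-- The polynomial ring, viewed as a polynomial ring in one of its variables. -/
noncomputable def splitVar (K : Type u) [Field K] {σ : Type} [DecidableEq σ] (q : σ) :
    MvPolynomial σ K ≃ₐ[K] Polynomial (MvPolynomial {x // x ≠ q} K) :=
  (renameEquiv K (Equiv.optionSubtypeNe q).symm).trans (optionEquivLeft K _)

variable {K : Type u} [Field K] {σ : Type} [DecidableEq σ] (q : σ)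

@[simp] theorem splitVar_self : splitVar K q (X q) = Polynomial.X := by
  simp [splitVar]

theorem splitVar_of_ne {w : σ} (h : w ≠ q) :
    splitVar K q (X w) = Polynomial.C (X ⟨w, h⟩) := by
  simp [splitVar, Equiv.optionSubtypeNe_symm_of_ne h]

end divStep

section binomial

variable {K : Type u} [Field K] {σ P : Type}

/-- The ideal of `2 × 2` minors of a two-rowed matrix of distinct variables. -/
noncomputable def minors₂ (K : Type u) [Field K] (t : Fin 2 × P → σ) : Ideal (MvPolynomial σ K) :=
  Ideal.span {g | ∃ i j, g = X (t (0, i)) * X (t (1, j)) - X (t (0, j)) * X (t (1, i))}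

theorem exists_sum_equiv (t : Fin 2 × P → σ) (ht : Function.Injective t) :
    ∃ (τ : Set σ) (e : τ ⊕ Fin 2 × P ≃ σ), ∀ x, e (Sum.inr x) = t x := by
  classical
  exact ⟨(Set.range t)ᶜ, (Equiv.sumCongr (Equiv.refl _) (Equiv.ofInjective t ht)).trans
    ((Equiv.sumComm _ _).trans (Equiv.Set.sumCompl _)), fun x => rfl⟩

theorem map_segIdeal {σ₀ : Type} (t : Fin 2 × P → σ) (e : σ₀ ⊕ Fin 2 × P ≃ σ)
    (he : ∀ x, e (Sum.inr x) = t x) :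
    (segIdeal K σ₀ P (Fin 2)).map (renameEquiv K e) = minors₂ K t := by
  refine le_antisymm (Ideal.map_le_iff_le_comap.2 (Ideal.span_le.2 ?_)) (Ideal.span_le.2 ?_)
  · rintro _ ⟨k, l, i, j, rfl⟩
    rw [SetLike.mem_coe, Ideal.mem_comap]
    simp only [map_sub, map_mul, renameEquiv_apply, rename_X, he]
    fin_cases k <;> fin_cases l <;> simp only [Fin.zero_eta, Fin.mk_one]
    · convert Ideal.zero_mem _ using 1; ring
    · exact Ideal.subset_span ⟨i, j, rfl⟩
    · exact Ideal.subset_span ⟨j, i, by ring⟩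
    · convert Ideal.zero_mem _ using 1; ring
  · rintro _ ⟨i, j, rfl⟩
    have := Ideal.mem_map_of_mem (renameEquiv K e) (Ideal.subset_span ⟨0, 1, i, j, rfl⟩ :
      (_ : SegA K σ₀ P (Fin 2)) ∈ segIdeal K σ₀ P (Fin 2))
    simp only [map_sub, map_mul, renameEquiv_apply, rename_X, he] at this
    exact this

/-- The kernel of the chart of the Segre embedding given by `2 × P` variables `t`. -/
theorem mem_span_minors_of_chart [DecidableEq σ] (t : Fin 2 × P → σ) (ht : Function.Injective t)
    (q : MvPolynomial σ K →ₐ[K] MvPolynomial (Option σ) K)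
    (h1 : ∀ i, q (X (t (1, i))) = X none * X (some (t (0, i))))
    (h0 : ∀ w, (∀ i, w ≠ t (1, i)) → q (X w) = X (some w)) (f : MvPolynomial σ K) (hf : q f = 0) :
    f ∈ minors₂ K t := by
  classical
  obtain ⟨σ₀, e, he⟩ := exists_sum_equiv t ht
  have hes (x) : e.symm (t x) = Sum.inr x := by rw [← he, Equiv.symm_apply_apply]
  let F := FractionRing (SegW K σ₀ P (Fin 2))
  let ψ : MvPolynomial σ K →ₐ[K] SegW K σ₀ P (Fin 2) := (seg K σ₀ P (Fin 2)).comp (rename e.symm)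
  let c (k : Fin 2) : F := algebraMap (SegW K σ₀ P (Fin 2)) F (X (Sum.inr (Sum.inr k)))
  have hc : c 0 ≠ 0 := by
    simp only [c, ne_eq, FaithfulSMul.algebraMap_eq_zero_iff]
    exact X_ne_zero _
  -- the chart recovers the Segre parametrisation over the fraction field
  let r : MvPolynomial (Option σ) K →ₐ[K] F := MvPolynomial.aeval (fun o => o.elim (c 1 / c 0)
    (fun w => algebraMap (SegW K σ₀ P (Fin 2)) F (ψ (X w))))
  have hr : r.comp q = (IsScalarTower.toAlgHom K (SegW K σ₀ P (Fin 2)) F).comp ψ := by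
    ext w
    rw [AlgHom.comp_apply, AlgHom.comp_apply, IsScalarTower.toAlgHom_apply]
    by_cases hw : ∃ i, w = t (1, i)
    · obtain ⟨i, rfl⟩ := hw
      rw [h1, map_mul]
      simp only [r]
      rw [aeval_X, aeval_X]
      simp only [Option.elim, ψ, AlgHom.comp_apply, rename_X, hes, seg_X_inr, map_mul]
      rw [← mul_assoc, div_mul_cancel₀ _ hc]
    · rw [h0 w (by simpa using hw)]
      simp only [r]
      rw [aeval_X]
      rfl
  have hψ : ψ f = 0 := by
    have := congrArg (fun g => g f) hr
    simp only [AlgHom.comp_apply, hf, map_zero, IsScalarTower.toAlgHom_apply] at this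
    exact (FaithfulSMul.algebraMap_eq_zero_iff _ F).1 this.symm
  rw [AlgHom.comp_apply, seg_eq_zero_iff] at hψ
  have h2 := Ideal.mem_map_of_mem (renameEquiv K e) hψ
  rwa [map_segIdeal t e he, renameEquiv_apply, rename_rename, Equiv.self_comp_symm,
    rename_id_apply] at h2

theorem PDLE.quotient_map {R R' : Type u} [CommRing R] [CommRing R'] (e : R ≃+* R') {I : Ideal R}
    {I' : Ideal R'} (h : I.map e = I') {n : ℕ} (hI : PDLE R (R ⧸ I) n) :
    PDLE R' (R' ⧸ I') n := by
  let _ := Module.compHom (R ⧸ I) (e.symm : R' →+* R)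
  have h1 : PDLE R' (R ⧸ I) n := PDLE.of_ringEquiv e.symm (fun r x => rfl) hI
  let E := Ideal.quotientEquiv I I' e h.symm
  refine h1.of_equiv { E with map_smul' := fun r x => ?_ }
  obtain ⟨y, rfl⟩ := Ideal.Quotient.mk_surjective x
  obtain ⟨s, rfl⟩ := e.surjective r
  have h2 : (e s) • (Ideal.Quotient.mk I y) = Ideal.Quotient.mk I (s * y) := by
    change (e.symm (e s)) • (Ideal.Quotient.mk I y) = _
    rw [e.symm_apply_apply]; rfl
  change E ((e s) • (Ideal.Quotient.mk I y)) = e s • E (Ideal.Quotient.mk I y)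
  rw [h2, map_mul, map_mul]
  rfl

theorem pdle_minors₂ [Fintype σ] [Fintype P] (t : Fin 2 × P → σ) (ht : Function.Injective t) :
    PDLE (MvPolynomial σ K) (MvPolynomial σ K ⧸ minors₂ K t) (Fintype.card P) := by
  classical
  obtain ⟨σ₀, e, he⟩ := exists_sum_equiv t ht
  have := Fintype.ofFinite σ₀
  refine PDLE.quotient_map (renameEquiv K e).toRingEquiv (map_segIdeal t e he) ?_
  refine (segV_fin_two_pdle (K := K) (σ₀ := σ₀) (ι := P) 0).of_equiv ?_
  let φ : SegA K σ₀ P (Fin 2) →ₗ[SegA K σ₀ P (Fin 2)] segV K σ₀ P (Fin 2) (0 : ℕ) :=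
    LinearMap.codRestrict _ (Algebra.linearMap (SegA K σ₀ P (Fin 2)) (SegW K σ₀ P (Fin 2)))
      (fun a => seg_isWeightedHomogeneous a)
  have hs : Function.Surjective φ := fun ⟨x, hx⟩ => by
    obtain ⟨a, ha⟩ := exists_seg_eq_of_mem_segV hx
    exact ⟨a, Subtype.ext ha⟩
  refine ((Submodule.quotEquivOfEq _ _ ?_).trans (φ.quotKerEquivOfSurjective hs)).symm
  ext f
  rw [LinearMap.mem_ker, ← seg_eq_zero_iff, Subtype.ext_iff]
  rfl

end binomial

end

section

open MvPolynomial

theorem PDLE.quotient_of_twist {S B : Type u} [CommRing S] [CommRing B] [IsDomain B] (π : S →+* B)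
    {I J₁ J₂ : Ideal S} (hI : ∀ f, π f = 0 ↔ f ∈ I) (h₁ : I ≤ J₁) (h₂ : I ≤ J₂) {a b : B}
    (ha : a ≠ 0) (hb : b ≠ 0) (H₁ : ∀ f ∈ J₁, ∃ g ∈ J₂, a * π f = b * π g)
    (H₂ : ∀ g ∈ J₂, ∃ f ∈ J₁, a * π f = b * π g) {d : ℕ} (hd : PDLE S (S ⧸ I) d)
    (hd₂ : PDLE S (S ⧸ J₂) (d + 1)) : PDLE S (S ⧸ J₁) (d + 1) := by
  let _ : Algebra S B := π.toAlgebra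
  let ψ : (S ⧸ I) →ₗ[S] B := I.liftQ (Algebra.linearMap S B) fun f hf => (hI f).2 hf
  have hψ : Function.Injective ψ := by
    rw [← LinearMap.ker_eq_bot]
    refine Submodule.ker_liftQ_eq_bot _ _ _ fun f hf => (hI f).1 hf
  let N (J : Ideal S) : Submodule S (S ⧸ I) := Submodule.map I.mkQ J
  have hN (J : Ideal S) (hJ : I ≤ J) : ((S ⧸ I) ⧸ N J) ≃ₗ[S] S ⧸ J :=
    Submodule.quotientQuotientEquivQuotient I J hJ
  have hinj (c : B) (hc : c ≠ 0) : Function.Injective (LinearMap.mulLeft S c ∘ₗ ψ) :=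
    fun x y h => hψ (mul_left_cancel₀ hc h)
  have hex (J : Ideal S) : Function.Exact (N J).subtype (N J).mkQ :=
    LinearMap.exact_subtype_mkQ _
  have e : N J₂ ≃ₗ[S] N J₁ :=
    ((N J₂).equivMapOfInjective _ (hinj b hb)).trans ((LinearEquiv.ofEq _ _ (by
      ext y
      simp only [N, Submodule.mem_map, exists_exists_and_eq_and]
      constructor
      · rintro ⟨g, hg, rfl⟩
        obtain ⟨f, hf, h⟩ := H₂ g hg
        exact ⟨f, hf, h⟩
      · rintro ⟨f, hf, rfl⟩
        obtain ⟨g, hg, h⟩ := H₁ f hf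
        exact ⟨g, hg, h.symm⟩)).trans ((N J₁).equivMapOfInjective _ (hinj a ha)).symm)
  have h3 : PDLE S (N J₂) d := PDLE.left (N J₂).injective_subtype (hex J₂) (N J₂).mkQ_surjective hd
    (hd₂.of_equiv (hN J₂ h₂).symm)
  exact (PDLE.right (N J₁).injective_subtype (hex J₁) (N J₁).mkQ_surjective
    (h3.of_equiv e) (hd.mono (Nat.le_succ d))).of_equiv (hN J₁ h₁)

section chart

variable (K : Type u) [Field K] (o R : Type)

/-- Generic matrices with three columns, together with some additional variables. -/
abbrev GenMat := MvPolynomial (o ⊕ R × Fin 3) K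

variable {o R}

/-- The determinant of three rows of the generic matrix. -/
noncomputable def rowDet (i j k : R) : GenMat K o R :=
  Matrix.det !![X (Sum.inr (i, 0)), X (Sum.inr (i, 1)), X (Sum.inr (i, 2));
    X (Sum.inr (j, 0)), X (Sum.inr (j, 1)), X (Sum.inr (j, 2));
    X (Sum.inr (k, 0)), X (Sum.inr (k, 1)), X (Sum.inr (k, 2))]

/-- The `2 × 2` minor of the last two columns. -/
noncomputable def rowMinor (i j : R) : GenMat K o R :=
  X (Sum.inr (i, 1)) * X (Sum.inr (j, 2)) - X (Sum.inr (j, 1)) * X (Sum.inr (i, 2))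

variable (o) in
noncomputable def minorIdeal (s : Set R) : Ideal (GenMat K o R) :=
  Ideal.span {f | ∃ i ∈ s, ∃ j ∈ s, f = rowMinor K i j}

variable (o) in
noncomputable def detIdeal (s : Set R) : Ideal (GenMat K o R) :=
  Ideal.span {f | ∃ i ∈ s, ∃ j ∈ s, ∃ k ∈ s, f = rowDet K i j k}

/-- Coordinates of the matrices whose rows in `s` kill the vector `(v₀, v₁, -1)`. -/
abbrev ChartRing (o R : Type) := MvPolynomial (Option (Option (o ⊕ R × Fin 3))) K

/-- The entry at `(i, j)`. -/
noncomputable def chX (i : R) (j : Fin 3) : ChartRing K o R := X (some (some (Sum.inr (i, j))))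

open Classical in
variable (o) in
noncomputable def chart (s : Set R) : GenMat K o R →ₐ[K] ChartRing K o R :=
  aeval (Sum.elim (fun w => X (some (some (Sum.inl w)))) fun p => if p.1 ∈ s ∧ p.2 = 2 then
    X none * chX K p.1 0 + X (some none) * chX K p.1 1 else chX K p.1 p.2)

@[simp] theorem chart_inl (s : Set R) (w : o) : chart K o s (X (Sum.inl w)) =
    X (some (some (Sum.inl w))) := by
  simp only [chart]; rw [aeval_X]; rfl

@[simp] theorem chart_zero (s : Set R) (i : R) : chart K o s (X (Sum.inr (i, 0))) = chX K i 0 := by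
  simp only [chart]; rw [aeval_X]; simp

@[simp] theorem chart_one (s : Set R) (i : R) : chart K o s (X (Sum.inr (i, 1))) = chX K i 1 := by
  simp only [chart]; rw [aeval_X]; simp

theorem chart_two_mem {s : Set R} {i : R} (hi : i ∈ s) : chart K o s (X (Sum.inr (i, 2))) =
    X none * chX K i 0 + X (some none) * chX K i 1 := by
  simp only [chart]; rw [aeval_X]; simp [hi]

theorem chart_two_notMem {s : Set R} {i : R} (hi : i ∉ s) : chart K o s (X (Sum.inr (i, 2))) =
    chX K i 2 := by
  simp only [chart]; rw [aeval_X]; simp [hi]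

theorem rowDet_eq (i j k : R) : (rowDet K i j k : GenMat K o R) =
    X (Sum.inr (k, 0)) * rowMinor K i j - X (Sum.inr (j, 0)) * rowMinor K i k +
      X (Sum.inr (i, 0)) * rowMinor K j k := by
  simp only [rowDet, rowMinor, Matrix.det_fin_three, Matrix.of_apply, Matrix.cons_val]
  ring

theorem detIdeal_mono {s t : Set R} (h : s ⊆ t) : detIdeal K o s ≤ detIdeal K o t :=
  Ideal.span_mono fun _ ⟨i, hi, j, hj, k, hk, e⟩ => ⟨i, h hi, j, h hj, k, h hk, e⟩

theorem detIdeal_le_minorIdeal (s : Set R) : detIdeal K o s ≤ minorIdeal K o s := by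
  refine Ideal.span_le.2 ?_
  rintro _ ⟨i, hi, j, hj, k, hk, rfl⟩
  have h (a) (ha : a ∈ s) (b) (hb : b ∈ s) : rowMinor K a b ∈ minorIdeal K o s :=
    Ideal.subset_span ⟨a, ha, b, hb, rfl⟩
  rw [rowDet_eq]
  exact add_mem (sub_mem (Ideal.mul_mem_left _ _ (h _ hi _ hj)) (Ideal.mul_mem_left _ _ (h _ hi _ hk)))
    (Ideal.mul_mem_left _ _ (h _ hj _ hk))

theorem chart_eq_zero_of_mem (s : Set R) (f : GenMat K o R) (hf : f ∈ detIdeal K o s) :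
    chart K o s f = 0 := by
  refine (Ideal.span_le.2 ?_ : detIdeal K o s ≤ RingHom.ker (chart K o s)) hf
  rintro _ ⟨i, hi, j, hj, k, hk, rfl⟩
  rw [SetLike.mem_coe, RingHom.mem_ker, rowDet_eq]
  simp only [rowMinor, map_add, map_sub, map_mul, chart_zero, chart_one, chart_two_mem K hi,
    chart_two_mem K hj, chart_two_mem K hk]
  ring

/-- The linear form defining the next row condition. -/
noncomputable def chL (g : R) : ChartRing K o R :=
  X none * chX K g 0 + X (some none) * chX K g 1 - chX K g 2

theorem chart_insert_congr (s : Set R) {g : R} (hg : g ∉ s) (f : GenMat K o R) :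
    chL K g ∣ chart K o s f - chart K o (insert g s) f := by
  classical
  rw [← Ideal.mem_span_singleton, ← Ideal.Quotient.mk_eq_mk_iff_sub_mem]
  have : (Ideal.Quotient.mkₐ K (Ideal.span {(chL K g : ChartRing K o R)})).comp (chart K o s) =
      (Ideal.Quotient.mkₐ K (Ideal.span {chL K g})).comp (chart K o (insert g s)) := by
    ext w
    rw [AlgHom.comp_apply, AlgHom.comp_apply]
    rcases w with w | ⟨i, j⟩
    · rw [chart_inl, chart_inl]
    · fin_cases j
      · simp only [Fin.zero_eta, chart_zero]
      · simp only [Fin.mk_one, chart_one]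
      · simp only [Fin.reduceFinMk]
        by_cases hi : i ∈ s
        · rw [chart_two_mem K hi, chart_two_mem K (Set.mem_insert_of_mem g hi)]
        · by_cases hig : i = g
          · subst hig
            rw [chart_two_notMem K hi, chart_two_mem K (Set.mem_insert i s)]
            refine (Ideal.Quotient.mk_eq_mk_iff_sub_mem _ _).2 ?_
            rw [Ideal.mem_span_singleton]
            exact ⟨-1, by rw [chL]; ring⟩
          · rw [chart_two_notMem K hi, chart_two_notMem K (by simp [hig, hi])]
  exact congrArg (fun h => h f) this

theorem chL_dvd_chart (s : Set R) {g : R} (hg : g ∉ s) (f : GenMat K o R)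
    (hf : f ∈ detIdeal K o (insert g s)) : chL K g ∣ chart K o s f := by
  have := chart_insert_congr K s hg f
  rwa [chart_eq_zero_of_mem K _ f hf, sub_zero] at this

/-- If the chart vanishes along `v₀ = 0`, the polynomial lies in the ideal of minors. -/
theorem mem_minorIdeal_of_dvd (s : Set R) (f : GenMat K o R) (hf : X none ∣ chart K o s f) :
    f ∈ minorIdeal K o s := by
  classical
  let z : ChartRing K o R →ₐ[K] MvPolynomial (Option (o ⊕ R × Fin 3)) K :=
    aeval (fun w => w.elim 0 X)
  have z0 : z (X none) = 0 := by simp only [z]; rw [aeval_X]; rfl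
  have zs (w) : z (X (some w)) = X w := by simp only [z]; rw [aeval_X]; rfl
  let t : Fin 2 × s → o ⊕ R × Fin 3 := fun p => Sum.inr (p.2, if p.1 = 0 then 1 else 2)
  have ht : Function.Injective t := by
    rintro ⟨a, i⟩ ⟨b, j⟩ h
    fin_cases a <;> fin_cases b <;> simp_all [t, Subtype.ext_iff]
  refine (Ideal.span_le.2 ?_ : minors₂ K t ≤ _) (mem_span_minors_of_chart t ht
    (z.comp (chart K o s)) ?_ ?_ f ?_)
  · rintro _ ⟨i, j, rfl⟩
    refine Ideal.subset_span ⟨i, i.2, j, j.2, ?_⟩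
    simp [t, rowMinor]
  · intro i
    simp [t, chart_two_mem K i.2, z0, zs, chX]
  · rintro (w | ⟨i, j⟩) hw
    · simp [zs]
    · fin_cases j
      · simp [zs, chX]
      · simp [zs, chX]
      · have : i ∉ s := fun hi => hw ⟨i, hi⟩ (by simp [t])
        simp [zs, chX, chart_two_notMem K this]
  · obtain ⟨h, hh⟩ := hf
    rw [AlgHom.comp_apply, hh, map_mul, z0, zero_mul]

theorem exists_minor_of_det (s : Set R) {g : R} (hg : g ∉ s) (f : GenMat K o R)
    (hf : f ∈ detIdeal K o (insert g s)) :
    ∃ h ∈ minorIdeal K o s, X none * chart K o s f = chL K g * chart K o s h := by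
  have hm (a) (ha : a ∈ s) (b) (hb : b ∈ s) : rowMinor K a b ∈ minorIdeal K o s :=
    Ideal.subset_span ⟨a, ha, b, hb, rfl⟩
  refine Submodule.span_induction ?_ ⟨0, zero_mem _, by simp⟩ ?_ ?_ hf
  · rintro _ ⟨i, hi, j, hj, k, hk, rfl⟩
    rw [rowDet_eq]
    rcases hi with rfl | hi <;> rcases hj with rfl | hj <;> rcases hk with rfl | hk
    · exact ⟨0, zero_mem _, by simp only [rowMinor, map_add, map_sub, map_mul, map_zero]; ring⟩
    · exact ⟨0, zero_mem _, by simp only [rowMinor, map_add, map_sub, map_mul, map_zero]; ring⟩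
    · exact ⟨0, zero_mem _, by simp only [rowMinor, map_add, map_sub, map_mul, map_zero]; ring⟩
    · refine ⟨rowMinor K j k, hm _ hj _ hk, ?_⟩
      simp only [rowMinor, map_add, map_sub, map_mul, chart_zero, chart_one, chart_two_notMem K hg,
        chart_two_mem K hj, chart_two_mem K hk, chL]
      ring
    · exact ⟨0, zero_mem _, by simp only [rowMinor, map_add, map_sub, map_mul, map_zero]; ring⟩
    · refine ⟨-rowMinor K i k, neg_mem (hm _ hi _ hk), ?_⟩
      simp only [rowMinor, map_add, map_sub, map_mul, map_neg, chart_zero, chart_one, chart_two_notMem K hg,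
        chart_two_mem K hi, chart_two_mem K hk, chL]
      ring
    · refine ⟨rowMinor K i j, hm _ hi _ hj, ?_⟩
      simp only [rowMinor, map_add, map_sub, map_mul, chart_zero, chart_one, chart_two_notMem K hg,
        chart_two_mem K hi, chart_two_mem K hj, chL]
      ring
    · refine ⟨0, zero_mem _, ?_⟩
      simp only [rowMinor, map_add, map_sub, map_mul, map_zero, chart_zero, chart_one, chart_two_mem K hk,
        chart_two_mem K hi, chart_two_mem K hj, chL]
      ring
  · rintro x y - - ⟨h, hh, e⟩ ⟨h', hh', e'⟩
    exact ⟨h + h', add_mem hh hh', by rw [map_add, mul_add, e, e', map_add, mul_add]⟩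
  · rintro a x - ⟨h, hh, e⟩
    refine ⟨a * h, Ideal.mul_mem_left _ _ hh, ?_⟩
    rw [smul_eq_mul, map_mul, mul_left_comm, e, map_mul, mul_left_comm]

theorem exists_det_of_minor (s : Set R) {g : R} (hg : g ∉ s) (f : GenMat K o R)
    (hf : f ∈ minorIdeal K o s) :
    ∃ h ∈ detIdeal K o (insert g s), X none * chart K o s h = chL K g * chart K o s f := by
  refine Submodule.span_induction ?_ ⟨0, zero_mem _, by simp⟩ ?_ ?_ hf
  · rintro _ ⟨i, hi, j, hj, rfl⟩
    refine ⟨rowDet K i j g, Ideal.subset_span ⟨i, Or.inr hi, j, Or.inr hj, g, Or.inl rfl, rfl⟩, ?_⟩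
    rw [rowDet_eq]
    simp only [rowMinor, map_add, map_sub, map_mul, chart_zero, chart_one, chart_two_notMem K hg,
        chart_two_mem K hi, chart_two_mem K hj, chL]
    ring
  · rintro x y - - ⟨h, hh, e⟩ ⟨h', hh', e'⟩
    exact ⟨h + h', add_mem hh hh', by rw [map_add, mul_add, e, e', map_add, mul_add]⟩
  · rintro a x - ⟨h, hh, e⟩
    refine ⟨a * h, Ideal.mul_mem_left _ _ hh, ?_⟩
    rw [smul_eq_mul, map_mul, mul_left_comm, e, map_mul, mul_left_comm]

end chart

end

section

open MvPolynomial

section splitMap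

variable {K : Type u} [Field K] {σ τ : Type} [DecidableEq σ] [DecidableEq τ]

theorem splitVar_rename (q : σ) (c : MvPolynomial {w // w ≠ q} K) :
    splitVar K q (rename Subtype.val c) = Polynomial.C c := by
  induction c using MvPolynomial.induction_on with
  | C a =>
    rw [rename_C]
    exact (splitVar K q).commutes a
  | add p r hp hr => rw [map_add, map_add, hp, hr, Polynomial.C_add]
  | mul_X p w hp => rw [map_mul, map_mul, hp, rename_X, splitVar_of_ne q w.2, Polynomial.C_mul]

/-- A map of polynomial rings compatible with a splitting of the variables. -/
theorem exists_splitVar_map (q : σ) (Q : τ) (ch : MvPolynomial σ K →ₐ[K] MvPolynomial τ K)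
    (hq : ch (X q) = X Q)
    (hne : ∀ w, w ≠ q → ∃ b, splitVar K Q (ch (X w)) = Polynomial.C b) :
    ∃ φ : MvPolynomial {w // w ≠ q} K →+* MvPolynomial {w // w ≠ Q} K,
      ∀ f, splitVar K Q (ch f) = (splitVar K q f).map φ := by
  choose! b hb using hne
  let φ : MvPolynomial {w // w ≠ q} K →ₐ[K] MvPolynomial {w // w ≠ Q} K :=
    aeval (fun w => b w)
  refine ⟨φ.toRingHom, fun f => ?_⟩
  induction f using MvPolynomial.induction_on with
  | C a =>
    have h1 : splitVar K Q (ch (C a)) = Polynomial.C (C a) := by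
      rw [show ch (C a) = C a from ch.commutes a]
      exact (splitVar K Q).commutes a
    have h2 : splitVar K q (C a) = Polynomial.C (C a) := (splitVar K q).commutes a
    rw [h1, h2, Polynomial.map_C]
    exact congrArg _ (φ.commutes a).symm
  | add p r hp hr => rw [map_add, map_add, hp, hr, map_add, Polynomial.map_add]
  | mul_X p w hp =>
    rw [map_mul, map_mul, hp, map_mul, Polynomial.map_mul]
    congr 1
    by_cases hw : w = q
    · subst hw
      rw [hq, splitVar_self, splitVar_self, Polynomial.map_X]
    · rw [hb w hw, splitVar_of_ne q hw, Polynomial.map_C]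
      congr 1
      exact (aeval_X (R := K) (fun w : {w // w ≠ q} => b w) ⟨w, hw⟩).symm

end splitMap

variable (K : Type u) [Field K] {o R : Type}
theorem chart_empty_injective : Function.Injective (chart K o (∅ : Set R)) := by
  have : chart K o (∅ : Set R) = rename (fun w => some (some w)) := by
    ext w
    rcases w with w | ⟨i, j⟩
    · simp
    · fin_cases j <;> simp [chX, chart_two_notMem]
  rw [this]
  exact rename_injective _ fun a b h => by simpa using h


/-- Splitting off the first entry of a new row from the chart. -/
theorem exists_chart_split (s : Set R) {g : R} (hg : g ∉ s) :
    ∃ (C B : Type u) (_ : CommRing C) (_ : CommRing B) (_ : IsDomain B)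
      (E : GenMat K o R ≃+* Polynomial C) (E' : ChartRing K o R ≃+* Polynomial B) (ι : C →+* GenMat K o R)
      (φ : C →+* B) (v y : B), v ≠ 0 ∧ (∀ c, E (ι c) = Polynomial.C c) ∧
      E (X (Sum.inr (g, 0))) = Polynomial.X ∧
      (∀ w, w ≠ Sum.inr (g, 0) → ∃ c, ι c = X w) ∧
      (∀ f, E' (chart K o s f) = (E f).map φ) ∧ E' (X none) = Polynomial.C v ∧
      E' (chL K g) = Polynomial.C v * Polynomial.X + Polynomial.C y := by
  classical
  obtain ⟨q, hq⟩ : ∃ q : o ⊕ R × Fin 3, q = Sum.inr (g, 0) := ⟨_, rfl⟩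
  obtain ⟨Q, hQ⟩ : ∃ Q : Option (Option (o ⊕ R × Fin 3)), Q = some (some q) := ⟨_, rfl⟩
  have hne {w} (h : w ≠ q) : some (some w) ≠ Q := by simpa [hQ] using h
  have hij {i : R} {j : Fin 3} (h : i ≠ g ∨ j ≠ 0) : (Sum.inr (i, j) : o ⊕ R × Fin 3) ≠ q := by
    rw [hq]
    rintro h'
    simp_all
  have hch {i : R} {j : Fin 3} (h : i ≠ g ∨ j ≠ 0) :
      splitVar K Q (chX K i j) = Polynomial.C (X ⟨_, hne (hij h)⟩) := splitVar_of_ne _ _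
  obtain ⟨v, hv, hn⟩ : ∃ v, v ≠ 0 ∧ splitVar K Q (X none) = Polynomial.C v :=
    ⟨X ⟨none, by simp [hQ]⟩, X_ne_zero _, splitVar_of_ne _ _⟩
  have hsn : splitVar K Q (X (some none)) = Polynomial.C (X ⟨some none, by simp [hQ]⟩) :=
    splitVar_of_ne _ _
  have hEQ : splitVar K Q (chX K g 0) = Polynomial.X := by
    rw [chX, ← hq, ← hQ]; exact splitVar_self _
  obtain ⟨φ, hφ⟩ := exists_splitVar_map q Q (chart K o s) (by rw [hQ, hq, chart_zero, chX]) (by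
    rintro (w | ⟨i, j⟩) hw
    · rw [chart_inl]; exact ⟨_, splitVar_of_ne _ (hne hw)⟩
    · by_cases hj : i ∈ s ∧ j = 2
      · obtain ⟨hi, rfl⟩ := hj
        have hig : i ≠ g := fun h => hg (h ▸ hi)
        rw [chart_two_mem K hi, map_add, map_mul, map_mul, hn, hsn, hch (Or.inl hig),
          hch (Or.inl hig), ← Polynomial.C_mul, ← Polynomial.C_mul, ← Polynomial.C_add]
        exact ⟨_, rfl⟩
      · have : chart K o s (X (Sum.inr (i, j))) = chX K i j := by
          fin_cases j
          · simp
          · simp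
          · exact chart_two_notMem K (by simpa using hj)
        rw [this]
        exact ⟨_, splitVar_of_ne _ (hne hw)⟩)
  obtain ⟨b₁, h₁⟩ : ∃ b, splitVar K Q (chX K g 1) = Polynomial.C b := ⟨_, hch (by simp)⟩
  obtain ⟨b₂, h₂⟩ : ∃ b, splitVar K Q (chX K g 2) = Polynomial.C b := ⟨_, hch (by simp)⟩
  obtain ⟨u, hu⟩ : ∃ b, splitVar K Q (X (some none)) = Polynomial.C b := ⟨_, hsn⟩
  have hL : splitVar K Q (chL K g) = Polynomial.C v * Polynomial.X +
      Polynomial.C (u * b₁ - b₂) := by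
    rw [chL, map_sub, map_add, map_mul, map_mul, hn, hu, hEQ, h₁, h₂, Polynomial.C_sub,
      Polynomial.C_mul, add_sub_assoc]
  refine ⟨MvPolynomial {w // w ≠ q} K, MvPolynomial {w // w ≠ Q} K, inferInstance, inferInstance,
    inferInstance, (splitVar K q).toRingEquiv, (splitVar K Q).toRingEquiv,
    (rename Subtype.val : MvPolynomial {w // w ≠ q} K →ₐ[K] GenMat K o R).toRingHom, φ, v, u * b₁ - b₂, hv,
    splitVar_rename q, ?_, ?_, hφ, hn, hL⟩
  · rw [← hq]; exact splitVar_self _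
  · intro w hw
    exact ⟨X ⟨w, hq ▸ hw⟩, rename_X _ _⟩

/-- The polynomials vanishing on the chart are generated by determinants. -/
theorem chart_insert_step (s : Set R) {g : R} (hg : g ∉ s)
    (ih : ∀ f, chart K o s f = 0 → f ∈ detIdeal K o s) (f : GenMat K o R)
    (hf : chart K o (insert g s) f = 0) : f ∈ detIdeal K o (insert g s) := by
  classical
  obtain ⟨C, B, _, _, _, E, E', ι, φ, v, y, hv, hι, hX, hιX, hcomm, hn, hL⟩ :=
    exists_chart_split K (o := o) s hg
  let J : Ideal (Polynomial C) := (detIdeal K o (insert g s)).map E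
  have hJ (f) : f ∈ J ↔ E.symm f ∈ detIdeal K o (insert g s) :=
    Ideal.mem_map_of_equiv _ _ |>.trans ⟨by rintro ⟨x, hx, rfl⟩; simpa using hx,
      fun h => ⟨_, h, by simp⟩⟩
  have hEJ (f) : E f ∈ J ↔ f ∈ detIdeal K o (insert g s) := by rw [hJ, RingEquiv.symm_apply_apply]
  rw [← hEJ]
  refine mem_of_linear_dvd_map φ v y hv J ?_ ?_ ?_ _ ?_
  · intro h hh
    rw [← hL]
    have := map_dvd E' (chL_dvd_chart K s hg _ ((hJ h).1 hh))
    rwa [hcomm, RingEquiv.apply_symm_apply] at this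
  · intro c hc
    rw [← hι, hEJ]
    refine detIdeal_mono K (Set.subset_insert g s) (ih _ (E'.injective ?_))
    rw [hcomm, hι, Polynomial.map_C, hc, map_zero, map_zero]
  · intro c hc
    have h1 : ι c ∈ minorIdeal K o s := by
      refine mem_minorIdeal_of_dvd K s _ ?_
      rw [← map_dvd_iff E', hcomm, hn, hι, Polynomial.map_C]
      exact map_dvd Polynomial.C hc
    let 𝔞 : Ideal C :=
      { carrier := {c | ∃ c', Polynomial.C c * Polynomial.X + Polynomial.C c' ∈ J}
        zero_mem' := ⟨0, by simp⟩
        add_mem' := by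
          rintro a b ⟨a', ha⟩ ⟨b', hb⟩
          refine ⟨a' + b', ?_⟩
          convert J.add_mem ha hb using 1
          simp only [Polynomial.C_add]; ring
        smul_mem' := by
          rintro a b ⟨b', hb⟩
          refine ⟨a * b', ?_⟩
          convert J.mul_mem_left (Polynomial.C a) hb using 1
          simp only [smul_eq_mul, Polynomial.C_mul]; ring }
    let ε : GenMat K o R →+* C := (Polynomial.evalRingHom (0 : C)).comp (E : GenMat K o R →+* _)
    have hε (c : C) : ε (ι c) = c := by
      change Polynomial.eval 0 (E (ι c)) = c
      rw [hι, Polynomial.eval_C]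
    have h2 : minorIdeal K o s ≤ 𝔞.comap ε := by
      refine Ideal.span_le.2 ?_
      rintro _ ⟨i, hi, j, hj, rfl⟩
      have hig : i ≠ g := fun h => hg (h ▸ hi)
      have hjg : j ≠ g := fun h => hg (h ▸ hj)
      have hx (i : R) (j : Fin 3) (h : i ≠ g ∨ j ≠ 0) : ∃ c, ι c = X (Sum.inr (i, j)) :=
        hιX _ (by rintro h'; simp_all)
      have hμ (i j : R) : ∃ c, ι c = rowMinor K i j := by
        obtain ⟨a, ha⟩ := hx i 1 (by simp)
        obtain ⟨b, hb⟩ := hx j 2 (by simp)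
        obtain ⟨c, hc⟩ := hx j 1 (by simp)
        obtain ⟨d, hd⟩ := hx i 2 (by simp)
        exact ⟨a * b - c * d, by rw [map_sub, map_mul, map_mul, ha, hb, hc, hd, rowMinor]⟩
      obtain ⟨ci, hci⟩ := hx i 0 (Or.inl hig)
      obtain ⟨cj, hcj⟩ := hx j 0 (Or.inl hjg)
      obtain ⟨m, hm⟩ := hμ i j
      obtain ⟨m₁, hm₁⟩ := hμ i g
      obtain ⟨m₂, hm₂⟩ := hμ j g
      rw [SetLike.mem_coe, Ideal.mem_comap, ← hm, hε]
      have h5 : E (rowDet K i j g) ∈ J := (hEJ _).2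
        (Ideal.subset_span ⟨i, Or.inr hi, j, Or.inr hj, g, Or.inl rfl, rfl⟩)
      refine ⟨ci * m₂ - cj * m₁, ?_⟩
      convert h5 using 1
      rw [rowDet_eq, ← hm, ← hm₁, ← hm₂, ← hci, ← hcj]
      simp only [map_add, map_sub, map_mul, hX, hι]
      ring
    have := h2 h1
    rwa [Ideal.mem_comap, hε] at this
  · rw [← hL, ← hcomm]
    refine map_dvd E' ?_
    have := chart_insert_congr K s hg f
    rwa [hf, sub_zero] at this

theorem chart_eq_zero_iff (s : Set R) (hs : s.Finite) :
    ∀ f, chart K o s f = 0 ↔ f ∈ detIdeal K o s := by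
  induction s, hs using Set.Finite.induction_on with
  | empty =>
    intro f
    refine ⟨fun h => ?_, chart_eq_zero_of_mem K _ f⟩
    rw [(map_eq_zero_iff _ (chart_empty_injective K)).1 h]
    exact zero_mem _
  | @insert g s hg _ ih =>
    exact fun f => ⟨chart_insert_step K s hg (fun f => (ih f).1) f, chart_eq_zero_of_mem K _ f⟩

theorem pdle_minorIdeal [Finite o] [Finite R] (s : Set R) :
    PDLE (GenMat K o R) (GenMat K o R ⧸ minorIdeal K o s) s.ncard := by
  classical
  have := Fintype.ofFinite o
  have := Fintype.ofFinite R
  let t : Fin 2 × s → o ⊕ R × Fin 3 := fun p => Sum.inr (p.2, if p.1 = 0 then 1 else 2)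
  have ht : Function.Injective t := by
    rintro ⟨a, i⟩ ⟨b, j⟩ h
    fin_cases a <;> fin_cases b <;> simp_all [t, Subtype.ext_iff]
  have h1 : minorIdeal K o s = minors₂ K t := by
    rw [minorIdeal, minors₂]
    congr 1
    ext f
    simp [t, rowMinor]
  rw [h1, Set.ncard_eq_toFinset_card', Set.toFinset_card]
  exact pdle_minors₂ t ht

theorem pdle_detIdeal [Finite o] [Finite R] (s : Set R) (g : R) (hg : g ∉ s) :
    PDLE (GenMat K o R) (GenMat K o R ⧸ detIdeal K o (insert g s)) s.ncard := by
  classical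
  induction s, s.toFinite using Set.Finite.induction_on generalizing g with
  | empty =>
    rw [Set.ncard_empty]
    have : detIdeal K o (insert g (∅ : Set R)) = ⊥ := by
      rw [detIdeal, Ideal.span_eq_bot]
      rintro _ ⟨i, hi, j, hj, k, hk, rfl⟩
      simp only [Set.mem_insert_iff, Set.mem_empty_iff_false, or_false] at hi hj hk
      subst hi hj hk
      rw [rowDet_eq]; simp only [rowMinor]; ring
    rw [this]
    have : PDLE (GenMat K o R) (GenMat K o R) 0 := PDLE.of_projective 0
    exact this.of_equiv (Submodule.quotEquivOfEqBot _ rfl).symm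
  | @insert h s hh hs ih =>
    rw [Set.ncard_insert_of_notMem hh hs]
    refine PDLE.quotient_of_twist (chart K o (insert h s)).toRingHom
      (chart_eq_zero_iff K _ (Set.toFinite _)) (detIdeal_mono K (Set.subset_insert g _))
      (detIdeal_le_minorIdeal K _) (X_ne_zero none) (b := chL K g) ?_
      (exists_minor_of_det K _ hg) (exists_det_of_minor K _ hg) (ih h hh) ?_
    · intro h0
      have := congrArg (aeval (fun w => if w = some (some (Sum.inr (g, 2))) then (1 : K) else 0)) h0
      rw [chL, map_sub, map_add, map_mul, map_mul, chX, chX, chX, aeval_X, aeval_X, aeval_X, aeval_X,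
        aeval_X] at this
      simp at this
    · have := pdle_minorIdeal K (o := o) (insert h s)
      rwa [Set.ncard_insert_of_notMem hh hs] at this

theorem pdle_detIdeal_univ [Finite o] [Finite R] [Nonempty R] :
    PDLE (GenMat K o R) (GenMat K o R ⧸ detIdeal K o (Set.univ : Set R)) (Nat.card R - 1) := by
  obtain ⟨g⟩ := ‹Nonempty R›
  have := pdle_detIdeal K (o := o) ({g}ᶜ : Set R) g (by simp)
  have h1 : insert g ({g}ᶜ : Set R) = Set.univ := by
    ext x; simp [em]
  rwa [h1, Set.ncard_compl, Set.ncard_singleton] at this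

end

section

section rel
open Polynomial
variable {R : Type u} [CommRing R] (a : Fin 3 → Fin 3 → R) (w : Fin 3 → R)

def chE1 : R := a 0 0 + a 1 1 + a 2 2
def chE2 : R := a 0 0 * a 1 1 - a 0 1 * a 1 0 + (a 0 0 * a 2 2 - a 0 2 * a 2 0) +
  (a 1 1 * a 2 2 - a 1 2 * a 2 1)
def chE3 : R := a 0 0 * (a 1 1 * a 2 2 - a 1 2 * a 2 1) - a 0 1 * (a 1 0 * a 2 2 - a 1 2 * a 2 0) +
  a 0 2 * (a 1 0 * a 2 1 - a 1 1 * a 2 0)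

/-- The image of the row vector `w` under the matrix `a`. -/
def rowT (j : Fin 3) : R := w 0 * a 0 j + w 1 * a 1 j + w 2 * a 2 j

noncomputable def chPoly : R[X] := X ^ 3 - C (chE1 a) * X ^ 2 + C (chE2 a) * X - C (chE3 a)

noncomputable def relElt (j : Fin 3) : R[X] := C (w j) * X - C (rowT a w j)

noncomputable def relIdeal : Ideal R[X] := Ideal.span (insert (chPoly a) (Set.range (relElt a w)))

theorem chPoly_monic : (chPoly a).Monic := by
  unfold chPoly; monicity!

theorem chPoly_natDegree [Nontrivial R] : (chPoly a).natDegree = 3 := by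
  unfold chPoly; compute_degree!

/-- `a ^ 2 - e₁ a + e₂`. -/
def chBeta (i j : Fin 3) : R := a i 0 * a 0 j + a i 1 * a 1 j + a i 2 * a 2 j - chE1 a * a i j +
  if i = j then chE2 a else 0

theorem sq_mul_relElt (j : Fin 3) : X ^ 2 * relElt a w j = C (w j) * chPoly a
    - ∑ i, C (a i j - if i = j then chE1 a else 0) * (X * relElt a w i)
    - ∑ i, C (chBeta a i j) * relElt a w i := by
  fin_cases j <;>
  · simp [Fin.sum_univ_three, relElt, chPoly, rowT, chBeta, chE1, chE2, chE3]
    ring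

theorem mem_relIdeal_form {f : R[X]} (hf : f ∈ relIdeal a w) : ∃ (x y : Fin 3 → R) (h : R[X]),
    f = ∑ j, (C (x j) + C (y j) * X) * relElt a w j + chPoly a * h := by
  have key : ∀ (g f : R[X]), (∃ (x y : Fin 3 → R) (h : R[X]),
      f = ∑ j, (C (x j) + C (y j) * X) * relElt a w j + chPoly a * h) →
      (∃ (x y : Fin 3 → R) (h : R[X]),
      g * f = ∑ j, (C (x j) + C (y j) * X) * relElt a w j + chPoly a * h) := by
    intro g
    induction g using Polynomial.induction_on' with
    | add p q hp hq =>
      intro f hf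
      obtain ⟨x, y, h, e⟩ := hp f hf
      obtain ⟨x', y', h', e'⟩ := hq f hf
      refine ⟨x + x', y + y', h + h', ?_⟩
      rw [add_mul, e, e']
      simp [Fin.sum_univ_three]
      ring
    | monomial n r =>
      induction n with
      | zero =>
        rintro f ⟨x, y, h, rfl⟩
        refine ⟨fun j => r * x j, fun j => r * y j, C r * h, ?_⟩
        simp [Fin.sum_univ_three]
        ring
      | succ n ih =>
        rintro f ⟨x, y, h, rfl⟩
        have : monomial (n + 1) r = monomial n r * X := by simp
        rw [this, mul_assoc]
        apply ih
        refine ⟨fun i => - ∑ j, y j * chBeta a i j,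
          fun i => x i - ∑ j, y j * (a i j - if i = j then chE1 a else 0),
          X * h + ∑ j, C (y j) * C (w j), ?_⟩
        have e0 := sq_mul_relElt a w 0
        have e1 := sq_mul_relElt a w 1
        have e2 := sq_mul_relElt a w 2
        simp only [Fin.sum_univ_three] at e0 e1 e2 ⊢
        simp only [map_neg, map_add, map_sub, map_mul]  at e0 e1 e2 ⊢
        linear_combination C (y 0) * e0 + C (y 1) * e1 + C (y 2) * e2
  unfold relIdeal at hf
  refine Submodule.span_induction ?_ ?_ ?_ ?_ hf
  · rintro f (rfl | ⟨j, rfl⟩)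
    · exact ⟨0, 0, 1, by simp⟩
    · refine ⟨Pi.single j 1, 0, 0, ?_⟩
      rw [Finset.sum_eq_single j]
      · simp
      · intro i _ hi
        simp [hi]
      · simp
  · exact ⟨0, 0, 0, by simp⟩
  · rintro f g _ _ ⟨x, y, h, e⟩ ⟨x', y', h', e'⟩
    refine ⟨x + x', y + y', h + h', ?_⟩
    rw [e, e']
    simp [Fin.sum_univ_three]
    ring
  · intro g f _ h
    exact key g f h

theorem eq_of_quadratic_eq {p q r p' q' r' : R}
    (h : C p + C q * X + C r * X ^ 2 = C p' + C q' * X + C r' * X ^ 2) :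
    p = p' ∧ q = q' ∧ r = r' := by
  refine ⟨?_, ?_, ?_⟩
  · simpa using congrArg (fun f => coeff f 0) h
  · simpa [coeff_X, coeff_C] using congrArg (fun f => coeff f 1) h
  · simpa [coeff_X, coeff_C] using congrArg (fun f => coeff f 2) h

theorem mem_relIdeal_iff [Nontrivial R] (p q r : R) :
    C p + C q * X + C r * X ^ 2 ∈ relIdeal a w ↔ ∃ x y : Fin 3 → R,
      p = - (x 0 * rowT a w 0 + x 1 * rowT a w 1 + x 2 * rowT a w 2) ∧
      q = (x 0 * w 0 + x 1 * w 1 + x 2 * w 2) -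
        (y 0 * rowT a w 0 + y 1 * rowT a w 1 + y 2 * rowT a w 2) ∧
      r = y 0 * w 0 + y 1 * w 1 + y 2 * w 2 := by
  constructor
  · intro hf
    obtain ⟨x, y, h, e⟩ := mem_relIdeal_form a w hf
    have hlow : ∑ j, (C (x j) + C (y j) * X) * relElt a w j =
        C (- (x 0 * rowT a w 0 + x 1 * rowT a w 1 + x 2 * rowT a w 2)) +
        C ((x 0 * w 0 + x 1 * w 1 + x 2 * w 2) -
        (y 0 * rowT a w 0 + y 1 * rowT a w 1 + y 2 * rowT a w 2)) * X +
        C (y 0 * w 0 + y 1 * w 1 + y 2 * w 2) * X ^ 2 := by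
      simp only [Fin.sum_univ_three, relElt, map_neg, map_add, map_sub, map_mul]
      ring
    rw [hlow] at e
    have hh : h = 0 := by
      by_contra hh
      have h1 : (chPoly a * h).natDegree = 3 + h.natDegree := by
        rw [(chPoly_monic a).natDegree_mul' hh, chPoly_natDegree]
      have h2 : chPoly a * h = C (p - (- (x 0 * rowT a w 0 + x 1 * rowT a w 1 + x 2 * rowT a w 2))) + C (q - ((x 0 * w 0 + x 1 * w 1 + x 2 * w 2) -
        (y 0 * rowT a w 0 + y 1 * rowT a w 1 + y 2 * rowT a w 2))) * X +
        C (r - (y 0 * w 0 + y 1 * w 1 + y 2 * w 2)) * X ^ 2 := by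
        simp only [map_sub] at e ⊢
        linear_combination -e
      have h3 : (chPoly a * h).natDegree ≤ 2 := by
        rw [h2]; compute_degree
      omega
    rw [hh, mul_zero, add_zero] at e
    obtain ⟨h0, h1, h2⟩ := eq_of_quadratic_eq e
    exact ⟨x, y, h0, h1, h2⟩
  · rintro ⟨x, y, hp, hq, hr⟩
    have : C p + C q * X + C r * X ^ 2 = ∑ j, (C (x j) + C (y j) * X) * relElt a w j := by
      rw [hp, hq, hr]
      simp only [Fin.sum_univ_three, relElt, map_neg, map_add, map_sub, map_mul]
      ring
    rw [this]
    exact Ideal.sum_mem _ fun j _ => Ideal.mul_mem_left _ _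
      (Ideal.subset_span (Set.mem_insert_of_mem _ ⟨j, rfl⟩))

end rel

end

section

open MvPolynomial

section koszul

theorem mem_span_X_of_X_mul_mem {K : Type u} [Field K] {σ : Type} (s : Set σ) {q : σ} (hq : q ∉ s)
    {f : MvPolynomial σ K} (h : X q * f ∈ Ideal.span (X '' s : Set (MvPolynomial σ K))) :
    f ∈ Ideal.span (X '' s : Set (MvPolynomial σ K)) := by
  classical
  rw [mem_ideal_span_X_image] at h ⊢
  intro m hm
  obtain ⟨i, hi, h'⟩ := h (Finsupp.single q 1 + m) (by
    rw [mem_support_iff, coeff_X_mul]; exact mem_support_iff.1 hm)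
  refine ⟨i, hi, ?_⟩
  rw [Finsupp.add_apply, Finsupp.single_apply, if_neg (by rintro rfl; exact hq hi), zero_add] at h'
  exact h'

variable {R : Type u} [CommRing R] [IsDomain R] (a : Fin 3 → Fin 3 → R) (w : Fin 3 → R)

def cross3 (u v : Fin 3 → R) : Fin 3 → R :=
  ![u 1 * v 2 - u 2 * v 1, u 2 * v 0 - u 0 * v 2, u 0 * v 1 - u 1 * v 0]

structure GoodRow : Prop where
  ne_zero : w 0 ≠ 0
  dvd_one : ∀ f, w 0 ∣ w 1 * f → w 0 ∣ f
  mem_two : ∀ f, w 2 * f ∈ Ideal.span {w 0, w 1} → f ∈ Ideal.span {w 0, w 1}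
  prime : Prime (cross3 w (rowT a w) 0)
  not_dvd : ¬ cross3 w (rowT a w) 0 ∣ cross3 w (rowT a w) 1

variable {a w}

theorem GoodRow.exists_cross (h : GoodRow a w) {y : Fin 3 → R}
    (hy : y 0 * w 0 + y 1 * w 1 + y 2 * w 2 = 0) : ∃ u, y = cross3 w u := by
  have h2 : y 2 ∈ Ideal.span {w 0, w 1} := by
    apply h.mem_two
    rw [Ideal.mem_span_pair]
    exact ⟨- y 0, - y 1, by linear_combination -hy⟩
  obtain ⟨p, q, h2⟩ := Ideal.mem_span_pair.1 h2
  obtain ⟨s, hs⟩ := h.dvd_one (y 1 + q * w 2) ⟨-(y 0 + p * w 2), by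
    linear_combination hy + w 2 * h2⟩
  refine ⟨![-q, p, -s], ?_⟩
  have h0 : y 0 = - w 1 * s - p * w 2 := by
    apply mul_left_cancel₀ h.ne_zero
    linear_combination hy + w 2 * h2 - w 1 * hs
  ext j
  fin_cases j
  · simp [cross3]; linear_combination h0
  · simp [cross3]; linear_combination hs
  · simp [cross3]; linear_combination -h2

theorem GoodRow.exists_smul_cross (h : GoodRow a w) {x : Fin 3 → R}
    (hx : x 0 * w 0 + x 1 * w 1 + x 2 * w 2 = 0)
    (hx' : x 0 * rowT a w 0 + x 1 * rowT a w 1 + x 2 * rowT a w 2 = 0) :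
    ∃ s : R, ∀ j, x j = s * cross3 w (rowT a w) j := by
  have hp := h.prime
  have hn := h.not_dvd
  generalize rowT a w = t at *
  have h01 : x 0 * cross3 w t 1 = x 1 * cross3 w t 0 := by
    simp [cross3]; linear_combination -t 2 * hx + w 2 * hx'
  have h02 : x 0 * cross3 w t 2 = x 2 * cross3 w t 0 := by
    simp [cross3]; linear_combination t 1 * hx - w 1 * hx'
  obtain ⟨s, hs⟩ := (hp.dvd_mul.1 ⟨x 1, by rw [h01, mul_comm]⟩).resolve_right hn
  refine ⟨s, fun j => ?_⟩
  apply mul_right_cancel₀ hp.ne_zero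
  fin_cases j
  · simp only [Fin.zero_eta, Fin.isValue]; rw [hs]; ring
  · simp only [Fin.mk_one, Fin.isValue]; rw [← h01, hs]; ring
  · simp only [Fin.reduceFinMk, Fin.isValue]; rw [← h02, hs]; ring

theorem GoodRow.eq_zero (h : GoodRow a w) {u : Fin 3 → R} (h1 : cross3 w u = 0)
    (h2 : cross3 u (rowT a w) = 0) : u = 0 := by
  have e0 := congrFun h1 0
  have e1 := congrFun h1 1
  have e2 := congrFun h1 2
  have f0 := congrFun h2 0
  simp [cross3] at e0 e1 e2 f0
  obtain ⟨s, hs⟩ := h.dvd_one (u 0) ⟨u 1, by linear_combination -e2⟩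
  have hs1 : u 1 = w 1 * s := by
    apply mul_left_cancel₀ h.ne_zero
    linear_combination e2 + w 1 * hs
  have hs2 : u 2 = w 2 * s := by
    apply mul_left_cancel₀ h.ne_zero
    linear_combination -e1 + w 2 * hs
  have : s = 0 := by
    apply mul_right_cancel₀ h.prime.ne_zero
    simp only [cross3, Matrix.cons_val_zero]
    rw [hs1, hs2] at f0
    linear_combination f0
  ext j
  fin_cases j
  · simp [hs, this]
  · simp [hs1, this]
  · simp [hs2, this]

end koszul

section segGood

variable (K : Type u) [Field K] (o κ : Type)

/-- The universal matrix over `SegW`. -/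
noncomputable def alW (i j : Fin 3) : SegW K ((Fin 3 × Fin 3) ⊕ o) (Fin 3) κ :=
  X (Sum.inl (Sum.inl (i, j)))

/-- The universal row vector over `SegW`. -/
noncomputable def wW (i : Fin 3) : SegW K ((Fin 3 × Fin 3) ⊕ o) (Fin 3) κ :=
  X (Sum.inr (Sum.inl i))

theorem goodRow_segW : GoodRow (alW K o κ) (wW K o κ) where
  ne_zero := X_ne_zero _
  dvd_one f h := by
    have h1 := mem_span_X_of_X_mul_mem (K := K)
      (σ := ((Fin 3 × Fin 3) ⊕ o) ⊕ (Fin 3 ⊕ κ)) {Sum.inr (Sum.inl 0)}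
      (q := Sum.inr (Sum.inl 1)) (by simp) (f := f) (by
        rw [Set.image_singleton, Ideal.mem_span_singleton]; exact h)
    rw [Set.image_singleton, Ideal.mem_span_singleton] at h1
    exact h1
  mem_two f h := by
    have h1 := mem_span_X_of_X_mul_mem (K := K)
      (σ := ((Fin 3 × Fin 3) ⊕ o) ⊕ (Fin 3 ⊕ κ)) {Sum.inr (Sum.inl 0), Sum.inr (Sum.inl 1)}
      (q := Sum.inr (Sum.inl 2)) (by simp) (f := f) (by
        rw [Set.image_pair]; exact h)
    rw [Set.image_pair] at h1
    exact h1
  prime := by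
    rw [← irreducible_iff_prime]
    have e : cross3 (wW K o κ) (rowT (alW K o κ) (wW K o κ)) 0 =
        X (Sum.inr (Sum.inl 1)) ^ 2 * X (Sum.inl (Sum.inl (1, 2))) +
        (X (Sum.inr (Sum.inl 1)) * (X (Sum.inr (Sum.inl 0)) * X (Sum.inl (Sum.inl (0, 2))) +
            X (Sum.inr (Sum.inl 2)) * X (Sum.inl (Sum.inl (2, 2)))) -
          X (Sum.inr (Sum.inl 2)) * (X (Sum.inr (Sum.inl 0)) * X (Sum.inl (Sum.inl (0, 1))) +
            X (Sum.inr (Sum.inl 1)) * X (Sum.inl (Sum.inl (1, 1))) +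
            X (Sum.inr (Sum.inl 2)) * X (Sum.inl (Sum.inl (2, 1))))) := by
      simp [cross3, rowT, alW, wW]
      ring
    rw [e]
    have hv : ∀ f : SegW K ((Fin 3 × Fin 3) ⊕ o) (Fin 3) κ,
        f ∈ supported K ({Sum.inl (Sum.inl (1, 2))}ᶜ : Set (((Fin 3 × Fin 3) ⊕ o) ⊕ (Fin 3 ⊕ κ))) →
        Sum.inl (Sum.inl (1, 2)) ∉ f.vars := fun f hf hm => (mem_supported.1 hf) hm rfl
    have hX : ∀ i, i ≠ Sum.inl (Sum.inl (1, 2)) → (X i : SegW K ((Fin 3 × Fin 3) ⊕ o) (Fin 3) κ) ∈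
        supported K ({Sum.inl (Sum.inl (1, 2))}ᶜ : Set (((Fin 3 × Fin 3) ⊕ o) ⊕ (Fin 3 ⊕ κ))) :=
      fun i hi => X_mem_supported.2 hi
    apply irreducible_mul_X_add
    · exact pow_ne_zero _ (X_ne_zero _)
    · exact hv _ (pow_mem (hX _ (by simp)) _)
    · apply hv
      repeat' first
        | apply sub_mem
        | apply add_mem
        | apply mul_mem
        | exact hX _ (by simp)
    · apply IsRelPrime.pow_left
      rw [(X_prime (R := K)).irreducible.isRelPrime_iff_not_dvd]
      rintro ⟨g, hg⟩
      classical
      have := congrArg (aeval (fun i => if i = Sum.inr (Sum.inl 2) ∨ i = Sum.inl (Sum.inl (2, 1))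
        then (1 : K) else 0)) hg
      simp only [map_mul, map_sub, map_add, aeval_X] at this
      simp at this
  not_dvd := by
    rintro ⟨g, hg⟩
    classical
    have := congrArg (aeval (fun i => if i = Sum.inr (Sum.inl 2) ∨ i = Sum.inl (Sum.inl (2, 0))
        then (1 : K) else 0)) hg
    simp only [cross3, rowT, alW, wW, Matrix.cons_val_zero, Matrix.cons_val_one,
      map_mul, map_sub, map_add, aeval_X] at this
    simp at this

end segGood

end

section

open MvPolynomial

section comp

variable (K : Type u) [Field K] (σ₀ ι κ : Type)

/-- The weight-`j` component. -/
noncomputable def segComp (j : ℤ) : SegW K σ₀ ι κ →ₗ[K] SegW K σ₀ ι κ :=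
  weightedHomogeneousComponent (segWt σ₀ ι κ) j

variable {K σ₀ ι κ}

theorem segComp_mem (j : ℤ) (x : SegW K σ₀ ι κ) : segComp K σ₀ ι κ j x ∈ segV K σ₀ ι κ j :=
  weightedHomogeneousComponent_isWeightedHomogeneous _ _

theorem segComp_same {j : ℤ} {x : SegW K σ₀ ι κ} (hx : x ∈ segV K σ₀ ι κ j) :
    segComp K σ₀ ι κ j x = x :=
  IsWeightedHomogeneous.weightedHomogeneousComponent_same hx

theorem segComp_ne {i j : ℤ} {x : SegW K σ₀ ι κ} (hx : x ∈ segV K σ₀ ι κ i) (h : j ≠ i) :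
    segComp K σ₀ ι κ j x = 0 :=
  IsWeightedHomogeneous.weightedHomogeneousComponent_ne _ hx h

theorem segComp_mul {i j : ℤ} (k : ℤ) (hk : j + i = k) (x : SegW K σ₀ ι κ) {y : SegW K σ₀ ι κ}
    (hy : y ∈ segV K σ₀ ι κ i) :
    segComp K σ₀ ι κ k (x * y) = segComp K σ₀ ι κ j x * y := by
  subst hk
  induction x using MvPolynomial.induction_on' with
  | add p q hp hq => simp only [add_mul, map_add, hp, hq]
  | monomial m r =>
    have hm : (monomial m r : SegW K σ₀ ι κ) ∈ segV K σ₀ ι κ (Finsupp.weight (segWt σ₀ ι κ) m) :=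
      isWeightedHomogeneous_monomial _ _ _ rfl
    by_cases h : j = Finsupp.weight (segWt σ₀ ι κ) m
    · subst h
      rw [segComp_same hm, segComp_same (segV_mul hm hy)]
    · rw [segComp_ne hm h, segComp_ne (segV_mul hm hy) (fun e => h (add_right_cancel e)), zero_mul]

end comp

namespace PDLE
theorem map {R M N : Type u} [CommRing R] [AddCommGroup M] [Module R M] [AddCommGroup N]
    [Module R N] (d : M →ₗ[R] N) (P : Submodule R M) (Q : Submodule R M)
    (hQ : ∀ x, x ∈ Q ↔ x ∈ P ∧ d x = 0) {n : ℕ} (h1 : PDLE R Q n)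
    (h2 : PDLE R P (n + 1)) : PDLE R (P.map d) (n + 1) := by
  have hle : Q ≤ P := fun x hx => ((hQ x).1 hx).1
  refine right (f := Submodule.inclusion hle) (g := d.submoduleMap P)
    (Submodule.inclusion_injective hle) ?_ (d.submoduleMap_surjective P) h1 h2
  rintro ⟨x, hx⟩
  constructor
  · intro h
    exact ⟨⟨x, (hQ x).2 ⟨hx, congrArg Subtype.val h⟩⟩, rfl⟩
  · rintro ⟨⟨y, hy⟩, h⟩
    obtain rfl : y = x := congrArg Subtype.val h
    exact Subtype.ext ((hQ y).1 hy).2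

theorem map_of_injective {R M N : Type u} [CommRing R] [AddCommGroup M] [Module R M]
    [AddCommGroup N] [Module R N] (d : M →ₗ[R] N) (hd : Function.Injective d) (P : Submodule R M)
    {n : ℕ} (h : PDLE R P n) : PDLE R (P.map d) n :=
  h.of_equiv (Submodule.equivMapOfInjective d hd P)

theorem submodule_pi {R M : Type u} [CommRing R] [AddCommGroup M] [Module R M] {r : ℕ}
    (P : Submodule R M) {n : ℕ} (h : PDLE R P n) :
    PDLE R (Submodule.pi Set.univ fun _ : Fin r => P) n :=
  (PDLE.pi (r := r) h).of_equiv
    { toFun := fun x => ⟨fun i => x i, fun i _ => (x i).2⟩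
      invFun := fun x i => ⟨x.1 i, x.2 i trivial⟩
      map_add' := fun _ _ => rfl
      map_smul' := fun _ _ => rfl
      left_inv := fun _ => rfl
      right_inv := fun _ => rfl }

theorem submodule_prod {R M N : Type u} [CommRing R] [AddCommGroup M] [Module R M]
    [AddCommGroup N] [Module R N]
    (P : Submodule R M) (Q : Submodule R N) {n : ℕ} (h : PDLE R P n) (h' : PDLE R Q n) :
    PDLE R (P.prod Q) n :=
  let e : (P × Q) ≃ₗ[R] P.prod Q :=
    { toFun := fun x => ⟨(x.1, x.2), x.1.2, x.2.2⟩
      invFun := fun x => (⟨x.1.1, x.2.1⟩, ⟨x.1.2, x.2.2⟩)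
      map_add' := fun _ _ => rfl
      map_smul' := fun _ _ => rfl
      left_inv := fun _ => rfl
      right_inv := fun _ => rfl }
  (PDLE.prod h h').of_equiv e

end PDLE

section diffs

variable {R : Type u} [CommRing R] (w t : Fin 3 → R)

def hbOne : ((Fin 3 → R) × (Fin 3 → R)) →ₗ[R] (Fin 3 → R) where
  toFun z := ![-(z.1 0 * t 0 + z.1 1 * t 1 + z.1 2 * t 2),
    (z.1 0 * w 0 + z.1 1 * w 1 + z.1 2 * w 2) - (z.2 0 * t 0 + z.2 1 * t 1 + z.2 2 * t 2),
    z.2 0 * w 0 + z.2 1 * w 1 + z.2 2 * w 2]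
  map_add' x y := by
    ext i
    fin_cases i <;> simp <;> ring
  map_smul' r x := by
    ext i
    fin_cases i <;> simp <;> ring

def hbTwo : (Fin 3 → R) →ₗ[R] ((Fin 3 → R) × (Fin 3 → R)) where
  toFun u := (cross3 u t, cross3 w u)
  map_add' x y := by
    ext i <;> fin_cases i <;> simp [cross3] <;> ring
  map_smul' r x := by
    ext i <;> fin_cases i <;> simp [cross3] <;> ring

theorem hbOne_hbTwo (u : Fin 3 → R) : hbOne w t (hbTwo w t u) = 0 := by
  ext i
  fin_cases i <;> simp [hbOne, hbTwo, cross3] <;> ring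

variable {w} {a : Fin 3 → Fin 3 → R} [IsDomain R]

theorem GoodRow.exists_hbTwo (h : GoodRow a w) {z : (Fin 3 → R) × (Fin 3 → R)}
    (hz : hbOne w (rowT a w) z = 0) : ∃ u, z = hbTwo w (rowT a w) u := by
  obtain ⟨x, y⟩ := z
  have h0 := congrFun hz 0
  have h1 := congrFun hz 1
  have h2 := congrFun hz 2
  simp only [hbOne, LinearMap.coe_mk, AddHom.coe_mk, Matrix.cons_val_zero, Matrix.cons_val_one,
    Matrix.cons_val, Pi.zero_apply, neg_eq_zero] at h0 h1 h2
  obtain ⟨u, rfl⟩ := h.exists_cross h2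
  obtain ⟨s, hs⟩ := h.exists_smul_cross (x := x - cross3 u (rowT a w))
    (by
      simp only [cross3, Matrix.cons_val_zero, Matrix.cons_val_one,
        Matrix.cons_val, Pi.sub_apply] at h1 ⊢
      linear_combination h1)
    (by
      simp only [cross3, Matrix.cons_val_zero, Matrix.cons_val_one,
        Matrix.cons_val, Pi.sub_apply] at h0 ⊢
      linear_combination h0)
  refine ⟨u + s • w, ?_⟩
  have hx : ∀ j, x j = cross3 u (rowT a w) j + s * cross3 w (rowT a w) j := fun j => by
    rw [← hs j, Pi.sub_apply]; ring
  ext j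
  · refine (hx j).trans ?_
    fin_cases j <;> simp [hbTwo, cross3] <;> ring
  · fin_cases j <;> simp [hbTwo, cross3] <;> ring

theorem GoodRow.hbTwo_injective (h : GoodRow a w) :
    Function.Injective (hbTwo w (rowT a w)) := by
  rw [injective_iff_map_eq_zero]
  intro u hu
  exact h.eq_zero (congrArg Prod.snd hu) (congrArg Prod.fst hu)

end diffs

section modY

variable (K : Type u) [Field K] (o κ : Type)

abbrev AA := SegA K ((Fin 3 × Fin 3) ⊕ o) (Fin 3) κ
abbrev WW := SegW K ((Fin 3 × Fin 3) ⊕ o) (Fin 3) κ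
noncomputable abbrev VV (j : ℤ) := segV K ((Fin 3 × Fin 3) ⊕ o) (Fin 3) κ j

/-- The image `w α` of the universal row vector. -/
noncomputable abbrev tW : Fin 3 → WW K o κ := rowT (alW K o κ) (wW K o κ)

abbrev YY := Polynomial (WW K o κ) ⧸ relIdeal (alW K o κ) (wW K o κ)

noncomputable def thetaY : (Fin 3 → WW K o κ) →ₗ[AA K o κ] YY K o κ where
  toFun a := Ideal.Quotient.mk _
    (Polynomial.C (a 0) + Polynomial.C (a 1) * Polynomial.X + Polynomial.C (a 2) * Polynomial.X ^ 2)
  map_add' x y := by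
    rw [← map_add]
    congr 1
    simp only [Pi.add_apply, map_add]
    ring
  map_smul' r x := by
    change _ = Ideal.Quotient.mk _ (r • _)
    congr 1
    simp only [smul_add, Pi.smul_apply, ← Polynomial.smul_C, smul_mul_assoc]

theorem wW_mem (i) : wW K o κ i ∈ VV K o κ (-1) := X_p_mem i

theorem alW_mem (i j) : alW K o κ i j ∈ VV K o κ 0 := X_s_mem _

theorem tW_mem (i) : tW K o κ i ∈ VV K o κ (-1) := by
  refine add_mem (add_mem ?_ ?_) ?_ <;>
  exact segV_mul (wW_mem K o κ _) (alW_mem K o κ _ _)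

variable {K o κ}

theorem segComp_mul_w (k : ℤ) (x : WW K o κ) (i) : segComp K _ _ _ k (x * wW K o κ i) =
    segComp K _ _ _ (k + 1) x * wW K o κ i :=
  segComp_mul k (by ring) x (wW_mem K o κ i)

theorem segComp_mul_t (k : ℤ) (x : WW K o κ) (i) : segComp K _ _ _ k (x * tW K o κ i) =
    segComp K _ _ _ (k + 1) x * tW K o κ i :=
  segComp_mul k (by ring) x (tW_mem K o κ i)

variable (K o κ) in
/-- Triples in the weight-`j` strand. -/
noncomputable def V3 (j : ℤ) : Submodule (AA K o κ) (Fin 3 → WW K o κ) :=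
  Submodule.pi Set.univ fun _ => VV K o κ j

theorem mem_V3 {j : ℤ} {x : Fin 3 → WW K o κ} : x ∈ V3 K o κ j ↔ ∀ i, x i ∈ VV K o κ j := by
  simp [V3, Submodule.mem_pi]

theorem thetaY_eq_zero_iff (x : Fin 3 → WW K o κ) :
    thetaY K o κ x = 0 ↔ ∃ z, x = hbOne (wW K o κ) (tW K o κ) z := by
  change Ideal.Quotient.mk _ _ = 0 ↔ _
  rw [Ideal.Quotient.eq_zero_iff_mem, mem_relIdeal_iff]
  constructor
  · rintro ⟨y, z, h0, h1, h2⟩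
    refine ⟨(y, z), ?_⟩
    ext i : 1
    fin_cases i
    · exact h0
    · exact h1
    · exact h2
  · rintro ⟨⟨y, z⟩, h⟩
    exact ⟨y, z, congrFun h 0, congrFun h 1, congrFun h 2⟩

theorem segComp_hbOne (k : ℤ) (z) (i) :
    segComp K _ _ _ k (hbOne (wW K o κ) (tW K o κ) z i) =
    hbOne (wW K o κ) (tW K o κ) (fun i => segComp K _ _ _ (k + 1) (z.1 i),
      fun i => segComp K _ _ _ (k + 1) (z.2 i)) i := by
  fin_cases i <;>
  simp [hbOne, -map_mul, segComp_mul_w, segComp_mul_t]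

theorem segComp_hbTwo (k : ℤ) (u) :
    hbTwo (wW K o κ) (tW K o κ) (fun i => segComp K _ _ _ (k + 1) (u i)) =
    (fun i => segComp K _ _ _ k ((hbTwo (wW K o κ) (tW K o κ) u).1 i),
      fun i => segComp K _ _ _ k ((hbTwo (wW K o κ) (tW K o κ) u).2 i)) := by
  ext i : 2 <;> fin_cases i <;>
  simp [hbTwo, cross3, -map_mul, segComp_mul_w, segComp_mul_t, mul_comm (wW K o κ _)]

theorem hbOne_mem {j : ℤ} {z} (h1 : z.1 ∈ V3 K o κ j) (h2 : z.2 ∈ V3 K o κ j) :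
    hbOne (wW K o κ) (tW K o κ) z ∈ V3 K o κ (j - 1) := by
  rw [mem_V3] at *
  have hw : ∀ i, ∀ x ∈ VV K o κ j, x * wW K o κ i ∈ VV K o κ (j - 1) :=
    fun i x hx => segV_mul hx (wW_mem K o κ i)
  have ht : ∀ i, ∀ x ∈ VV K o κ j, x * tW K o κ i ∈ VV K o κ (j - 1) :=
    fun i x hx => segV_mul hx (tW_mem K o κ i)
  intro i
  fin_cases i
  · exact neg_mem (add_mem (add_mem (ht _ _ (h1 _)) (ht _ _ (h1 _))) (ht _ _ (h1 _)))
  · exact sub_mem (add_mem (add_mem (hw _ _ (h1 _)) (hw _ _ (h1 _))) (hw _ _ (h1 _)))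
      (add_mem (add_mem (ht _ _ (h2 _)) (ht _ _ (h2 _))) (ht _ _ (h2 _)))
  · exact add_mem (add_mem (hw _ _ (h2 _)) (hw _ _ (h2 _))) (hw _ _ (h2 _))

variable (K o κ) in
/-- The weight-zero strand of `YY`. -/
noncomputable def Y0 : Submodule (AA K o κ) (YY K o κ) := (V3 K o κ 0).map (thetaY K o κ)

/-- An element of `V3 0` dies in `YY` iff it is in the image of the strand of `hbOne`. -/
theorem thetaY_eq_zero_iff' {x : Fin 3 → WW K o κ} (hx : x ∈ V3 K o κ 0) :
    thetaY K o κ x = 0 ↔ ∃ z, z.1 ∈ V3 K o κ 1 ∧ z.2 ∈ V3 K o κ 1 ∧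
      hbOne (wW K o κ) (tW K o κ) z = x := by
  rw [thetaY_eq_zero_iff]
  constructor
  · rintro ⟨z, rfl⟩
    refine ⟨(fun i => segComp K _ _ _ (0 + 1) (z.1 i), fun i => segComp K _ _ _ (0 + 1) (z.2 i)),
      mem_V3.2 fun i => segComp_mem _ _, mem_V3.2 fun i => segComp_mem _ _, ?_⟩
    ext i : 1
    rw [← segComp_hbOne, segComp_same (mem_V3.1 hx i)]
  · rintro ⟨z, _, _, rfl⟩
    exact ⟨z, rfl⟩

theorem hbOne_eq_zero_iff' {z} (h1 : z.1 ∈ V3 K o κ 1) (h2 : z.2 ∈ V3 K o κ 1) :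
    hbOne (wW K o κ) (tW K o κ) z = 0 ↔ ∃ u ∈ V3 K o κ 2, hbTwo (wW K o κ) (tW K o κ) u = z := by
  constructor
  · intro h
    obtain ⟨u, rfl⟩ := (goodRow_segW K o κ).exists_hbTwo h
    refine ⟨fun i => segComp K _ _ _ (1 + 1) (u i), mem_V3.2 fun i => segComp_mem _ _, ?_⟩
    rw [segComp_hbTwo]
    ext i : 2
    · exact segComp_same (mem_V3.1 h1 i)
    · exact segComp_same (mem_V3.1 h2 i)
  · rintro ⟨u, _, rfl⟩
    exact hbOne_hbTwo _ _ u

theorem hbTwo_mem {j : ℤ} {u} (h : u ∈ V3 K o κ (j + 1)) :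
    (hbTwo (wW K o κ) (tW K o κ) u).1 ∈ V3 K o κ j ∧
    (hbTwo (wW K o κ) (tW K o κ) u).2 ∈ V3 K o κ j := by
  simp only [mem_V3] at *
  constructor <;> intro i
  · have : ∀ i, (hbTwo (wW K o κ) (tW K o κ) u).1 i =
      segComp K _ _ _ j ((hbTwo (wW K o κ) (tW K o κ) u).1 i) := by
      intro i
      conv_lhs => rw [show u = (fun i => segComp K _ _ _ (j + 1) (u i)) from
        funext fun i => (segComp_same (h i)).symm, segComp_hbTwo]
    rw [this]
    exact segComp_mem _ _
  · have : ∀ i, (hbTwo (wW K o κ) (tW K o κ) u).2 i =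
      segComp K _ _ _ j ((hbTwo (wW K o κ) (tW K o κ) u).2 i) := by
      intro i
      conv_lhs => rw [show u = (fun i => segComp K _ _ _ (j + 1) (u i)) from
        funext fun i => (segComp_same (h i)).symm, segComp_hbTwo]
    rw [this]
    exact segComp_mem _ _

theorem pdle_Y0 {n : ℕ} (h : ∀ j : ℕ, PDLE (AA K o κ) (VV K o κ j) n) :
    PDLE (AA K o κ) (Y0 K o κ) (n + 2) := by
  have h3 : ∀ j : ℕ, PDLE (AA K o κ) (V3 K o κ j) n := fun j => PDLE.submodule_pi _ (h j)
  refine PDLE.map (thetaY K o κ) (V3 K o κ 0)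
    (((V3 K o κ 1).prod (V3 K o κ 1)).map
      ((hbOne (wW K o κ) (tW K o κ)).restrictScalars (AA K o κ))) ?_ (n := n + 1) ?_
    ((h3 0).mono (by omega))
  · intro x
    constructor
    · rintro ⟨z, ⟨hz1, hz2⟩, rfl⟩
      have : hbOne (wW K o κ) (tW K o κ) z ∈ V3 K o κ 0 := hbOne_mem hz1 hz2
      exact ⟨this, (thetaY_eq_zero_iff' this).2 ⟨z, hz1, hz2, rfl⟩⟩
    · rintro ⟨hx, hx0⟩
      obtain ⟨z, h1, h2, rfl⟩ := (thetaY_eq_zero_iff' hx).1 hx0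
      exact ⟨z, ⟨h1, h2⟩, rfl⟩
  · refine PDLE.map _ _ ((V3 K o κ 2).map
      ((hbTwo (wW K o κ) (tW K o κ)).restrictScalars (AA K o κ))) ?_ ?_
      (PDLE.submodule_prod _ _ ((h3 1).mono (by omega)) ((h3 1).mono (by omega)))
    · intro z
      constructor
      · rintro ⟨u, hu, rfl⟩
        have := hbTwo_mem (j := 1) hu
        exact ⟨⟨this.1, this.2⟩, hbOne_hbTwo _ _ u⟩
      · rintro ⟨⟨h1, h2⟩, hz⟩
        obtain ⟨u, hu, rfl⟩ := (hbOne_eq_zero_iff' h1 h2).1 hz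
        exact ⟨u, hu, rfl⟩
    · exact PDLE.map_of_injective ((hbTwo (wW K o κ) (tW K o κ)).restrictScalars (AA K o κ))
        (goodRow_segW K o κ).hbTwo_injective _ (h3 2)

end modY

end

section detThree

variable {R : Type u} [CommRing R]

def det3 (u v w : Fin 3 → R) : R :=
  u 0 * (v 1 * w 2 - v 2 * w 1) - u 1 * (v 0 * w 2 - v 2 * w 0) + u 2 * (v 0 * w 1 - v 1 * w 0)

theorem det3_rowT (P : Fin 3 → Fin 3 → R) (u v w : Fin 3 → R) :
    det3 (rowT P u) (rowT P v) (rowT P w) = det3 u v w * det3 (P 0) (P 1) (P 2) := by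
  simp only [det3, rowT]; ring

theorem map_det3 {T : Type v} [CommRing T] (f : R →+* T) (u v w : Fin 3 → R) :
    f (det3 u v w) = det3 (fun i => f (u i)) (fun i => f (v i)) (fun i => f (w i)) := by
  simp only [det3, map_add, map_sub, map_mul]

open Polynomial

/-- The rows of `a - X`. -/
noncomputable def chRow (a : Fin 3 → Fin 3 → R) (i j : Fin 3) : R[X] :=
  C (a i j) - if i = j then X else 0

theorem det3_chRow (a : Fin 3 → Fin 3 → R) :
    det3 (chRow a 0) (chRow a 1) (chRow a 2) = - chPoly a := by
  simp [det3, chRow, chPoly, chE1, chE2, chE3]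
  ring

variable (a : Fin 3 → Fin 3 → R) (w : Fin 3 → R) (μ : R)

noncomputable def chQuot : R[X] :=
  X ^ 2 - C (chE1 a - μ) * X + C (μ ^ 2 - chE1 a * μ + chE2 a)

theorem chQuot_monic : (chQuot a μ).Monic := by
  unfold chQuot; monicity!

theorem chQuot_natDegree [Nontrivial R] : (chQuot a μ).natDegree = 2 := by
  unfold chQuot; compute_degree!

variable {a w μ}

theorem chPoly_eq_mul (hχ : (chPoly a).eval μ = 0) : chPoly a = (X - C μ) * chQuot a μ := by
  simp [chPoly] at hχ
  have := congrArg C hχ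
  simp only [map_add, map_sub, map_mul, map_pow, map_zero] at this
  simp only [chPoly, chQuot, map_add, map_sub, map_mul, map_pow]
  linear_combination this

theorem chQuot_dvd_det3 {κ : Type} (hρ : ∀ j, w j * μ = rowT a w j)
    (hχ : (chPoly a).eval μ = 0) (c : κ → R) (r : Fin 3 ⊕ κ → Fin 3 → R[X])
    (hl : ∀ i, r (Sum.inl i) = chRow a i) (hr : ∀ k j, r (Sum.inr k) j = C (c k * w j))
    (i j k : Fin 3 ⊕ κ) : chQuot a μ ∣ det3 (r i) (r j) (r k) := by
  have hl' : ∀ i, ∃ v, r (Sum.inl i) = rowT (chRow a) v := by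
    intro i
    refine ⟨Pi.single i 1, ?_⟩
    rw [hl]
    ext1 j
    fin_cases i <;> simp [rowT]
  have hr' : ∀ k, ∃ v, (X - C μ) • r (Sum.inr k) = rowT (chRow a) v := by
    intro k
    refine ⟨fun j => - C (c k * w j), ?_⟩
    ext1 j
    have := congrArg C (hρ j)
    simp only [rowT, map_add, map_mul] at this
    simp only [Pi.smul_apply, smul_eq_mul, hr, rowT, chRow, map_mul]
    fin_cases j <;> simp at this ⊢ <;> linear_combination - C (c k) * this
  have hrr : ∀ k, r (Sum.inr k) = C (c k) • fun j => C (w j) := by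
    intro k
    ext1 j
    simp [hr]
  have key : ∀ u v x, det3 (rowT (chRow a) u) (rowT (chRow a) v) (rowT (chRow a) x) =
      (X - C μ) * (chQuot a μ * - det3 u v x) := by
    intro u v x
    rw [det3_rowT, det3_chRow, chPoly_eq_mul hχ]
    ring
  have one : ∀ f : R[X], ∀ g, (X - C μ) * f = (X - C μ) * (chQuot a μ * g) → chQuot a μ ∣ f :=
    fun f g h => ⟨g, (monic_X_sub_C μ).isRegular.left h⟩
  have two : ∀ k l (f : Fin 3 → R[X]), det3 (r (Sum.inr k)) (r (Sum.inr l)) f = 0 ∧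
      det3 (r (Sum.inr k)) f (r (Sum.inr l)) = 0 ∧ det3 f (r (Sum.inr k)) (r (Sum.inr l)) = 0 := by
    intro k l f
    rw [hrr k, hrr l]
    simp only [det3, Pi.smul_apply, smul_eq_mul]
    refine ⟨?_, ?_, ?_⟩ <;> ring
  rcases i with i | i <;> rcases j with j | j <;> rcases k with k | k
  · obtain ⟨u, hu⟩ := hl' i
    obtain ⟨v, hv⟩ := hl' j
    obtain ⟨x, hx⟩ := hl' k
    rw [hu, hv, hx, key]
    exact ⟨(X - C μ) * - det3 u v x, by ring⟩
  · obtain ⟨u, hu⟩ := hl' i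
    obtain ⟨v, hv⟩ := hl' j
    obtain ⟨x, hx⟩ := hr' k
    apply one _ (- det3 u v x)
    rw [← key, ← hu, ← hv, ← hx]
    simp only [det3, Pi.smul_apply, smul_eq_mul]; ring
  · obtain ⟨u, hu⟩ := hl' i
    obtain ⟨v, hv⟩ := hr' j
    obtain ⟨x, hx⟩ := hl' k
    apply one _ (- det3 u v x)
    rw [← key, ← hu, ← hv, ← hx]
    simp only [det3, Pi.smul_apply, smul_eq_mul]; ring
  · rw [(two j k _).2.2]; exact dvd_zero _
  · obtain ⟨u, hu⟩ := hr' i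
    obtain ⟨v, hv⟩ := hl' j
    obtain ⟨x, hx⟩ := hl' k
    apply one _ (- det3 u v x)
    rw [← key, ← hu, ← hv, ← hx]
    simp only [det3, Pi.smul_apply, smul_eq_mul]; ring
  · rw [(two i k _).2.1]; exact dvd_zero _
  · rw [(two i j _).1]; exact dvd_zero _
  · rw [(two i j _).1]; exact dvd_zero _

theorem coeff_one_modByMonic_chQuot (p q r : R) :
    ((C p + C q * X + C r * X ^ 2) %ₘ chQuot a μ).coeff 1 = q + r * (chE1 a - μ) := by
  nontriviality R
  have h : (C p + C q * X + C r * X ^ 2) %ₘ chQuot a μ =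
      C (p - r * (μ ^ 2 - chE1 a * μ + chE2 a)) + C (q + r * (chE1 a - μ)) * X := by
    refine (div_modByMonic_unique (C r) _ (chQuot_monic a μ) ⟨?_, ?_⟩).2
    · simp only [chQuot, map_add, map_sub, map_mul, map_pow]
      ring
    · rw [degree_eq_natDegree (chQuot_monic a μ).ne_zero, chQuot_natDegree]
      refine lt_of_le_of_lt (b := 1) ?_ (by norm_num)
      compute_degree
  rw [h]
  simp [-map_mul, coeff_C]

end detThree

section delta

open Polynomial

variable (K : Type u) [Field K] (o κ : Type)

noncomputable def alA (i j : Fin 3) : AA K o κ := MvPolynomial.X (Sum.inl (Sum.inl (i, j)))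
noncomputable def gaA (k : κ) (j : Fin 3) : AA K o κ := MvPolynomial.X (Sum.inr (k, j))

/-- The rows of the matrix obtained by stacking `α - X` on `γ`. -/
noncomputable def rowS : Fin 3 ⊕ κ → Fin 3 → (AA K o κ)[X] :=
  Sum.elim (chRow (alA K o κ)) fun k j => C (gaA K o κ k j)

noncomputable def detIdealS : Ideal (AA K o κ)[X] :=
  Ideal.span {f | ∃ i j k, f = det3 (rowS K o κ i) (rowS K o κ j) (rowS K o κ k)}

/-- The coefficient map of `YY`. -/
noncomputable def psiY : AA K o κ →+* YY K o κ :=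
  ((Ideal.Quotient.mk (relIdeal (alW K o κ) (wW K o κ))).comp Polynomial.C).comp
    (seg K ((Fin 3 × Fin 3) ⊕ o) (Fin 3) κ : AA K o κ →+* WW K o κ)

noncomputable def mkW : WW K o κ →+* YY K o κ :=
  (Ideal.Quotient.mk (relIdeal (alW K o κ) (wW K o κ))).comp Polynomial.C

noncomputable def muY : YY K o κ := Ideal.Quotient.mk _ X

theorem smul_YY (x : AA K o κ) (y : YY K o κ) : x • y = psiY K o κ x * y := by
  obtain ⟨f, rfl⟩ := Ideal.Quotient.mk_surjective y
  change Ideal.Quotient.mk _ (x • f) = Ideal.Quotient.mk _ (C (seg _ _ _ _ x)) * _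
  rw [← map_mul]
  congr 1
  rw [← smul_eq_C_mul]
  rfl

theorem psiY_alA (i j) : psiY K o κ (alA K o κ i j) = mkW K o κ (alW K o κ i j) := by
  simp only [psiY, mkW, RingHom.comp_apply, alA, alW]
  congr 2
  exact seg_X_inl _

theorem psiY_gaA (k j) : psiY K o κ (gaA K o κ k j) =
    mkW K o κ (MvPolynomial.X (Sum.inr (Sum.inr k))) * mkW K o κ (wW K o κ j) := by
  rw [← map_mul]
  simp only [psiY, mkW, RingHom.comp_apply, gaA, wW]
  congr 2
  exact seg_X_inr _ _

noncomputable def alY (i j : Fin 3) : YY K o κ := mkW K o κ (alW K o κ i j)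
noncomputable def wY (j : Fin 3) : YY K o κ := mkW K o κ (wW K o κ j)

theorem wY_mul_muY (j) : wY K o κ j * muY K o κ = rowT (alY K o κ) (wY K o κ) j := by
  have h : relElt (alW K o κ) (wW K o κ) j ∈ relIdeal (alW K o κ) (wW K o κ) :=
    Ideal.subset_span (Set.mem_insert_of_mem _ ⟨j, rfl⟩)
  rw [← Ideal.Quotient.eq_zero_iff_mem, relElt, map_sub, sub_eq_zero, map_mul] at h
  refine h.trans ?_
  change mkW K o κ (rowT _ _ _) = _
  simp only [rowT, map_add, map_mul, alY, wY]

theorem eval_chPoly_alY : (chPoly (alY K o κ)).eval (muY K o κ) = 0 := by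
  have h : chPoly (alW K o κ) ∈ relIdeal (alW K o κ) (wW K o κ) :=
    Ideal.subset_span (Set.mem_insert _ _)
  rw [← Ideal.Quotient.eq_zero_iff_mem] at h
  rw [← h, chPoly, chPoly]
  simp only [eval_add, eval_sub, eval_mul, eval_pow, eval_X, eval_C, map_add, map_sub, map_mul,
    map_pow]
  change _ = muY K o κ ^ 3 - mkW K o κ (chE1 _) * muY K o κ ^ 2 +
    mkW K o κ (chE2 _) * muY K o κ - mkW K o κ (chE3 _)
  simp only [chE1, chE2, chE3, alY, map_add, map_sub, map_mul]

/-- The divided-difference map from the determinantal quotient to `YY`. -/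
noncomputable def deltaS : (AA K o κ)[X] →ₗ[AA K o κ] YY K o κ where
  toFun f := ((f.map (psiY K o κ)) %ₘ chQuot (alY K o κ) (muY K o κ)).coeff 1
  map_add' f g := by rw [Polynomial.map_add, add_modByMonic, coeff_add]
  map_smul' r f := by
    rw [smul_eq_C_mul, Polynomial.map_mul, map_C, ← smul_eq_C_mul, smul_modByMonic, coeff_smul,
      RingHom.id_apply, smul_YY, smul_eq_mul]

theorem map_rowS_det3_dvd (i j k) : chQuot (alY K o κ) (muY K o κ) ∣
    (det3 (rowS K o κ i) (rowS K o κ j) (rowS K o κ k)).map (psiY K o κ) := by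
  rw [← coe_mapRingHom, map_det3]
  refine chQuot_dvd_det3 (wY_mul_muY K o κ) (eval_chPoly_alY K o κ)
    (fun k => mkW K o κ (MvPolynomial.X (Sum.inr (Sum.inr k))))
    (fun i j => mapRingHom (psiY K o κ) (rowS K o κ i j)) ?_ ?_ i j k
  · intro i
    ext1 j
    simp only [rowS, Sum.elim_inl, chRow, map_sub, coe_mapRingHom, map_C, psiY_alA]
    by_cases h : i = j <;> simp [h, alY]
  · intro k j
    simp only [rowS, Sum.elim_inr, coe_mapRingHom, map_C, psiY_gaA, wY]

variable {K o κ}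

theorem deltaS_eq_zero_of_mem {f : (AA K o κ)[X]} (hf : f ∈ detIdealS K o κ) :
    deltaS K o κ f = 0 := by
  have : detIdealS K o κ ≤
      (Ideal.span {chQuot (alY K o κ) (muY K o κ)}).comap (mapRingHom (psiY K o κ)) := by
    refine Ideal.span_le.2 ?_
    rintro f ⟨i, j, k, rfl⟩
    exact Ideal.mem_span_singleton.2 (map_rowS_det3_dvd K o κ i j k)
  have h := Ideal.mem_span_singleton.1 (this hf)
  change ((f.map (psiY K o κ)) %ₘ _).coeff 1 = 0
  rw [coe_mapRingHom, ← modByMonic_eq_zero_iff_dvd (chQuot_monic _ _)] at h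
  rw [h, coeff_zero]

theorem deltaS_quadratic (a b c : AA K o κ) : deltaS K o κ (C a + C b * X + C c * X ^ 2) =
    psiY K o κ b + psiY K o κ c * (chE1 (alY K o κ) - muY K o κ) := by
  change ((Polynomial.map _ _) %ₘ _).coeff 1 = _
  simp only [Polynomial.map_add, Polynomial.map_mul, Polynomial.map_pow, map_C, map_X]
  exact coeff_one_modByMonic_chQuot _ _ _

theorem psiY_chE1 : psiY K o κ (chE1 (alA K o κ)) = chE1 (alY K o κ) := by
  simp only [chE1, map_add, psiY_alA, alY]

theorem det3_rowS_mem (i j k) :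
    det3 (rowS K o κ i) (rowS K o κ j) (rowS K o κ k) ∈ detIdealS K o κ :=
  Ideal.subset_span ⟨i, j, k, rfl⟩

theorem exists_quadratic (f : (AA K o κ)[X]) : ∃ a b c,
    f - (C a + C b * X + C c * X ^ 2) ∈ detIdealS K o κ := by
  have hm := chPoly_monic (alA K o κ)
  have hd : (f %ₘ chPoly (alA K o κ)).natDegree < 3 := by
    have h3 := chPoly_natDegree (alA K o κ)
    refine (natDegree_modByMonic_lt f hm fun h => ?_).trans_eq h3
    rw [h, natDegree_one] at h3
    omega
  refine ⟨(f %ₘ chPoly (alA K o κ)).coeff 0, (f %ₘ chPoly (alA K o κ)).coeff 1,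
    (f %ₘ chPoly (alA K o κ)).coeff 2, ?_⟩
  have hs : C ((f %ₘ chPoly (alA K o κ)).coeff 0) + C ((f %ₘ chPoly (alA K o κ)).coeff 1) * X +
    C ((f %ₘ chPoly (alA K o κ)).coeff 2) * X ^ 2 = f %ₘ chPoly (alA K o κ) := by
    conv_rhs => rw [as_sum_range' (f %ₘ chPoly (alA K o κ)) 3 hd]
    simp [Finset.sum_range_succ, ← C_mul_X_pow_eq_monomial]
  rw [hs]
  have : f - f %ₘ chPoly (alA K o κ) = - ((f /ₘ chPoly (alA K o κ)) *
      det3 (rowS K o κ (Sum.inl 0)) (rowS K o κ (Sum.inl 1)) (rowS K o κ (Sum.inl 2))) := by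
    simp only [rowS, Sum.elim_inl]
    rw [det3_chRow]
    have := modByMonic_add_div f (chPoly (alA K o κ))
    linear_combination - this
  rw [this]
  exact neg_mem (Ideal.mul_mem_left _ _ (det3_rowS_mem _ _ _))

variable (K o κ) in
/-- Elements congruent to constants modulo `detIdealS`. -/
noncomputable def constMod : Submodule (AA K o κ) (AA K o κ)[X] :=
  (detIdealS K o κ).restrictScalars (AA K o κ) ⊔ LinearMap.range (Algebra.linearMap (AA K o κ) _)

theorem mem_constMod {f : (AA K o κ)[X]} :
    f ∈ constMod K o κ ↔ ∃ a, f - C a ∈ detIdealS K o κ := by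
  rw [constMod, Submodule.mem_sup]
  constructor
  · rintro ⟨y, hy, _, ⟨a, rfl⟩, rfl⟩
    refine ⟨a, ?_⟩
    convert! hy using 1
    exact add_sub_cancel_right _ _
  · rintro ⟨a, ha⟩
    exact ⟨f - C a, ha, C a, ⟨a, rfl⟩, sub_add_cancel _ _⟩

theorem mem_constMod_of_mem {f : (AA K o κ)[X]} (h : f ∈ detIdealS K o κ) :
    f ∈ constMod K o κ := Submodule.mem_sup_left h

theorem C_mem_constMod (a : AA K o κ) : C a ∈ constMod K o κ :=
  Submodule.mem_sup_right ⟨a, rfl⟩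

theorem C_mul_mem_constMod (a : AA K o κ) {f : (AA K o κ)[X]} (h : f ∈ constMod K o κ) :
    C a * f ∈ constMod K o κ := by
  rw [← smul_eq_C_mul]
  exact Submodule.smul_mem _ _ h

end delta

section adjugate

open Polynomial

variable {R : Type u} [CommRing R] (a : Fin 3 → Fin 3 → R) (g h : Fin 3 → R)

theorem det3_adj_zero : det3 (fun j => C (g j)) (chRow a 1) (chRow a 2) =
    C (rowT a g 0 - chE1 a * g 0) * X + C (g 0) * X ^ 2 + C (det3 g (a 1) (a 2)) := by
  simp [det3, chRow, rowT, chE1]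
  ring

theorem det3_adj_one : det3 (chRow a 0) (fun j => C (g j)) (chRow a 2) =
    C (rowT a g 1 - chE1 a * g 1) * X + C (g 1) * X ^ 2 + C (det3 (a 0) g (a 2)) := by
  simp [det3, chRow, rowT, chE1]
  ring

theorem det3_adj_two : det3 (chRow a 0) (chRow a 1) (fun j => C (g j)) =
    C (rowT a g 2 - chE1 a * g 2) * X + C (g 2) * X ^ 2 + C (det3 (a 0) (a 1) g) := by
  simp [det3, chRow, rowT, chE1]
  ring

theorem det3_two_const (r : Fin 3) : det3 (fun j => C (g j)) (fun j => C (h j)) (chRow a r) =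
    C (det3 g h (a r)) - C (cross3 g h r) * X := by
  fin_cases r <;> simp [det3, chRow, cross3] <;> ring

theorem det3_eq_sum_cross3 (v : Fin 3 → R) : det3 g h v = ∑ s, v s * cross3 g h s := by
  simp [Fin.sum_univ_three, det3, cross3]; ring

end adjugate

section delta2

open Polynomial

variable {K : Type u} [Field K] {o κ : Type}

/-- The rows of `γ α`. -/
noncomputable def gaT (K : Type u) [Field K] (o κ : Type) (k : κ) : Fin 3 → AA K o κ :=
  rowT (alA K o κ) (gaA K o κ k)

theorem adj_mem_constMod (k : κ) (j : Fin 3) :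
    C (gaT K o κ k j - chE1 (alA K o κ) * gaA K o κ k j) * X + C (gaA K o κ k j) * X ^ 2 ∈
      constMod K o κ := by
  rw [mem_constMod]
  fin_cases j
  · refine ⟨- det3 (gaA K o κ k) (alA K o κ 1) (alA K o κ 2), ?_⟩
    have h := det3_rowS_mem (K := K) (o := o) (κ := κ) (Sum.inr k) (Sum.inl 1) (Sum.inl 2)
    change det3 (fun j => C (gaA K o κ k j)) (chRow (alA K o κ) 1) (chRow (alA K o κ) 2) ∈ _ at h
    rw [det3_adj_zero] at h
    rw [C_neg, sub_neg_eq_add]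
    exact h
  · refine ⟨- det3 (alA K o κ 0) (gaA K o κ k) (alA K o κ 2), ?_⟩
    have h := det3_rowS_mem (K := K) (o := o) (κ := κ) (Sum.inl 0) (Sum.inr k) (Sum.inl 2)
    change det3 (chRow (alA K o κ) 0) (fun j => C (gaA K o κ k j)) (chRow (alA K o κ) 2) ∈ _ at h
    rw [det3_adj_one] at h
    rw [C_neg, sub_neg_eq_add]
    exact h
  · refine ⟨- det3 (alA K o κ 0) (alA K o κ 1) (gaA K o κ k), ?_⟩
    have h := det3_rowS_mem (K := K) (o := o) (κ := κ) (Sum.inl 0) (Sum.inl 1) (Sum.inr k)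
    change det3 (chRow (alA K o κ) 0) (chRow (alA K o κ) 1) (fun j => C (gaA K o κ k j)) ∈ _ at h
    rw [det3_adj_two] at h
    rw [C_neg, sub_neg_eq_add]
    exact h

/-- The `2 × 2` minor of the rows `k, l` of `γ`, leaving out one column. -/
noncomputable def gaMinor (K : Type u) [Field K] (o κ : Type) (k l : κ) (r : Fin 3) : AA K o κ :=
  cross3 (gaA K o κ k) (gaA K o κ l) r

theorem gaMinor_mul_X_mem (k l : κ) (r : Fin 3) :
    C (gaMinor K o κ k l r) * X ∈ constMod K o κ := by
  rw [mem_constMod]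
  refine ⟨det3 (gaA K o κ k) (gaA K o κ l) (alA K o κ r), ?_⟩
  have h := det3_rowS_mem (K := K) (o := o) (κ := κ) (Sum.inr k) (Sum.inr l) (Sum.inl r)
  change det3 (fun j => C (gaA K o κ k j)) (fun j => C (gaA K o κ l j)) (chRow (alA K o κ) r) ∈ _ at h
  rw [det3_two_const] at h
  rw [← neg_sub]
  exact (detIdealS K o κ).neg_mem h

theorem gaMinor_mul_X_sq_mem (k l : κ) (r : Fin 3) :
    C (gaMinor K o κ k l r) * X ^ 2 ∈ constMod K o κ := by
  have h := det3_rowS_mem (K := K) (o := o) (κ := κ) (Sum.inr k) (Sum.inr l) (Sum.inl r)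
  change det3 (fun j => C (gaA K o κ k j)) (fun j => C (gaA K o κ l j)) (chRow (alA K o κ) r) ∈ _ at h
  rw [det3_two_const,
    det3_eq_sum_cross3] at h
  have h' : C (gaMinor K o κ k l r) * X ^ 2 =
      (∑ s, C (alA K o κ r s) * (C (gaMinor K o κ k l s) * X)) -
      X * (C (∑ s, alA K o κ r s * cross3 (gaA K o κ k) (gaA K o κ l) s) -
        C (cross3 (gaA K o κ k) (gaA K o κ l) r) * X) := by
    simp only [Fin.sum_univ_three, map_add, map_mul, gaMinor]
    ring
  rw [h']
  exact sub_mem (sum_mem fun s _ => C_mul_mem_constMod _ (gaMinor_mul_X_mem k l s))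
    (mem_constMod_of_mem (Ideal.mul_mem_left _ X h))

theorem segIdeal_mul_mem (f : (AA K o κ)[X])
    (h : ∀ k l r, C (gaMinor K o κ k l r) * f ∈ constMod K o κ) {s : AA K o κ}
    (hs : s ∈ segIdeal K ((Fin 3 × Fin 3) ⊕ o) (Fin 3) κ) : C s * f ∈ constMod K o κ := by
  rw [segIdeal] at hs
  refine Submodule.span_induction ?_ ?_ ?_ ?_ hs
  · rintro s ⟨k, l, i, j, rfl⟩
    change C (gaA K o κ k i * gaA K o κ l j - gaA K o κ k j * gaA K o κ l i) * f ∈ _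
    have h0 := h k l 0
    have h1 := h k l 1
    have h2 := h k l 2
    have hn : ∀ r, C (- gaMinor K o κ k l r) * f ∈ constMod K o κ := fun r => by
      have := C_mul_mem_constMod (-1) (h k l r)
      rwa [← mul_assoc, ← C_mul, neg_one_mul] at this
    have hs : ∀ s s', s' = s → C s * f ∈ constMod K o κ → C s' * f ∈ constMod K o κ := by
      rintro s _ rfl hs
      exact hs
    have z : C (0 : AA K o κ) * f ∈ constMod K o κ := by simp
    have e0 : gaMinor K o κ k l 0 = gaA K o κ k 1 * gaA K o κ l 2 - gaA K o κ k 2 * gaA K o κ l 1 :=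
      rfl
    have e1 : gaMinor K o κ k l 1 = gaA K o κ k 2 * gaA K o κ l 0 - gaA K o κ k 0 * gaA K o κ l 2 :=
      rfl
    have e2 : gaMinor K o κ k l 2 = gaA K o κ k 0 * gaA K o κ l 1 - gaA K o κ k 1 * gaA K o κ l 0 :=
      rfl
    fin_cases i <;> fin_cases j
    · exact hs _ _ (sub_self _) z
    · exact hs _ _ e2.symm h2
    · exact hs _ _ (by rw [e1, neg_sub]; rfl) (hn 1)
    · exact hs _ _ (by rw [e2, neg_sub]; rfl) (hn 2)
    · exact hs _ _ (sub_self _) z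
    · exact hs _ _ e0.symm h0
    · exact hs _ _ e1.symm h1
    · exact hs _ _ (by rw [e0, neg_sub]; rfl) (hn 0)
    · exact hs _ _ (sub_self _) z
  · simp
  · intro x y _ _ hx hy
    rw [C_add, add_mul]
    exact add_mem hx hy
  · intro a x _ hx
    rw [smul_eq_mul, C_mul, mul_assoc]
    exact C_mul_mem_constMod a hx

variable [Fintype κ]

theorem quadratic_mem_constMod {a b c : AA K o κ} {G : κ → Fin 3 → AA K o κ}
    (hb : b + c * chE1 (alA K o κ) + ∑ k, ∑ j, G k j * gaT K o κ k j ∈ segIdeal K _ _ κ)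
    (hc : -c - ∑ k, ∑ j, G k j * gaA K o κ k j ∈ segIdeal K _ _ κ) :
    C a + C b * X + C c * X ^ 2 ∈ constMod K o κ := by
  have e : C a + C b * X + C c * X ^ 2 = C a +
      C (b + c * chE1 (alA K o κ) + ∑ k, ∑ j, G k j * gaT K o κ k j) * X +
      C (-c - ∑ k, ∑ j, G k j * gaA K o κ k j) * (C (chE1 (alA K o κ)) * X - X ^ 2) -
      ∑ k, ∑ j, C (G k j) * (C (gaT K o κ k j - chE1 (alA K o κ) * gaA K o κ k j) * X +
        C (gaA K o κ k j) * X ^ 2) := by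
    have e1 : ∑ k, ∑ j, C (G k j) * (C (gaT K o κ k j - chE1 (alA K o κ) * gaA K o κ k j) * X +
        C (gaA K o κ k j) * X ^ 2) = C (∑ k, ∑ j, G k j * gaT K o κ k j) * X
        - C (chE1 (alA K o κ)) * C (∑ k, ∑ j, G k j * gaA K o κ k j) * X +
        C (∑ k, ∑ j, G k j * gaA K o κ k j) * X ^ 2 := by
      simp only [map_sum, Finset.sum_mul, Finset.mul_sum, ← Finset.sum_sub_distrib,
        ← Finset.sum_add_distrib]
      refine Finset.sum_congr rfl fun k _ => Finset.sum_congr rfl fun j _ => ?_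
      simp only [map_sub, map_mul]
      ring
    rw [e1]
    generalize ∑ k, ∑ j, G k j * gaT K o κ k j = s
    generalize ∑ k, ∑ j, G k j * gaA K o κ k j = t
    simp only [map_add, map_sub, map_mul, map_neg]
    ring
  rw [e]
  refine sub_mem (add_mem (add_mem (C_mem_constMod a) ?_) ?_) ?_
  · exact segIdeal_mul_mem _ gaMinor_mul_X_mem hb
  · refine segIdeal_mul_mem _ (fun k l r => ?_) hc
    rw [mul_sub, mul_left_comm]
    exact sub_mem (C_mul_mem_constMod _ (gaMinor_mul_X_mem k l r)) (gaMinor_mul_X_sq_mem k l r)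
  · exact sum_mem fun k _ => sum_mem fun j _ => C_mul_mem_constMod _ (adj_mem_constMod k j)

end delta2

section kerDelta

variable {K : Type u} [Field K] {o κ : Type}

theorem seg_mem (a : AA K o κ) : seg K ((Fin 3 × Fin 3) ⊕ o) (Fin 3) κ a ∈ VV K o κ 0 :=
  seg_isWeightedHomogeneous a

theorem thetaY_seg (a b c : AA K o κ) :
    thetaY K o κ ![seg _ _ _ _ a, seg _ _ _ _ b, seg _ _ _ _ c] =
      psiY K o κ a + psiY K o κ b * muY K o κ + psiY K o κ c * muY K o κ ^ 2 := by
  change Ideal.Quotient.mk _ (_ + _ * _ + _ * _) = _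
  simp only [map_add, map_mul, map_pow]
  rfl

theorem seg_mem_V3 (a b c : AA K o κ) :
    ![seg _ _ _ _ a, seg _ _ _ _ b, seg _ _ _ _ c] ∈ V3 K o κ 0 := by
  rw [mem_V3]
  intro i
  fin_cases i
  · exact seg_mem a
  · exact seg_mem b
  · exact seg_mem c

theorem seg_gaA (k : κ) (j) : seg K ((Fin 3 × Fin 3) ⊕ o) (Fin 3) κ (gaA K o κ k j) =
    MvPolynomial.X (Sum.inr (Sum.inr k)) * wW K o κ j := seg_X_inr _ _

theorem seg_alA (i j) : seg K ((Fin 3 × Fin 3) ⊕ o) (Fin 3) κ (alA K o κ i j) = alW K o κ i j :=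
  seg_X_inl _

theorem seg_gaT (k : κ) (j) : seg K ((Fin 3 × Fin 3) ⊕ o) (Fin 3) κ (gaT K o κ k j) =
    MvPolynomial.X (Sum.inr (Sum.inr k)) * tW K o κ j := by
  simp only [gaT, rowT, map_add, map_mul, seg_gaA, seg_alA]
  ring

variable [Fintype κ]

/-- An element `b + c μ` with `b`, `c` of weight zero vanishes only for the evident reason. -/
theorem exists_of_linear_eq_zero {b c : AA K o κ}
    (h : psiY K o κ b + psiY K o κ c * muY K o κ = 0) :
    ∃ G : κ → Fin 3 → AA K o κ,
      b + ∑ k, ∑ j, G k j * gaT K o κ k j ∈ segIdeal K ((Fin 3 × Fin 3) ⊕ o) (Fin 3) κ ∧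
      c - ∑ k, ∑ j, G k j * gaA K o κ k j ∈ segIdeal K ((Fin 3 × Fin 3) ⊕ o) (Fin 3) κ := by
  have h0 : thetaY K o κ ![seg _ _ _ _ b, seg _ _ _ _ c, seg _ _ _ _ 0] = 0 := by
    rw [thetaY_seg, h, map_zero, zero_mul, add_zero]
  obtain ⟨z, h1, h2, hz⟩ := (thetaY_eq_zero_iff' (seg_mem_V3 _ _ _)).1 h0
  have hy : z.2 0 * wW K o κ 0 + z.2 1 * wW K o κ 1 + z.2 2 * wW K o κ 2 = 0 :=
    (congrFun hz 2).trans (map_zero _)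
  obtain ⟨u, hu⟩ := (goodRow_segW K o κ).exists_cross hy
  have hu' : z.2 = (hbTwo (wW K o κ) (tW K o κ) (fun i => segComp K _ _ _ (1 + 1) (u i))).2 := by
    rw [segComp_hbTwo]
    ext1 i
    rw [show (hbTwo (wW K o κ) (tW K o κ) u).2 = z.2 from hu.symm]
    exact (segComp_same (mem_V3.1 h2 i)).symm
  have hm := (hbTwo_mem (K := K) (o := o) (κ := κ) (j := 1)
    (u := fun i => segComp K _ _ _ (1 + 1) (u i)) (mem_V3.2 fun i => segComp_mem _ _)).1
  have hz' := hbOne_hbTwo (wW K o κ) (tW K o κ) (fun i => segComp K _ _ _ (1 + 1) (u i))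
  have hx := mem_V3.1 (sub_mem h1 hm)
  have hz2 : hbOne (wW K o κ) (tW K o κ)
      (z - hbTwo (wW K o κ) (tW K o κ) (fun i => segComp K _ _ _ (1 + 1) (u i))) =
      ![seg _ _ _ _ b, seg _ _ _ _ c, seg _ _ _ _ 0] := by
    rw [map_sub, hz', sub_zero, hz]
  have hy0 : (z - hbTwo (wW K o κ) (tW K o κ) (fun i => segComp K _ _ _ (1 + 1) (u i))).2 = 0 := by
    rw [Prod.snd_sub, ← hu', sub_self]
  change ∀ i, (z - hbTwo (wW K o κ) (tW K o κ)
    (fun i => segComp K _ _ _ (1 + 1) (u i))).1 i ∈ VV K o κ 1 at hx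
  generalize z - hbTwo (wW K o κ) (tW K o κ) (fun i => segComp K _ _ _ (1 + 1) (u i)) = z'
    at hx hz2 hy0
  obtain ⟨x, y⟩ := z'
  change y = 0 at hy0
  subst hy0
  change ∀ i, x i ∈ _ at hx
  have e0 : seg _ _ _ _ b = -(x 0 * tW K o κ 0 + x 1 * tW K o κ 1 + x 2 * tW K o κ 2) :=
    (congrFun hz2 0).symm
  have e1 : seg _ _ _ _ c = x 0 * wW K o κ 0 + x 1 * wW K o κ 1 + x 2 * wW K o κ 2 := by
    refine (congrFun hz2 1).symm.trans ?_
    change x 0 * wW K o κ 0 + x 1 * wW K o κ 1 + x 2 * wW K o κ 2 - (0 * _ + 0 * _ + 0 * _) = _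
    ring
  have hg : ∀ j, ∃ g : κ → AA K o κ, x j = ∑ k, MvPolynomial.X (Sum.inr (Sum.inr k)) *
      seg K ((Fin 3 × Fin 3) ⊕ o) (Fin 3) κ (g k) := by
    intro j
    obtain ⟨g, hg, e⟩ := exists_sum_of_mem_segV (K := K) 0 (x := x j) (by simpa using hx j)
    choose G hG using fun k => exists_seg_eq_of_mem_segV (hg k)
    exact ⟨G, by simp only [hG, e]⟩
  choose G hG using hg
  refine ⟨fun k j => G j k, ?_, ?_⟩
  · rw [← seg_eq_zero_iff, map_add, e0, map_sum]
    simp only [map_add, map_mul, seg_gaT, Fin.sum_univ_three, hG, Finset.sum_mul,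
      Finset.sum_add_distrib]
    have : ∀ j, ∑ k, MvPolynomial.X (Sum.inr (Sum.inr k)) *
        seg K ((Fin 3 × Fin 3) ⊕ o) (Fin 3) κ (G j k) * tW K o κ j =
        ∑ k, seg K ((Fin 3 × Fin 3) ⊕ o) (Fin 3) κ (G j k) *
        (MvPolynomial.X (Sum.inr (Sum.inr k)) * tW K o κ j) := fun j =>
      Finset.sum_congr rfl fun k _ => by ring
    rw [this, this, this]
    exact neg_add_cancel _
  · rw [← seg_eq_zero_iff, map_sub, e1, map_sum]
    simp only [map_add, map_mul, seg_gaA, Fin.sum_univ_three, hG, Finset.sum_mul,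
      Finset.sum_add_distrib]
    have : ∀ j, ∑ k, MvPolynomial.X (Sum.inr (Sum.inr k)) *
        seg K ((Fin 3 × Fin 3) ⊕ o) (Fin 3) κ (G j k) * wW K o κ j =
        ∑ k, seg K ((Fin 3 × Fin 3) ⊕ o) (Fin 3) κ (G j k) *
        (MvPolynomial.X (Sum.inr (Sum.inr k)) * wW K o κ j) := fun j =>
      Finset.sum_congr rfl fun k _ => by ring
    rw [this, this, this]
    exact sub_self _

open Polynomial in
theorem deltaS_eq_zero_iff (f : (AA K o κ)[X]) : deltaS K o κ f = 0 ↔ f ∈ constMod K o κ := by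
  constructor
  · intro h
    obtain ⟨a, b, c, hf⟩ := exists_quadratic f
    have h' : deltaS K o κ (C a + C b * X + C c * X ^ 2) = 0 := by
      have := deltaS_eq_zero_of_mem hf
      rw [map_sub, h, zero_sub, neg_eq_zero] at this
      exact this
    rw [deltaS_quadratic, ← psiY_chE1] at h'
    have h2 : psiY K o κ (b + c * chE1 (alA K o κ)) + psiY K o κ (-c) * muY K o κ = 0 := by
      rw [← h', map_add, map_mul, map_neg]
      ring
    obtain ⟨G, hb, hc⟩ := exists_of_linear_eq_zero h2
    have := add_mem (mem_constMod_of_mem hf) (quadratic_mem_constMod (a := a) hb hc)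
    rwa [sub_add_cancel] at this
  · rw [mem_constMod]
    rintro ⟨a, ha⟩
    have h := deltaS_eq_zero_of_mem ha
    have h2 := deltaS_quadratic a 0 0
    simp only [map_zero, zero_mul, add_zero] at h2
    rwa [map_sub, h2, sub_zero] at h

end kerDelta

section quotN

variable (K : Type u) [Field K] (o κ : Type)

/-- The span of `1` and `μ`. -/
noncomputable def C0 : Submodule (AA K o κ) (YY K o κ) := LinearMap.range (deltaS K o κ)

variable {K o κ}

theorem mem_C0 {y : YY K o κ} :
    y ∈ C0 K o κ ↔ ∃ b c, y = psiY K o κ b + psiY K o κ c * muY K o κ := by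
  constructor
  · rintro ⟨f, rfl⟩
    obtain ⟨a, b, c, hf⟩ := exists_quadratic f
    have := deltaS_eq_zero_of_mem hf
    rw [map_sub, sub_eq_zero] at this
    rw [this, deltaS_quadratic, ← psiY_chE1]
    refine ⟨b + c * chE1 (alA K o κ), -c, ?_⟩
    rw [map_add, map_mul, map_neg]
    ring
  · rintro ⟨b, c, rfl⟩
    refine ⟨_, (deltaS_quadratic 0 (b + c * chE1 (alA K o κ)) (-c)).trans ?_⟩
    rw [map_add, map_mul, map_neg, psiY_chE1]
    ring

theorem sub_rename_aeval_mem (f : AA K o κ) :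
    f - MvPolynomial.rename Sum.inl (MvPolynomial.aeval
      (Sum.elim MvPolynomial.X 0 : ((Fin 3 × Fin 3) ⊕ o) ⊕ κ × Fin 3 →
        MvPolynomial ((Fin 3 × Fin 3) ⊕ o) K) f) ∈
      Ideal.span (MvPolynomial.X '' Set.range (Sum.inr : κ × Fin 3 → _) : Set (AA K o κ)) := by
  induction f using MvPolynomial.induction_on with
  | C a =>
    rw [← MvPolynomial.algebraMap_eq, AlgHom.commutes, AlgHom.commutes, sub_self]
    exact zero_mem _
  | add p q hp hq =>
    rw [map_add, map_add, add_sub_add_comm]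
    exact add_mem hp hq
  | mul_X p i hp =>
    rw [map_mul, map_mul, MvPolynomial.aeval_X]
    rcases i with i | i
    · rw [Sum.elim_inl, MvPolynomial.rename_X, ← sub_mul]
      exact Ideal.mul_mem_right _ _ hp
    · rw [Sum.elim_inr, Pi.zero_apply, map_zero, mul_zero, sub_zero]
      exact Ideal.mul_mem_left _ _ (Ideal.subset_span ⟨_, ⟨i, rfl⟩, rfl⟩)

theorem psiY_mul_sq_mem_C0 (a : AA K o κ) : psiY K o κ a * muY K o κ ^ 2 ∈ C0 K o κ ↔
    a ∈ Ideal.span (MvPolynomial.X '' Set.range (Sum.inr : κ × Fin 3 → _) : Set (AA K o κ)) := by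
  constructor
  · intro h
    obtain ⟨b, c, h⟩ := mem_C0.1 h
    have h0 : thetaY K o κ ![seg _ _ _ _ (-b), seg _ _ _ _ (-c), seg _ _ _ _ a] = 0 := by
      rw [thetaY_seg, h, map_neg, map_neg]
      ring
    obtain ⟨z, hz⟩ := (thetaY_eq_zero_iff _).1 h0
    have e : seg _ _ _ _ a = z.2 0 * wW K o κ 0 + z.2 1 * wW K o κ 1 + z.2 2 * wW K o κ 2 :=
      congrFun hz 2
    have e2 := congrArg (MvPolynomial.aeval (Sum.elim MvPolynomial.X 0 :
      ((Fin 3 × Fin 3) ⊕ o) ⊕ (Fin 3 ⊕ κ) → MvPolynomial ((Fin 3 × Fin 3) ⊕ o) K)) e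
    have hw : ∀ j, MvPolynomial.aeval (Sum.elim MvPolynomial.X 0 :
      ((Fin 3 × Fin 3) ⊕ o) ⊕ (Fin 3 ⊕ κ) → MvPolynomial ((Fin 3 × Fin 3) ⊕ o) K)
      (wW K o κ j) = 0 := fun j => by
        rw [wW, MvPolynomial.aeval_X]
        rfl
    simp only [map_add, map_mul, hw, mul_zero, add_zero] at e2
    have hc : ((MvPolynomial.aeval (Sum.elim MvPolynomial.X 0 :
        ((Fin 3 × Fin 3) ⊕ o) ⊕ (Fin 3 ⊕ κ) → MvPolynomial ((Fin 3 × Fin 3) ⊕ o) K)).comp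
        (seg K ((Fin 3 × Fin 3) ⊕ o) (Fin 3) κ)) = MvPolynomial.aeval
      (Sum.elim MvPolynomial.X 0 : ((Fin 3 × Fin 3) ⊕ o) ⊕ κ × Fin 3 →
        MvPolynomial ((Fin 3 × Fin 3) ⊕ o) K) := by
      refine MvPolynomial.algHom_ext (fun i => ?_)
      rcases i with i | ⟨k, j⟩
      · rw [AlgHom.comp_apply, seg_X_inl, MvPolynomial.aeval_X, MvPolynomial.aeval_X]
        rfl
      · rw [AlgHom.comp_apply, seg_X_inr, map_mul, MvPolynomial.aeval_X, MvPolynomial.aeval_X,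
          MvPolynomial.aeval_X]
        exact zero_mul _
    have h3 := sub_rename_aeval_mem a
    rwa [← hc, AlgHom.comp_apply, e2, map_zero, sub_zero] at h3
  · intro h
    refine Submodule.span_induction ?_ ?_ ?_ ?_ h
    · rintro _ ⟨_, ⟨⟨k, j⟩, rfl⟩, rfl⟩
      refine mem_C0.2 ⟨0, gaT K o κ k j, ?_⟩
      change psiY K o κ (gaA K o κ k j) * _ = _
      have := wY_mul_muY K o κ j
      rw [psiY_gaA]
      have e : psiY K o κ (gaT K o κ k j) = mkW K o κ (MvPolynomial.X (Sum.inr (Sum.inr k))) *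
          rowT (alY K o κ) (wY K o κ) j := by
        simp only [gaT, rowT, map_add, map_mul, psiY_gaA, psiY_alA, alY, wY]
        ring
      rw [e, ← this, map_zero, wY]
      ring
    · rw [map_zero, zero_mul]
      exact zero_mem _
    · intro x y _ _ hx hy
      rw [map_add, add_mul]
      exact add_mem hx hy
    · intro r x _ hx
      rw [smul_eq_mul, map_mul, mul_assoc, ← smul_YY]
      exact Submodule.smul_mem _ _ hx

variable [Fintype κ]

theorem mem_Y0 {y : YY K o κ} :
    y ∈ Y0 K o κ ↔ ∃ a b c,
      y = psiY K o κ a + psiY K o κ b * muY K o κ + psiY K o κ c * muY K o κ ^ 2 := by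
  constructor
  · rintro ⟨x, hx, rfl⟩
    have hx := mem_V3.1 hx
    obtain ⟨a, ha⟩ := exists_seg_eq_of_mem_segV (hx 0)
    obtain ⟨b, hb⟩ := exists_seg_eq_of_mem_segV (hx 1)
    obtain ⟨c, hc⟩ := exists_seg_eq_of_mem_segV (hx 2)
    refine ⟨a, b, c, ?_⟩
    rw [← thetaY_seg, ha, hb, hc]
    congr 1
    ext i : 1
    fin_cases i <;> rfl
  · rintro ⟨a, b, c, rfl⟩
    exact ⟨_, seg_mem_V3 a b c, thetaY_seg a b c⟩

theorem C0_le_Y0 : C0 K o κ ≤ Y0 K o κ := by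
  intro y hy
  obtain ⟨b, c, rfl⟩ := mem_C0.1 hy
  exact mem_Y0.2 ⟨b, c, 0, by rw [map_zero, zero_mul, add_zero]⟩

theorem psiY_mul_sq_mem_Y0 (a : AA K o κ) : psiY K o κ a * muY K o κ ^ 2 ∈ Y0 K o κ :=
  mem_Y0.2 ⟨0, 0, a, by rw [map_zero, zero_mul, zero_add, zero_add]⟩

variable (K o κ) in
noncomputable def phiN : AA K o κ →ₗ[AA K o κ]
    Y0 K o κ ⧸ (C0 K o κ).comap (Y0 K o κ).subtype :=
  ((C0 K o κ).comap (Y0 K o κ).subtype).mkQ ∘ₗ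
    (LinearMap.toSpanSingleton (AA K o κ) (YY K o κ) (muY K o κ ^ 2)).codRestrict (Y0 K o κ)
      fun a => by
        rw [LinearMap.toSpanSingleton_apply, smul_YY]
        exact psiY_mul_sq_mem_Y0 a

theorem phiN_apply (a : AA K o κ) : phiN K o κ a =
    Submodule.Quotient.mk ⟨psiY K o κ a * muY K o κ ^ 2, psiY_mul_sq_mem_Y0 a⟩ := by
  simp only [phiN, LinearMap.comp_apply, Submodule.mkQ_apply]
  exact congrArg Submodule.Quotient.mk (Subtype.ext (smul_YY K o κ a _))

theorem pdle_quotN :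
    PDLE (AA K o κ) (Y0 K o κ ⧸ (C0 K o κ).comap (Y0 K o κ).subtype)
      (3 * Fintype.card κ) ∧
    ∀ k, PDLE (AA K o κ) (Y0 K o κ ⧸ (C0 K o κ).comap (Y0 K o κ).subtype) k →
      3 * Fintype.card κ ≤ k := by
  have h := PDLE.coordinate_subspace K (Equiv.sumComm (κ × Fin 3) ((Fin 3 × Fin 3) ⊕ o))
    (phiN K o κ) ?_ ?_
  · rwa [Fintype.card_prod, Fintype.card_fin, mul_comm] at h
  · intro y
    obtain ⟨⟨y, hy⟩, rfl⟩ := Submodule.Quotient.mk_surjective _ y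
    obtain ⟨a, b, c, rfl⟩ := mem_Y0.1 hy
    refine ⟨c, ?_⟩
    rw [phiN_apply, Submodule.Quotient.eq, Submodule.mem_comap]
    refine mem_C0.2 ⟨-a, -b, ?_⟩
    rw [Submodule.subtype_apply, AddSubgroupClass.coe_sub, map_neg, map_neg]
    ring
  · ext a
    rw [LinearMap.mem_ker, phiN_apply, Submodule.Quotient.mk_eq_zero, Submodule.mem_comap]
    exact psiY_mul_sq_mem_C0 a

end quotN

section genIso

variable (K : Type u) [Field K] (o κ : Type)

open Polynomial in
noncomputable def genTo : GenMat K (Option o) (Fin 3 ⊕ κ) →+* (AA K o κ)[X] :=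
  MvPolynomial.eval₂Hom ((C : AA K o κ →+* (AA K o κ)[X]).comp MvPolynomial.C)
    (Sum.elim (fun w => w.elim X fun w => C (MvPolynomial.X (Sum.inl (Sum.inr w))))
      fun p => rowS K o κ p.1 p.2)

noncomputable def genCoeff : AA K o κ →+* GenMat K (Option o) (Fin 3 ⊕ κ) :=
  MvPolynomial.eval₂Hom MvPolynomial.C
    (Sum.elim (Sum.elim (fun p => MvPolynomial.X (Sum.inr (Sum.inl p.1, p.2)) +
      if p.1 = p.2 then MvPolynomial.X (Sum.inl none) else 0)
      fun w => MvPolynomial.X (Sum.inl (some w)))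
      fun p => MvPolynomial.X (Sum.inr (Sum.inr p.1, p.2)))

open Polynomial in
noncomputable def genFrom : (AA K o κ)[X] →+* GenMat K (Option o) (Fin 3 ⊕ κ) :=
  eval₂RingHom (genCoeff K o κ) (MvPolynomial.X (Sum.inl none))

theorem genTo_row (i : Fin 3 ⊕ κ) (j) :
    genTo K o κ (MvPolynomial.X (Sum.inr (i, j))) = rowS K o κ i j := by
  rw [genTo, MvPolynomial.eval₂Hom_X']
  rfl

theorem genTo_none : genTo K o κ (MvPolynomial.X (Sum.inl none)) = Polynomial.X := by
  rw [genTo, MvPolynomial.eval₂Hom_X']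
  rfl

theorem genTo_some (w : o) : genTo K o κ (MvPolynomial.X (Sum.inl (some w))) =
    Polynomial.C (MvPolynomial.X (Sum.inl (Sum.inr w))) := by
  rw [genTo, MvPolynomial.eval₂Hom_X']
  rfl

theorem genCoeff_alA (i j) : genCoeff K o κ (alA K o κ i j) =
    MvPolynomial.X (Sum.inr (Sum.inl i, j)) +
      if i = j then MvPolynomial.X (Sum.inl none) else 0 := by
  rw [genCoeff, alA, MvPolynomial.eval₂Hom_X']
  rfl

theorem genCoeff_gaA (k j) : genCoeff K o κ (gaA K o κ k j) =
    MvPolynomial.X (Sum.inr (Sum.inr k, j)) := by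
  rw [genCoeff, gaA, MvPolynomial.eval₂Hom_X']
  rfl

theorem genCoeff_inr (w : o) : genCoeff K o κ (MvPolynomial.X (Sum.inl (Sum.inr w))) =
    MvPolynomial.X (Sum.inl (some w)) := by
  rw [genCoeff, MvPolynomial.eval₂Hom_X']
  rfl

theorem genFrom_C (a) : genFrom K o κ (Polynomial.C a) = genCoeff K o κ a :=
  Polynomial.eval₂_C _ _

theorem genFrom_X : genFrom K o κ Polynomial.X = MvPolynomial.X (Sum.inl none) :=
  Polynomial.eval₂_X _ _

noncomputable def genIso : GenMat K (Option o) (Fin 3 ⊕ κ) ≃+* Polynomial (AA K o κ) :=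
  RingEquiv.ofRingHom (genTo K o κ) (genFrom K o κ)
    (by
      refine Polynomial.ringHom_ext' (MvPolynomial.ringHom_ext (fun r => ?_) fun i => ?_) ?_
      · simp only [RingHom.comp_apply, genFrom_C, RingHom.id_apply]
        rw [genCoeff, MvPolynomial.eval₂Hom_C, genTo, MvPolynomial.eval₂Hom_C]
        rfl
      · simp only [RingHom.comp_apply, genFrom_C, RingHom.id_apply]
        rcases i with (⟨i, j⟩ | w) | ⟨k, j⟩
        · refine (congrArg _ (genCoeff_alA K o κ i j)).trans ?_
          rw [map_add, genTo_row, apply_ite (genTo K o κ), genTo_none, map_zero]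
          exact sub_add_cancel _ _
        · rw [genCoeff_inr, genTo_some]
        · refine (congrArg _ (genCoeff_gaA K o κ k j)).trans ?_
          rw [genTo_row]
          rfl
      · rw [RingHom.comp_apply, genFrom_X, genTo_none, RingHom.id_apply])
    (by
      refine MvPolynomial.ringHom_ext (fun r => ?_) fun i => ?_
      · rw [RingHom.comp_apply, genTo, MvPolynomial.eval₂Hom_C, RingHom.comp_apply, genFrom_C,
          genCoeff, MvPolynomial.eval₂Hom_C]
        rfl
      · rw [RingHom.comp_apply, RingHom.id_apply]
        rcases i with (_ | w) | ⟨i | k, j⟩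
        · rw [genTo_none, genFrom_X]
        · rw [genTo_some, genFrom_C, genCoeff_inr]
        · rw [genTo_row]
          change genFrom K o κ (Polynomial.C (alA K o κ i j) - if i = j then Polynomial.X else 0) = _
          rw [map_sub, genFrom_C, genCoeff_alA, apply_ite (genFrom K o κ), genFrom_X, map_zero,
            add_sub_cancel_right]
        · rw [genTo_row]
          change genFrom K o κ (Polynomial.C (gaA K o κ k j)) = _
          rw [genFrom_C, genCoeff_gaA])

theorem genIso_rowDet (i j k : Fin 3 ⊕ κ) : genIso K o κ (rowDet K i j k) =
    det3 (rowS K o κ i) (rowS K o κ j) (rowS K o κ k) := by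
  change genTo K o κ _ = _
  have e : ∀ i, rowS K o κ i = fun j => genTo K o κ (MvPolynomial.X (Sum.inr (i, j))) :=
    fun i => funext fun j => (genTo_row K o κ i j).symm
  rw [e i, e j, e k]
  rw [rowDet, Matrix.det_fin_three]
  simp only [Matrix.of_apply, Matrix.cons_val, det3, map_add, map_sub, map_mul]
  ring

theorem map_detIdeal_genIso :
    (detIdeal K (Option o) (Set.univ : Set (Fin 3 ⊕ κ))).map (genIso K o κ) = detIdealS K o κ := by
  rw [detIdeal, Ideal.map_span, detIdealS]
  congr 1
  ext f
  constructor
  · rintro ⟨_, ⟨i, -, j, -, k, -, rfl⟩, rfl⟩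
    exact ⟨i, j, k, genIso_rowDet K o κ i j k⟩
  · rintro ⟨i, j, k, rfl⟩
    exact ⟨_, ⟨i, trivial, j, trivial, k, trivial, rfl⟩, genIso_rowDet K o κ i j k⟩

theorem pdle_detIdealS [Finite o] [Fintype κ] :
    PDLE (AA K o κ) (Polynomial (AA K o κ) ⧸ detIdealS K o κ) (Fintype.card κ + 2) := by
  have h := PDLE.quotient_map (genIso K o κ) (map_detIdeal_genIso K o κ)
    (pdle_detIdeal_univ K (o := Option o) (R := Fin 3 ⊕ κ))
  refine PDLE.restrictScalars (R' := Polynomial (AA K o κ)) (h.mono ?_)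
  rw [Nat.card_sum, Nat.card_eq_fintype_card, Nat.card_eq_fintype_card, Fintype.card_fin]
  omega

end genIso

theorem PDLE.comap_subtype_iff {R M : Type u} [CommRing R] [AddCommGroup M] [Module R M]
    {P Q : Submodule R M} (h : P ≤ Q) {n : ℕ} : PDLE R (P.comap Q.subtype) n ↔ PDLE R P n :=
  ⟨.of_equiv (Submodule.comapSubtypeEquivOfLe h), .of_equiv (Submodule.comapSubtypeEquivOfLe h).symm⟩

section conclude

open Polynomial

variable (K : Type u) [Field K] (o κ : Type)

/-- The ideal of the coefficient ring cut out by `detIdealS`. -/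
noncomputable def kalI : Ideal (AA K o κ) := (detIdealS K o κ).comap C

noncomputable def inclO : (AA K o κ ⧸ kalI K o κ) →ₗ[AA K o κ] (AA K o κ)[X] ⧸ detIdealS K o κ :=
  (kalI K o κ).liftQ (Algebra.linearMap (AA K o κ) ((AA K o κ)[X] ⧸ detIdealS K o κ))
    fun _ ha => Ideal.Quotient.eq_zero_iff_mem.2 ha

noncomputable def deltaBar : ((AA K o κ)[X] ⧸ detIdealS K o κ) →ₗ[AA K o κ] C0 K o κ :=
  ((detIdealS K o κ).restrictScalars (AA K o κ)).liftQ (deltaS K o κ).rangeRestrict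
      (fun _ hf => Subtype.ext (deltaS_eq_zero_of_mem hf)) ∘ₗ
    (Submodule.Quotient.restrictScalarsEquiv (AA K o κ) (detIdealS K o κ)).symm.toLinearMap

theorem deltaBar_mk (f : (AA K o κ)[X]) :
    deltaBar K o κ (Ideal.Quotient.mk _ f) = ⟨deltaS K o κ f, f, rfl⟩ := rfl

theorem inclO_mk (a : AA K o κ) :
    inclO K o κ (Ideal.Quotient.mk _ a) = Ideal.Quotient.mk _ (C a) := rfl

theorem inclO_injective : Function.Injective (inclO K o κ) := by
  rw [injective_iff_map_eq_zero]
  intro x hx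
  obtain ⟨a, rfl⟩ := Ideal.Quotient.mk_surjective x
  rw [inclO_mk, Ideal.Quotient.eq_zero_iff_mem] at hx
  exact Ideal.Quotient.eq_zero_iff_mem.2 hx

theorem deltaBar_surjective : Function.Surjective (deltaBar K o κ) := by
  rintro ⟨_, f, rfl⟩
  exact ⟨Ideal.Quotient.mk _ f, rfl⟩

theorem exact_inclO_deltaBar [Fintype κ] :
    Function.Exact (inclO K o κ) (deltaBar K o κ) := by
  intro x
  obtain ⟨f, rfl⟩ := Ideal.Quotient.mk_surjective x
  rw [deltaBar_mk, ← Subtype.coe_inj]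
  change deltaS K o κ f = 0 ↔ _
  rw [deltaS_eq_zero_iff, mem_constMod]
  constructor
  · rintro ⟨a, ha⟩
    refine ⟨Ideal.Quotient.mk _ a, ?_⟩
    rw [inclO_mk, eq_comm]
    exact Ideal.Quotient.eq.2 ha
  · rintro ⟨y, hy⟩
    obtain ⟨a, rfl⟩ := Ideal.Quotient.mk_surjective y
    rw [inclO_mk, eq_comm] at hy
    exact ⟨a, Ideal.Quotient.eq.1 hy⟩

theorem pdle_VV [Fintype o] (m : ℕ) (hm : 2 ≤ m) (j : ℕ) :
    PDLE (AA K o (Fin m)) (VV K o (Fin m) j) (3 * m - 3) := by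
  obtain rfl | h := eq_or_lt_of_le hm
  · have := segV_fin_two_pdle (K := K) (σ₀ := (Fin 3 × Fin 3) ⊕ o) (ι := Fin 3) j
    rwa [Fintype.card_fin] at this
  · have := segV_pdle_of_embedding (K := K) (σ₀ := (Fin 3 × Fin 3) ⊕ o)
      (Fin.castLEEmb (show 3 ≤ m by omega)) (j : ℤ)
    rwa [Fintype.card_fin, Fintype.card_fin, mul_comm] at this

theorem pdle_kalI [Fintype o] (m : ℕ) (hm : 2 ≤ m) :
    PDLE (AA K o (Fin m)) (AA K o (Fin m) ⧸ kalI K o (Fin m)) (3 * m - 2) ∧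
    ∀ k, PDLE (AA K o (Fin m)) (AA K o (Fin m) ⧸ kalI K o (Fin m)) k → 3 * m - 2 ≤ k := by
  have hD := pdle_detIdealS K o (Fin m)
  have hY := pdle_Y0 (pdle_VV K o m hm)
  obtain ⟨hN, hN'⟩ := pdle_quotN (K := K) (o := o) (κ := Fin m)
  rw [Fintype.card_fin] at hD hN hN'
  set P := (C0 K o (Fin m)).comap (Y0 K o (Fin m)).subtype with hP
  have h1 := P.injective_subtype
  have h2 := LinearMap.exact_subtype_mkQ P
  have h3 := P.mkQ_surjective
  have h4 := inclO_injective K o (Fin m)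
  have h5 := exact_inclO_deltaBar K o (Fin m)
  have h6 := deltaBar_surjective K o (Fin m)
  constructor
  · have hC := (PDLE.comap_subtype_iff C0_le_Y0).1 (PDLE.left h1 h2 h3 (hY.mono (show _ ≤ 3 * m - 1 by omega))
      (hN.mono (by omega)))
    exact PDLE.left h4 h5 h6 (hD.mono (by omega)) (hC.mono (by omega))
  · intro k hk
    by_contra! hlt
    have hC := (PDLE.comap_subtype_iff C0_le_Y0).2 (PDLE.right (n := 3 * m - 3) h4 h5 h6 (hk.mono (by omega))
      (hD.mono (by omega)))
    have := hN' _ (PDLE.right (n := 3 * m - 2) h1 h2 h3 (hC.mono (by omega)) (hY.mono (by omega)))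
    omega

end conclude

section points

variable {K : Type u} [Field K] {o κ : Type}

/-- The matrix with coordinates `x` has an eigenvector supported on the first three coordinates. -/
def EigPt (x : ((Fin 3 × Fin 3) ⊕ o) ⊕ κ × Fin 3 → K) : Prop :=
  ∃ (c : K) (v : Fin 3 → K), v ≠ 0 ∧
    (∀ i, ∑ j, x (Sum.inl (Sum.inl (i, j))) * v j = c * v i) ∧
    ∀ k, ∑ j, x (Sum.inr (k, j)) * v j = 0

theorem det3_eq_zero_of_mul_eq_zero {v : Fin 3 → K} (hv : v ≠ 0) {r s t : Fin 3 → K}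
    (hr : ∑ j, r j * v j = 0) (hs : ∑ j, s j * v j = 0) (ht : ∑ j, t j * v j = 0) :
    det3 r s t = 0 := by
  obtain ⟨i, hi⟩ := Function.ne_iff.1 hv
  refine (mul_eq_zero.1 (?_ : v i * det3 r s t = 0)).resolve_left hi
  rw [Fin.sum_univ_three] at hr hs ht
  rw [det3]
  fin_cases i
  · change v 0 * (r 0 * (s 1 * t 2 - s 2 * t 1) - r 1 * (s 0 * t 2 - s 2 * t 0) +
      r 2 * (s 0 * t 1 - s 1 * t 0)) = 0
    linear_combination (s 1 * t 2 - s 2 * t 1) * hr - (r 1 * t 2 - r 2 * t 1) * hs +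
      (r 1 * s 2 - r 2 * s 1) * ht
  · change v 1 * (r 0 * (s 1 * t 2 - s 2 * t 1) - r 1 * (s 0 * t 2 - s 2 * t 0) +
      r 2 * (s 0 * t 1 - s 1 * t 0)) = 0
    linear_combination -(s 0 * t 2 - s 2 * t 0) * hr + (r 0 * t 2 - r 2 * t 0) * hs -
      (r 0 * s 2 - r 2 * s 0) * ht
  · change v 2 * (r 0 * (s 1 * t 2 - s 2 * t 1) - r 1 * (s 0 * t 2 - s 2 * t 0) +
      r 2 * (s 0 * t 1 - s 1 * t 0)) = 0
    linear_combination (s 0 * t 1 - s 1 * t 0) * hr - (r 0 * t 1 - r 1 * t 0) * hs +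
      (r 0 * s 1 - r 1 * s 0) * ht

theorem eval_eq_zero_of_mem_kalI {x : ((Fin 3 × Fin 3) ⊕ o) ⊕ κ × Fin 3 → K} (hx : EigPt x)
    {f : AA K o κ} (hf : f ∈ kalI K o κ) : MvPolynomial.eval x f = 0 := by
  obtain ⟨c, v, hv, h1, h2⟩ := hx
  have hle : detIdealS K o κ ≤
      RingHom.ker (Polynomial.eval₂RingHom (MvPolynomial.eval x : AA K o κ →+* K) c) := by
    refine Ideal.span_le.2 ?_
    rintro _ ⟨i, j, k, rfl⟩
    refine (map_det3 _ _ _ _).trans ?_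
    have h : ∀ i, ∑ j, (Polynomial.eval₂RingHom (MvPolynomial.eval x : AA K o κ →+* K) c)
        (rowS K o κ i j) * v j = 0 := by
      rintro (i | k)
      · have e : ∀ j, (Polynomial.eval₂RingHom (MvPolynomial.eval x : AA K o κ →+* K) c)
          (rowS K o κ (Sum.inl i) j) = x (Sum.inl (Sum.inl (i, j))) - if i = j then c else 0 := by
          intro j
          change Polynomial.eval₂RingHom _ c (Polynomial.C (alA K o κ i j) -
            if i = j then Polynomial.X else 0) = _
          rw [map_sub, Polynomial.coe_eval₂RingHom, Polynomial.eval₂_C, alA,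
            MvPolynomial.eval_X]
          split <;> simp
        simp only [e, sub_mul, Finset.sum_sub_distrib, h1, ite_mul, zero_mul, Finset.sum_ite_eq,
          Finset.mem_univ, if_true, sub_self]
      · have e : ∀ j, (Polynomial.eval₂RingHom (MvPolynomial.eval x : AA K o κ →+* K) c)
          (rowS K o κ (Sum.inr k) j) = x (Sum.inr (k, j)) := by
          intro j
          change Polynomial.eval₂RingHom _ c (Polynomial.C (gaA K o κ k j)) = _
          rw [Polynomial.coe_eval₂RingHom, Polynomial.eval₂_C, gaA, MvPolynomial.eval_X]
        simp only [e, h2]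
    exact det3_eq_zero_of_mul_eq_zero hv (h i) (h j) (h k)
  have h0 : Polynomial.eval₂RingHom (MvPolynomial.eval x : AA K o κ →+* K) c (Polynomial.C f) = 0 :=
    hle hf
  rwa [Polynomial.coe_eval₂RingHom, Polynomial.eval₂_C] at h0

theorem genFrom_mem_iff (f : Polynomial (AA K o κ)) :
    genFrom K o κ f ∈ detIdeal K (Option o) (Set.univ : Set (Fin 3 ⊕ κ)) ↔
      f ∈ detIdealS K o κ := by
  rw [← map_detIdeal_genIso, Ideal.mem_map_of_equiv]
  constructor
  · intro h
    exact ⟨_, h, (genIso K o κ).apply_symm_apply f⟩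
  · rintro ⟨g, hg, rfl⟩
    have : genFrom K o κ (genIso K o κ g) = g := (genIso K o κ).symm_apply_apply g
    rwa [this]

theorem mem_kalI_of_eval [Infinite K] [Finite κ] {f : AA K o κ}
    (hf : ∀ x, EigPt x → MvPolynomial.eval x f = 0) : f ∈ kalI K o κ := by
  change Polynomial.C f ∈ detIdealS K o κ
  rw [← genFrom_mem_iff, ← chart_eq_zero_iff K _ Set.finite_univ, genFrom_C]
  refine MvPolynomial.funext fun q => ?_
  rw [map_zero]
  let F : GenMat K (Option o) (Fin 3 ⊕ κ) →+* K := (MvPolynomial.eval q).comp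
    (chart K (Option o) (Set.univ : Set (Fin 3 ⊕ κ)) :
      GenMat K (Option o) (Fin 3 ⊕ κ) →+* ChartRing K (Option o) (Fin 3 ⊕ κ))
  have hF2 : ∀ i, F (MvPolynomial.X (Sum.inr (i, 2))) =
      q none * F (MvPolynomial.X (Sum.inr (i, 0))) +
      q (some none) * F (MvPolynomial.X (Sum.inr (i, 1))) := by
    intro i
    change MvPolynomial.eval q (chart K _ _ _) = _ * MvPolynomial.eval q (chart K _ _ _) +
      _ * MvPolynomial.eval q (chart K _ _ _)
    rw [chart_two_mem K (Set.mem_univ i), chart_zero, chart_one, map_add, map_mul, map_mul,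
      MvPolynomial.eval_X, MvPolynomial.eval_X]
  let x : ((Fin 3 × Fin 3) ⊕ o) ⊕ κ × Fin 3 → K :=
    fun t => F (genCoeff K o κ (MvPolynomial.X t))
  have hx : F.comp (genCoeff K o κ) = MvPolynomial.eval x := by
    refine MvPolynomial.ringHom_ext (fun r => ?_) fun t => ?_
    · rw [MvPolynomial.eval_C, RingHom.comp_apply, genCoeff, MvPolynomial.eval₂Hom_C]
      change MvPolynomial.eval q (chart K _ _ (MvPolynomial.C r)) = _
      rw [← MvPolynomial.algebraMap_eq, AlgHom.commutes, MvPolynomial.algebraMap_eq,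
        MvPolynomial.eval_C]
    · rw [MvPolynomial.eval_X]
      rfl
  have h := hf x ?_
  · rw [← hx] at h
    exact h
  · refine ⟨F (MvPolynomial.X (Sum.inl none)), ![q none, q (some none), -1], ?_, ?_, ?_⟩
    · intro h
      have := congrFun h 2
      simp at this
    · intro i
      have e : ∀ j, x (Sum.inl (Sum.inl (i, j))) = F (MvPolynomial.X (Sum.inr (Sum.inl i, j))) +
          if i = j then F (MvPolynomial.X (Sum.inl none)) else 0 := by
        intro j
        refine (congrArg F (genCoeff_alA K o κ i j)).trans ?_
        rw [map_add, apply_ite F, map_zero]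
      simp only [e, add_mul, Finset.sum_add_distrib, ite_mul, zero_mul, Finset.sum_ite_eq,
          Finset.mem_univ, if_true]
      rw [Fin.sum_univ_three, hF2, add_eq_right]
      simp only [Matrix.cons_val_zero, Matrix.cons_val_one, Matrix.cons_val]
      ring
    · intro k
      have e : ∀ j, x (Sum.inr (k, j)) = F (MvPolynomial.X (Sum.inr (Sum.inr k, j))) :=
        fun j => congrArg F (genCoeff_gaA K o κ k j)
      rw [Fin.sum_univ_three, e, e, e, hF2]
      simp only [Matrix.cons_val_zero, Matrix.cons_val_one, Matrix.cons_val]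
      ring

theorem mem_kalI_iff [Infinite K] [Finite κ] {f : AA K o κ} :
    f ∈ kalI K o κ ↔ ∀ x, EigPt x → MvPolynomial.eval x f = 0 :=
  ⟨fun hf _ hx => eval_eq_zero_of_mem_kalI hx hf, mem_kalI_of_eval⟩

end points

section transfer

/-- The coordinates of a block matrix, separated according to the blocks `α`, `γ` and the rest. -/
def blockEquiv (ι κ : Type) :
    ((ι × ι) ⊕ (ι ⊕ κ) × κ) ⊕ κ × ι ≃ (ι ⊕ κ) × (ι ⊕ κ) where
  toFun
    | Sum.inl (Sum.inl (i, j)) => (Sum.inl i, Sum.inl j)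
    | Sum.inl (Sum.inr (p, j)) => (p, Sum.inr j)
    | Sum.inr (k, j) => (Sum.inr k, Sum.inl j)
  invFun
    | (Sum.inl i, Sum.inl j) => Sum.inl (Sum.inl (i, j))
    | (p, Sum.inr j) => Sum.inl (Sum.inr (p, j))
    | (Sum.inr k, Sum.inl j) => Sum.inr (k, j)
  left_inv := by rintro ((⟨i, j⟩ | ⟨_ | _, j⟩) | ⟨k, j⟩) <;> rfl
  right_inv := by rintro ⟨i | k, j | l⟩ <;> rfl

def coordEquiv (m : ℕ) :
    ((Fin 3 × Fin 3) ⊕ (Fin 3 ⊕ Fin m) × Fin m) ⊕ Fin m × Fin 3 ≃ Fin (3 + m) × Fin (3 + m) :=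
  (blockEquiv (Fin 3) (Fin m)).trans (finSumFinEquiv.prodCongr finSumFinEquiv)

theorem mem_kalmanSet_iff {K : Type u} [Field K] {m : ℕ}
    (M : Matrix (Fin (3 + m)) (Fin (3 + m)) K) : M ∈ kalmanSet K (3 + m) 3 1 ↔
      EigPt fun t => M (coordEquiv m t).1 (coordEquiv m t).2 := by
  change _ ↔ ∃ (c : K) (v : Fin 3 → K), v ≠ 0 ∧
    (∀ i, ∑ j, M (Fin.castAdd m i) (Fin.castAdd m j) * v j = c * v i) ∧
    ∀ k, ∑ j, M (Fin.natAdd 3 k) (Fin.castAdd m j) * v j = 0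
  have hsum : ∀ (w : Fin (3 + m) → K) (hw : ∀ k, w (Fin.natAdd 3 k) = 0) (i),
      M.mulVec w i = ∑ j, M i (Fin.castAdd m j) * w (Fin.castAdd m j) := by
    intro w hw i
    rw [Matrix.mulVec, dotProduct, Fin.sum_univ_add]
    simp [hw]
  constructor
  · rintro ⟨U, hU, h1, hM⟩
    obtain ⟨⟨w, hwU⟩, hw0, hw⟩ := finrank_eq_one_iff'.1 h1
    have hL : ∀ k, w (Fin.natAdd 3 k) = 0 := fun k => hU hwU _ (by simp)
    obtain ⟨c, hc⟩ := hw ⟨_, hM w hwU⟩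
    have hc : c • w = M.mulVec w := congrArg Subtype.val hc
    refine ⟨c, fun j => w (Fin.castAdd m j), ?_, ?_, ?_⟩
    · intro h
      refine hw0 (Subtype.ext (funext fun i => ?_))
      induction i using Fin.addCases with
      | left i => exact congrFun h i
      | right i => exact hL i
    · intro i
      rw [← hsum w hL, ← hc]
      rfl
    · intro k
      rw [← hsum w hL, ← hc, Pi.smul_apply, hL, smul_zero]
  · rintro ⟨c, v, hv, h1, h2⟩
    let w : Fin (3 + m) → K := Fin.append v 0
    have hw1 : ∀ j, w (Fin.castAdd m j) = v j := fun j => Fin.append_left _ _ j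
    have hw2 : ∀ j, w (Fin.natAdd 3 j) = 0 := fun j => Fin.append_right _ _ j
    have hw0 : w ≠ 0 := fun h => hv (funext fun j => (hw1 j).symm.trans (congrFun h _))
    have hMw : M.mulVec w = c • w := by
      ext i
      rw [hsum w hw2, Pi.smul_apply, smul_eq_mul]
      simp only [hw1]
      induction i using Fin.addCases with
      | left i => rw [h1, hw1]
      | right i => rw [h2, hw2, mul_zero]
    refine ⟨Submodule.span K {w}, ?_, finrank_span_singleton hw0, ?_⟩
    · rw [Submodule.span_singleton_le_iff_mem]
      intro i hi
      induction i using Fin.addCases with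
      | left i => simp at hi; omega
      | right i => exact hw2 i
    · intro x hx
      obtain ⟨a, rfl⟩ := Submodule.mem_span_singleton.1 hx
      rw [Matrix.mulVec_smul, hMw]
      exact Submodule.smul_mem _ _ (Submodule.smul_mem _ _ (Submodule.mem_span_singleton_self w))

theorem rename_mem_kalmanIdeal_iff {K : Type u} [Field K] [Infinite K] {m : ℕ}
    (f : AA K ((Fin 3 ⊕ Fin m) × Fin m) (Fin m)) :
    MvPolynomial.rename (coordEquiv m) f ∈ kalmanIdeal K (3 + m) 3 1 ↔
      f ∈ kalI K ((Fin 3 ⊕ Fin m) × Fin m) (Fin m) := by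
  rw [mem_kalI_iff]
  change (∀ M ∈ kalmanSet K (3 + m) 3 1, MvPolynomial.eval _ _ = 0) ↔ _
  simp only [mem_kalmanSet_iff, MvPolynomial.eval_rename]
  constructor
  · intro h x hx
    have := h (fun i j => x ((coordEquiv m).symm (i, j))) (by simpa using hx)
    simpa [Function.comp_def] using this
  · intro h M hM
    exact h _ hM

theorem map_kalI {K : Type u} [Field K] [Infinite K] (m : ℕ) :
    (kalI K ((Fin 3 ⊕ Fin m) × Fin m) (Fin m)).map
      (MvPolynomial.renameEquiv K (coordEquiv m)).toRingEquiv = kalmanIdeal K (3 + m) 3 1 := by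
  ext f
  obtain ⟨g, rfl⟩ := (MvPolynomial.renameEquiv K (coordEquiv m)).surjective f
  refine Iff.trans ?_ (rename_mem_kalmanIdeal_iff g).symm
  rw [Ideal.mem_map_of_equiv]
  constructor
  · rintro ⟨x, hx, h⟩
    rwa [← (MvPolynomial.renameEquiv K (coordEquiv m)).injective h]
  · intro h
    exact ⟨g, h, rfl⟩

theorem pdle_kalmanCoordRing_iff {K : Type u} [Field K] [Infinite K] {m k : ℕ} :
    PDLE (MatCoordRing K (3 + m)) (KalmanCoordRing K (3 + m) 3 1) k ↔
      PDLE (AA K ((Fin 3 ⊕ Fin m) × Fin m) (Fin m))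
        (AA K ((Fin 3 ⊕ Fin m) × Fin m) (Fin m) ⧸ kalI K ((Fin 3 ⊕ Fin m) × Fin m) (Fin m)) k := by
  constructor
  · refine PDLE.quotient_map (MvPolynomial.renameEquiv K (coordEquiv m)).toRingEquiv.symm ?_
    rw [← map_kalI]
    exact Ideal.map_of_equiv _
  · exact PDLE.quotient_map (MvPolynomial.renameEquiv K (coordEquiv m)).toRingEquiv (map_kalI m)

end transfer

section hypersurface

theorem PDLE.quotient_of_eq_span {R : Type u} [CommRing R] [IsDomain R] {I : Ideal R}
    [I.IsPrime] {p : R} (hp : p ≠ 0) (hI : I = Ideal.span {p}) :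
    PDLE R (R ⧸ I) 1 ∧ ∀ k, PDLE R (R ⧸ I) k → 1 ≤ k := by
  have hpI : p ∈ I := hI ▸ Ideal.mem_span_singleton_self p
  constructor
  · refine PDLE.right (f := LinearMap.mulLeft R p) (g := I.mkQ) ?_ ?_ (Submodule.mkQ_surjective I)
      (PDLE.of_projective 0) (PDLE.of_projective 1)
    · exact fun a b h => mul_left_cancel₀ hp h
    · intro x
      rw [Submodule.mkQ_apply, Submodule.Quotient.mk_eq_zero]
      conv_lhs => rw [hI]
      rw [Ideal.mem_span_singleton']
      exact ⟨fun ⟨a, ha⟩ => ⟨a, (mul_comm _ _).trans ha⟩, fun ⟨a, ha⟩ => ⟨a, (mul_comm _ _).trans ha⟩⟩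
  · intro k hk
    by_contra h0
    obtain rfl : k = 0 := by omega
    have := PDLE.zero_iff.1 hk
    obtain ⟨s, hs⟩ := Module.projective_lifting_property (I.mkQ) LinearMap.id
      (Submodule.mkQ_surjective I)
    have h1 : p • s (I.mkQ 1) = 0 := by
      rw [← map_smul, ← map_smul, Submodule.mkQ_apply,
        (Submodule.Quotient.mk_eq_zero I).2 (by simpa using hpI), map_zero]
    have h2 : s (I.mkQ 1) = 0 := (mul_eq_zero.1 h1).resolve_left hp
    have h3 : I.mkQ (s (I.mkQ 1)) = I.mkQ 1 := LinearMap.congr_fun hs _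
    rw [h2, map_zero, eq_comm, Submodule.mkQ_apply, Submodule.Quotient.mk_eq_zero] at h3
    exact (Ideal.ne_top_iff_one I).1 (Ideal.IsPrime.ne_top') h3

theorem Ideal.exists_eq_span_singleton {R : Type u} [CommRing R] [IsDomain R]
    [UniqueFactorizationMonoid R] {I : Ideal R} [hI : I.IsPrime] {d : R} (hd : d ≠ 0) (hdI : d ∈ I)
    (h : I ≤ (Ideal.span {d}).radical) : ∃ p, p ≠ 0 ∧ I = Ideal.span {p} := by
  obtain ⟨f, hf, hfd⟩ := UniqueFactorizationMonoid.exists_prime_factors d hd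
  obtain ⟨p, hp, hpI⟩ := (hI.multiset_prod_mem_iff_exists_mem f).1
    ((I.mem_iff_of_associated hfd).2 hdI)
  have := (Ideal.span_singleton_prime (hf p hp).ne_zero).2 (hf p hp)
  refine ⟨p, (hf p hp).ne_zero, le_antisymm (h.trans ?_) (I.span_singleton_le_iff_mem.2 hpI)⟩
  rw [this.radical_le_iff, Ideal.span_singleton_le_span_singleton]
  exact (Multiset.dvd_prod hp).trans hfd.dvd

end hypersurface

section coplanar

variable {R : Type u} [CommRing R]

theorem rowT_cayley_hamilton (a : Fin 3 → Fin 3 → R) (w : Fin 3 → R) (j : Fin 3) :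
    rowT a (rowT a (rowT a w)) j =
      chE1 a * rowT a (rowT a w) j - chE2 a * rowT a w j + chE3 a * w j := by
  simp only [rowT, chE1, chE2, chE3]
  fin_cases j <;> ring!

theorem rowT_mul_eq (a : Fin 3 → Fin 3 → R) (w v : Fin 3 → R) :
    ∑ j, rowT a w j * v j = ∑ i, w i * ∑ j, a i j * v j := by
  simp only [Fin.sum_univ_three, rowT]
  ring

theorem exists_eigenvector {K : Type u} [Field K] [IsAlgClosed K] (a : Fin 3 → Fin 3 → K)
    (w : Fin 3 → K) (h : det3 w (rowT a w) (rowT a (rowT a w)) = 0) :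
    ∃ (c : K) (v : Fin 3 → K), v ≠ 0 ∧ (∀ i, ∑ j, a i j * v j = c * v i) ∧
      ∑ j, w j * v j = 0 := by
  let M : Matrix (Fin 3) (Fin 3) K := Matrix.of ![w, rowT a w, rowT a (rowT a w)]
  obtain ⟨v, hv, hMv⟩ := Matrix.exists_mulVec_eq_zero_iff.2 (show M.det = 0 by
    rw [← h, Matrix.det_fin_three, det3]
    simp [M]
    ring)
  let α : (Fin 3 → K) →ₗ[K] (Fin 3 → K) := (Matrix.of a).mulVecLin
  let N := LinearMap.ker M.mulVecLin
  have hN : ∀ x, x ∈ N ↔ ∑ j, w j * x j = 0 ∧ ∑ j, rowT a w j * x j = 0 ∧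
      ∑ j, rowT a (rowT a w) j * x j = 0 := by
    intro x
    rw [LinearMap.mem_ker, Matrix.mulVecLin_apply, funext_iff, Fin.forall_fin_succ,
      Fin.forall_fin_succ, Fin.forall_fin_one]
    rfl
  have hα : ∀ x ∈ N, α x ∈ N := by
    intro x hx
    rw [hN] at hx ⊢
    have e : ∀ r : Fin 3 → K, ∑ j, r j * α x j = ∑ j, rowT a r j * x j :=
      fun r => (rowT_mul_eq a r x).symm
    refine ⟨(e _).trans hx.2.1, (e _).trans hx.2.2, (e _).trans ?_⟩
    simp only [rowT_cayley_hamilton, add_mul, sub_mul, Finset.sum_add_distrib,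
      Finset.sum_sub_distrib, mul_assoc, ← Finset.mul_sum, hx, mul_zero, sub_zero, add_zero]
  have : Nontrivial N := ⟨⟨v, hMv⟩, 0, fun h => hv (congrArg Subtype.val h)⟩
  obtain ⟨c, hc⟩ := Module.End.exists_eigenvalue (α.restrict hα)
  obtain ⟨x, hx⟩ := hc.exists_hasEigenvector
  refine ⟨c, x.1, fun h => hx.2 (Subtype.ext h), fun i => ?_, ((hN _).1 x.2).1⟩
  exact congrFun (congrArg Subtype.val hx.apply_eq_smul) i

end coplanar

section oneRow

variable (K : Type u) [Field K] (o : Type)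

instance kalI_isPrime (κ : Type) [Finite κ] [Infinite K] : (kalI K o κ).IsPrime := by
  have key : ∀ f, f ∈ kalI K o κ ↔
      chart K (Option o) (Set.univ : Set (Fin 3 ⊕ κ)) (genCoeff K o κ f) = 0 := by
    intro f
    change Polynomial.C f ∈ detIdealS K o κ ↔ _
    rw [← genFrom_mem_iff, ← chart_eq_zero_iff K _ Set.finite_univ, genFrom_C]
  refine ⟨fun h => ?_, fun {f g} hfg => ?_⟩
  · have := (key 1).1 (h ▸ Submodule.mem_top)
    rw [map_one, map_one] at this
    exact one_ne_zero this
  · rw [key, map_mul, map_mul, mul_eq_zero] at hfg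
    rwa [key, key]

/-- The determinant of the reduced Kalman matrix with rows `γ`, `γα` and `γα²`. -/
noncomputable def kalDet : AA K o (Fin 1) :=
  det3 (gaA K o (Fin 1) 0) (rowT (alA K o (Fin 1)) (gaA K o (Fin 1) 0))
    (rowT (alA K o (Fin 1)) (rowT (alA K o (Fin 1)) (gaA K o (Fin 1) 0)))

variable {K o}

theorem eval_kalDet (x : ((Fin 3 × Fin 3) ⊕ o) ⊕ Fin 1 × Fin 3 → K) :
    MvPolynomial.eval x (kalDet K o) =
      det3 (fun j => x (Sum.inr (0, j)))
        (rowT (fun i j => x (Sum.inl (Sum.inl (i, j)))) fun j => x (Sum.inr (0, j)))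
        (rowT (fun i j => x (Sum.inl (Sum.inl (i, j))))
          (rowT (fun i j => x (Sum.inl (Sum.inl (i, j)))) fun j => x (Sum.inr (0, j)))) := by
  have hg : ∀ j, MvPolynomial.eval x (gaA K o (Fin 1) 0 j) = x (Sum.inr (0, j)) :=
    fun j => MvPolynomial.eval_X _
  have ha : ∀ i j, MvPolynomial.eval x (alA K o (Fin 1) i j) = x (Sum.inl (Sum.inl (i, j))) :=
    fun i j => MvPolynomial.eval_X _
  simp only [kalDet, det3, rowT, map_add, map_sub, map_mul, hg, ha]

theorem eval_kalDet_eq_zero_iff [IsAlgClosed K] (x : ((Fin 3 × Fin 3) ⊕ o) ⊕ Fin 1 × Fin 3 → K) :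
    MvPolynomial.eval x (kalDet K o) = 0 ↔ EigPt x := by
  rw [eval_kalDet]
  constructor
  · intro h
    obtain ⟨c, v, hv, h1, h2⟩ := exists_eigenvector _ _ h
    refine ⟨c, v, hv, h1, fun k => ?_⟩
    rw [Subsingleton.elim k 0]
    exact h2
  · rintro ⟨c, v, hv, h1, h2⟩
    have e : ∀ w : Fin 3 → K, ∑ j, w j * v j = 0 →
        ∑ j, rowT (fun i j => x (Sum.inl (Sum.inl (i, j)))) w j * v j = 0 := by
      intro w hw
      rw [rowT_mul_eq]
      simp only [h1, mul_left_comm _ c, ← Finset.mul_sum, hw, mul_zero]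
    exact det3_eq_zero_of_mul_eq_zero hv (h2 0) (e _ (h2 0)) (e _ (e _ (h2 0)))

variable (K o) in
theorem kalDet_ne_zero : kalDet K o ≠ 0 := by
  intro h
  let x : ((Fin 3 × Fin 3) ⊕ o) ⊕ Fin 1 × Fin 3 → K :=
    Sum.elim (Sum.elim (fun p => if p.2 = p.1 + 1 then 1 else 0) 0) (fun p => if p.2 = 0 then 1 else 0)
  have := eval_kalDet x
  rw [h, map_zero] at this
  simp [det3, rowT, x] at this

theorem kalI_le_radical [IsAlgClosed K] [Finite o] :
    kalI K o (Fin 1) ≤ (Ideal.span {kalDet K o}).radical := by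
  intro f hf
  rw [← MvPolynomial.vanishingIdeal_zeroLocus_eq_radical (K := K)]
  intro x hx
  have h : MvPolynomial.eval x (kalDet K o) = 0 := by
    simpa using hx _ (Ideal.mem_span_singleton_self _)
  have := mem_kalI_iff.1 hf x ((eval_kalDet_eq_zero_iff x).1 h)
  simpa using this

variable (K o) in
theorem pdle_kalI_one [IsAlgClosed K] [Finite o] :
    PDLE (AA K o (Fin 1)) (AA K o (Fin 1) ⧸ kalI K o (Fin 1)) 1 ∧
      ∀ k, PDLE (AA K o (Fin 1)) (AA K o (Fin 1) ⧸ kalI K o (Fin 1)) k → 1 ≤ k := by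
  have : Infinite K := IsAlgClosed.instInfinite
  obtain ⟨p, hp, h⟩ := Ideal.exists_eq_span_singleton (kalDet_ne_zero K o)
    (mem_kalI_iff.2 fun x hx => (eval_kalDet_eq_zero_iff x).2 hx) kalI_le_radical
  exact PDLE.quotient_of_eq_span hp h

end oneRow

theorem stmt11 (K : Type u) [Field K] [IsAlgClosed K] (n : ℕ) (hn : 4 ≤ n) :
    projDimEq (MatCoordRing K n) (KalmanCoordRing K n 3 1) (3 * n - 11) := by
  have : Infinite K := IsAlgClosed.instInfinite
  obtain ⟨m, rfl⟩ := Nat.exists_eq_add_of_le (show 3 ≤ n by omega)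
  simp only [projDimEq, projDimLE_iff, pdle_kalmanCoordRing_iff]
  rw [show 3 * (3 + m) - 11 = 3 * m - 2 by omega]
  obtain rfl | hm : m = 1 ∨ 2 ≤ m := by omega
  · exact pdle_kalI_one K _
  · exact pdle_kalI K _ m hm
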